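/- arXiv:2512.07373 — 15 statements merged into one kernel-verified Lean document; each statement's English description precedes it below -/
import Mathlib

section
/- Let A₊, A₋ ⊆ ℤⁿ be disjoint finite sets with A := A₊ ∪ A₋, A₋ ≠ ∅, and such that every extreme point of conv(A) belongs to A₊. Let Γ be the smallest nonempty face of conv(A) containing A₋, i.e. Γ is a nonempty face of conv(A) with A₋ ⊆ Γ and Γ ⊆ Γ'' for every nonempty face Γ'' of conv(A) with A₋ ⊆ Γ''. Let J be the set of nonempty faces Γ' of Γ with Γ' ∩ A₋ ≠ ∅. Fix coefficients c_a > 0 (a ∈ A) and a height function h : A → ℤ with h(a) = 0 for a ∈ A₊ and h(b) > 0 for b ∈ A₋. For t > 0 and Γ' ∈ J define the truncated Viro signomial f_t^{Γ'}(x) = ∑_{a ∈ A₊∩Γ'} c_a x^a − ∑_{b ∈ A₋∩Γ'} c_b t^{h(b)} x^b on ℝⁿ_{>0}, and set S := {t > 0 : f_t^{Γ'} has a positive singular zero for some Γ' ∈ J}. Then: (i) S has a minimum t_*; and (ii) the signomial f(x) = ∑_{a∈A₊} c_a x^a − ∑_{b∈A₋} c_b x^b is copositive if and only if t_* ≥ 1.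 -/
open Finset

attribute [local instance] Classical.propDecidable

/-- Real coordinates of an integer lattice point. -/
def coeR {n : ℕ} (a : Fin n → ℤ) : Fin n → ℝ := fun i => (a i : ℝ)

/-- The exponential sum `∑ a ∈ S, d a * exp ⟨a, u⟩`. -/
noncomputable def expSum {n : ℕ} (S : Finset (Fin n → ℤ)) (d : (Fin n → ℤ) → ℝ)
    (u : Fin n → ℝ) : ℝ :=
  ∑ a ∈ S, d a * Real.exp (∑ j, (a j : ℝ) * u j)

/-- The signed coefficient of the exponent `a` in the Viro signomial with parameter `t`. -/
noncomputable def viroCoeff {n : ℕ} (Ap : Finset (Fin n → ℤ)) (c : (Fin n → ℤ) → ℝ)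
    (h : (Fin n → ℤ) → ℤ) (t : ℝ) (a : Fin n → ℤ) : ℝ :=
  if a ∈ Ap then c a else -(c a * t ^ h a)

theorem prod_zpow_eq_exp {n : ℕ} (x : Fin n → ℝ) (hx : ∀ i, 0 < x i) (a : Fin n → ℤ) :
    ∏ j, x j ^ a j = Real.exp (∑ j, (a j : ℝ) * Real.log (x j)) := by
  rw [Real.exp_sum]
  refine Finset.prod_congr rfl fun j _ => ?_
  rw [← Real.log_zpow, Real.exp_log (zpow_pos (hx j) _)]

theorem sum_viroCoeff {n : ℕ} {Ap Am : Finset (Fin n → ℤ)} (hdisj : Disjoint Ap Am)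
    (c : (Fin n → ℤ) → ℝ) (h : (Fin n → ℤ) → ℤ) (t : ℝ) (q : (Fin n → ℤ) → Prop)
    (g : (Fin n → ℤ) → ℝ) :
    ∑ a ∈ (Ap ∪ Am).filter q, viroCoeff Ap c h t a * g a =
      ∑ a ∈ Ap.filter q, c a * g a - ∑ b ∈ Am.filter q, c b * t ^ h b * g b := by
  rw [Finset.filter_union, Finset.sum_union (Finset.disjoint_filter_filter hdisj), sub_eq_add_neg,
    ← Finset.sum_neg_distrib]
  congr 1
  · refine Finset.sum_congr rfl fun a ha => ?_
    rw [viroCoeff, if_pos (Finset.mem_filter.1 ha).1]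
  · refine Finset.sum_congr rfl fun a ha => ?_
    rw [viroCoeff, if_neg (Finset.disjoint_right.1 hdisj (Finset.mem_filter.1 ha).1)]
    ring

/-- Nonnegativity of an exponential sum passes to its truncations to exposed faces. -/
theorem expSum_filter_nonneg {n : ℕ} (S : Finset (Fin n → ℤ)) (d : (Fin n → ℤ) → ℝ)
    {K F : Set (Fin n → ℝ)} (hSK : ∀ a ∈ S, coeR a ∈ K) (hF : IsExposed ℝ K F)
    (hne : F.Nonempty) (hnn : ∀ u, 0 ≤ expSum S d u) (u : Fin n → ℝ) :
    0 ≤ expSum (S.filter fun a => coeR a ∈ F) d u := by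
  obtain ⟨l, hl⟩ := hF hne
  obtain ⟨x₀, hx₀⟩ := hne
  have hx₀' := hx₀
  rw [hl] at hx₀'
  set v : Fin n → ℝ := fun j => l (Pi.single j 1) with hv
  have hlv : ∀ x : Fin n → ℝ, ∑ j, x j * v j = l x := fun x => by
    conv_rhs => rw [pi_eq_sum_univ' x]
    simp [hv, map_sum]
  have hlim : Filter.Tendsto (fun r : ℝ => ∑ a ∈ S, d a * Real.exp (∑ j, (a j : ℝ) * u j) *
      Real.exp (r * (l (coeR a) - l x₀))) Filter.atTop
      (nhds (∑ a ∈ S, if coeR a ∈ F then d a * Real.exp (∑ j, (a j : ℝ) * u j) else 0)) := by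
    refine tendsto_finsetSum _ fun a ha => ?_
    have hle := hx₀'.2 _ (hSK a ha)
    split_ifs with haF
    · have : l (coeR a) - l x₀ = 0 := by
        rw [hl] at haF
        linarith [haF.2 _ hx₀'.1]
      simp [this]
    · have hlt : l (coeR a) - l x₀ < 0 := by
        by_contra hcon
        refine haF ?_
        rw [hl]
        exact ⟨hSK a ha, fun y hy => (hx₀'.2 y hy).trans (by linarith)⟩
      rw [← mul_zero (d a * Real.exp (∑ j, (a j : ℝ) * u j))]
      refine Filter.Tendsto.const_mul _ (Real.tendsto_exp_atBot.comp ?_)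
      exact Filter.tendsto_id.atTop_mul_const_of_neg hlt
  rw [expSum, Finset.sum_filter]
  refine ge_of_tendsto' hlim fun r => ?_
  have key := mul_nonneg (hnn (u + r • v)) (Real.exp_pos (-(r * l x₀))).le
  rw [expSum, Finset.sum_mul] at key
  refine key.trans_eq (Finset.sum_congr rfl fun a _ => ?_)
  rw [mul_assoc, mul_assoc, ← Real.exp_add, ← Real.exp_add]
  congr 2
  have := hlv (coeR a)
  simp only [coeR] at this
  simp only [Pi.add_apply, Pi.smul_apply, smul_eq_mul, mul_add, Finset.sum_add_distrib,
    mul_left_comm _ r, ← Finset.mul_sum, this]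
  ring

/-- A zero of a nonnegative exponential sum is a critical point. -/
theorem expSum_critical {n : ℕ} (S : Finset (Fin n → ℤ)) (d : (Fin n → ℤ) → ℝ)
    (hnn : ∀ u, 0 ≤ expSum S d u) {u : Fin n → ℝ} (hu : expSum S d u = 0) (i : Fin n) :
    ∑ a ∈ S, d a * ((a i : ℝ) * Real.exp (∑ j, (a j : ℝ) * u j)) = 0 := by
  have hshift : ∀ s : ℝ, expSum S d (u + s • Pi.single i 1) =
      ∑ a ∈ S, d a * (Real.exp (∑ j, (a j : ℝ) * u j) * Real.exp (s * a i)) := fun s => by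
    refine Finset.sum_congr rfl fun a _ => ?_
    rw [← Real.exp_add]
    simp [mul_add, Finset.sum_add_distrib, Pi.single_apply, mul_comm]
  have hder : HasDerivAt (fun s : ℝ => expSum S d (u + s • Pi.single i 1))
      (∑ a ∈ S, d a * ((a i : ℝ) * Real.exp (∑ j, (a j : ℝ) * u j))) 0 := by
    simp only [hshift]
    refine HasDerivAt.fun_sum fun a _ => HasDerivAt.const_mul _ ?_
    have := (((hasDerivAt_id (0 : ℝ)).mul_const (a i : ℝ)).exp).const_mul
      (Real.exp (∑ j, (a j : ℝ) * u j))
    simpa [mul_comm] using this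
  refine IsLocalMin.hasDerivAt_eq_zero (Filter.Eventually.of_forall fun s => ?_) hder
  simpa [hu] using hnn (u + s • Pi.single i 1)

/-- If `exp ∘ ℓ i` converges along a sequence for finitely many linear functionals `ℓ i`, the
positive limits are attained simultaneously, and the vanishing ones are cut out by a face. -/
theorem exists_face_of_tendsto_exp {E ι : Type*} [NormedAddCommGroup E] [NormedSpace ℝ E]
    [FiniteDimensional ℝ E] [Fintype ι] (ℓ : ι → E →ₗ[ℝ] ℝ) (z : ℕ → E) (p : ι → ℝ)
    (hp : ∀ i, Filter.Tendsto (fun k => Real.exp (ℓ i (z k))) Filter.atTop (nhds (p i))) :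
    ∃ w v : E, ∀ i, (0 < p i → Real.exp (ℓ i w) = p i ∧ ℓ i v = 0) ∧ (p i = 0 → ℓ i v < 0) := by
  let T : E →ₗ[ℝ] ({i // 0 < p i} → ℝ) := LinearMap.pi fun i => ℓ i.1
  obtain ⟨σ, hσ⟩ := T.rangeRestrict.exists_rightInverse_of_surjective T.range_rangeRestrict
  have hTσ : ∀ y : LinearMap.range T, T (σ y) = y := fun y =>
    congrArg Subtype.val (LinearMap.congr_fun hσ y)
  have hTz : Filter.Tendsto (fun k => T (z k)) Filter.atTop
      (nhds fun i : {i // 0 < p i} => Real.log (p i.1)) := by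
    refine tendsto_pi_nhds.2 fun i => ?_
    have := (hp i.1).log i.2.ne'
    simpa [T] using this
  obtain ⟨q, hq⟩ : ∃ q : LinearMap.range T,
      (q : {i // 0 < p i} → ℝ) = fun i => Real.log (p i.1) :=
    ⟨⟨_, (LinearMap.range T).closed_of_finiteDimensional.mem_of_tendsto hTz
      (Filter.Eventually.of_forall fun k => LinearMap.mem_range_self T (z k))⟩, rfl⟩
  have hσlim : Filter.Tendsto (fun k => σ (T.rangeRestrict (z k))) Filter.atTop (nhds (σ q)) := by
    refine (σ.continuous_of_finiteDimensional.tendsto q).comp ?_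
    rw [tendsto_subtype_rng, hq]
    exact hTz
  have hev : ∀ᶠ k in Filter.atTop, ∀ i, p i = 0 →
      ℓ i (z k - σ (T.rangeRestrict (z k))) < 0 := by
    refine Filter.eventually_all.2 fun i => ?_
    by_cases hi : p i = 0
    · have h1 : Filter.Tendsto (fun k => ℓ i (z k)) Filter.atTop Filter.atBot := by
        rw [← Real.tendsto_exp_comp_nhds_zero]
        exact hi ▸ hp i
      have h2 := (((ℓ i).continuous_of_finiteDimensional.tendsto _).comp hσlim).neg
      filter_upwards [(h1.atBot_add h2).eventually_lt_atBot 0] with k hk _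
      simpa [sub_eq_add_neg] using hk
    · exact Filter.Eventually.of_forall fun k hk => absurd hk hi
  obtain ⟨k, hk⟩ := hev.exists
  refine ⟨σ q, z k - σ (T.rangeRestrict (z k)), fun i => ⟨fun hi => ⟨?_, ?_⟩, hk i⟩⟩
  · have := congrFun ((hTσ q).trans hq) ⟨i, hi⟩
    simp only [T, LinearMap.pi_apply] at this
    rw [this, Real.exp_log hi]
  · have := congrFun (hTσ (T.rangeRestrict (z k))) ⟨i, hi⟩
    change ℓ i (σ (T.rangeRestrict (z k))) = ℓ i (z k) at this
    rw [map_sub, sub_eq_zero]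
    exact this.symm

/-- The points spanning a polytope lie in the convex hull of any finite set containing its
extreme points. -/
theorem mem_convexHull_of_extremePoints_subset {E : Type*} [NormedAddCommGroup E]
    [NormedSpace ℝ E] {s t : Set E} (hs : s.Finite) (ht : t.Finite)
    (hst : (convexHull ℝ s).extremePoints ℝ ⊆ t) : s ⊆ convexHull ℝ t := by
  intro x hx
  have hK := closure_convexHull_extremePoints (hs.isCompact_convexHull ℝ) (convex_convexHull ℝ s)
  have hx' : x ∈ closure (convexHull ℝ ((convexHull ℝ s).extremePoints ℝ)) := by
    rw [hK]
    exact subset_convexHull ℝ s hx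
  exact closure_minimal (convexHull_mono hst) (ht.isClosed_convexHull ℝ) hx'

theorem exists_le_of_mem_convexHull_coeR {n : ℕ} {Ap : Finset (Fin n → ℤ)} {b : Fin n → ℤ}
    (hb : coeR b ∈ convexHull ℝ (coeR '' (Ap : Set (Fin n → ℤ)))) (u : Fin n → ℝ) :
    ∃ a ∈ Ap, ∑ j, (b j : ℝ) * u j ≤ ∑ j, (a j : ℝ) * u j := by
  let l : (Fin n → ℝ) →ₗ[ℝ] ℝ := Fintype.linearCombination ℝ u
  obtain ⟨_, ⟨a, ha, rfl⟩, hle⟩ :=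
    (l.convexOn convex_univ).exists_ge_of_mem_convexHull (Set.subset_univ _) hb
  exact ⟨a, ha, by simpa [l, Fintype.linearCombination_apply, coeR] using hle⟩

/-- The Viro signomial is copositive for small parameters. -/
theorem exists_viro_nonneg {n : ℕ} {Ap Am : Finset (Fin n → ℤ)} (hdisj : Disjoint Ap Am)
    (hAmne : Am.Nonempty)
    (hhull : ∀ b ∈ Am, coeR b ∈ convexHull ℝ (coeR '' (Ap : Set (Fin n → ℤ))))
    {c : (Fin n → ℤ) → ℝ} (hc : ∀ a ∈ Ap ∪ Am, 0 < c a)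
    {h : (Fin n → ℤ) → ℤ} (hhm : ∀ b ∈ Am, 0 < h b) :
    ∃ t : ℝ, 0 < t ∧ ∀ u, 0 ≤ expSum (Ap ∪ Am) (viroCoeff Ap c h t) u := by
  obtain ⟨m, hm, hmc⟩ : ∃ m : ℝ, 0 < m ∧ ∀ a ∈ Ap, m ≤ c a := by
    rcases Ap.eq_empty_or_nonempty with rfl | hne
    · exact ⟨1, one_pos, by simp⟩
    · obtain ⟨a, ha, hmin⟩ := Ap.exists_min_image c hne
      exact ⟨c a, hc a (Finset.mem_union_left _ ha), hmin⟩
  have hC : 0 < ∑ b ∈ Am, c b :=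
    Finset.sum_pos (fun b hb => hc b (Finset.mem_union_right _ hb)) hAmne
  have ht : 0 < min 1 (m / ∑ b ∈ Am, c b) := lt_min one_pos (div_pos hm hC)
  refine ⟨min 1 (m / ∑ b ∈ Am, c b), ht, fun u => ?_⟩
  set t := min 1 (m / ∑ b ∈ Am, c b)
  have htC : t * ∑ b ∈ Am, c b ≤ m := (le_div_iff₀ hC).1 (min_le_right _ _)
  have hsum := sum_viroCoeff hdisj c h t (fun _ => True)
    (fun a => Real.exp (∑ j, (a j : ℝ) * u j))
  simp only [Finset.filter_true] at hsum
  rw [expSum, hsum, sub_nonneg]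
  set P := ∑ a ∈ Ap, c a * Real.exp (∑ j, (a j : ℝ) * u j) with hP
  have hPnn : 0 ≤ P := Finset.sum_nonneg fun a ha =>
    mul_nonneg (hc a (Finset.mem_union_left _ ha)).le (Real.exp_pos _).le
  have hbP : ∀ b ∈ Am, Real.exp (∑ j, (b j : ℝ) * u j) ≤ P / m := fun b hb => by
    obtain ⟨a, ha, hle⟩ := exists_le_of_mem_convexHull_coeR (hhull b hb) u
    rw [le_div_iff₀ hm]
    calc Real.exp (∑ j, (b j : ℝ) * u j) * m
        ≤ Real.exp (∑ j, (a j : ℝ) * u j) * c a :=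
          mul_le_mul (Real.exp_le_exp.2 hle) (hmc a ha) hm.le (Real.exp_pos _).le
      _ = c a * Real.exp (∑ j, (a j : ℝ) * u j) := mul_comm _ _
      _ ≤ P := Finset.single_le_sum
          (f := fun a : Fin n → ℤ => c a * Real.exp (∑ j, (a j : ℝ) * u j))
          (fun a ha => mul_nonneg (hc a (Finset.mem_union_left _ ha)).le (Real.exp_pos _).le) ha
  calc ∑ b ∈ Am, c b * t ^ h b * Real.exp (∑ j, (b j : ℝ) * u j)
      ≤ ∑ b ∈ Am, c b * t * (P / m) := by
        refine Finset.sum_le_sum fun b hb => ?_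
        have hcb := hc b (Finset.mem_union_right _ hb)
        have hth : t ^ h b ≤ t := by
          have := zpow_le_zpow_right_of_le_one₀ ht (min_le_left _ _) (Int.add_one_le_iff.2 (hhm b hb))
          simpa using this
        exact mul_le_mul (mul_le_mul_of_nonneg_left hth hcb.le) (hbP b hb) (Real.exp_pos _).le
          (mul_nonneg hcb.le ht.le)
    _ = (t * ∑ b ∈ Am, c b) * (P / m) := by rw [← Finset.sum_mul, ← Finset.sum_mul, mul_comm t]
    _ ≤ m * (P / m) := mul_le_mul_of_nonneg_right htC (div_nonneg hPnn hm.le)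
    _ = P := by field_simp

/-- If the exponential sums with coefficients `d k`, converging to `d'`, take negative values, then
some truncation of the limit sum is nonpositive at a point. -/
theorem exists_face_of_tendsto_coeff {n : ℕ} (S : Finset (Fin n → ℤ)) (hS : S.Nonempty)
    (d : ℕ → (Fin n → ℤ) → ℝ) (d' : (Fin n → ℤ) → ℝ)
    (hd : ∀ a ∈ S, Filter.Tendsto (fun k => d k a) Filter.atTop (nhds (d' a)))
    (hneg : ∀ k, ∃ u, expSum S (d k) u < 0) :
    ∃ (v : Fin n → ℝ) (m : ℝ) (w : Fin n → ℝ),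
      (∀ a ∈ S, ∑ j, (a j : ℝ) * v j ≤ m) ∧ (∃ a ∈ S, ∑ j, (a j : ℝ) * v j = m) ∧
      expSum (S.filter fun a => ∑ j, (a j : ℝ) * v j = m) d' w ≤ 0 := by
  choose u hu using hneg
  let ℓ : S → ((Fin n → ℝ) × ℝ) →ₗ[ℝ] ℝ := fun a =>
    (Fintype.linearCombination ℝ (coeR a.1)).comp (LinearMap.fst ℝ _ _) + LinearMap.snd ℝ _ _
  have hℓ : ∀ a z, ℓ a z = ∑ j, (a.1 j : ℝ) * z.1 j + z.2 := fun a z => by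
    simp [ℓ, Fintype.linearCombination_apply, coeR, mul_comm]
  let M : ℕ → ℝ := fun k => ∑ a ∈ S, Real.exp (∑ j, (a j : ℝ) * u k j)
  have hM : ∀ k, 0 < M k := fun k => Finset.sum_pos (fun a _ => Real.exp_pos _) hS
  let z : ℕ → (Fin n → ℝ) × ℝ := fun k => (u k, -Real.log (M k))
  have hexp : ∀ a k, Real.exp (ℓ a (z k)) = Real.exp (∑ j, (a.1 j : ℝ) * u k j) / M k :=
    fun a k => by
      rw [hℓ, Real.exp_add, Real.exp_neg, Real.exp_log (hM k), div_eq_mul_inv]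
  have hmem : ∀ k, (fun a => Real.exp (ℓ a (z k))) ∈ stdSimplex ℝ S := fun k => by
    refine ⟨fun a => (Real.exp_pos _).le, ?_⟩
    simp only [hexp]
    rw [← Finset.sum_div, Finset.sum_coe_sort S fun a => Real.exp (∑ j, (a j : ℝ) * u k j)]
    exact div_self (hM k).ne'
  obtain ⟨p, hp, φ, hφ, hlim⟩ := (isCompact_stdSimplex ℝ S).tendsto_subseq hmem
  have hlim' := tendsto_pi_nhds.1 hlim
  obtain ⟨w, v, hwv⟩ := exists_face_of_tendsto_exp ℓ (z ∘ φ) p hlim'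
  have hle : ∑ a : S, d' a * p a ≤ 0 := by
    refine le_of_tendsto' (tendsto_finsetSum _ fun a _ =>
      ((hd a.1 a.2).comp hφ.tendsto_atTop).mul (hlim' a)) fun k => ?_
    simp only [Function.comp_apply, hexp]
    have := div_nonpos_of_nonpos_of_nonneg (hu (φ k)).le (hM (φ k)).le
    rw [expSum, Finset.sum_div, ← Finset.sum_coe_sort] at this
    simpa only [mul_div_assoc] using this
  have hpos : ∀ a : S, 0 < p a ↔ ∑ j, (a.1 j : ℝ) * v.1 j = -v.2 := fun a => by
    constructor
    · intro ha
      have := ((hwv a).1 ha).2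
      rw [hℓ] at this
      linarith
    · intro ha
      refine (hp.1 a).lt_of_ne' fun h0 => ?_
      have := (hwv a).2 h0
      rw [hℓ] at this
      linarith
  refine ⟨v.1, -v.2, w.1, fun a ha => ?_, ?_, ?_⟩
  · rcases (hp.1 ⟨a, ha⟩).eq_or_lt' with h0 | h0
    · have := (hwv ⟨a, ha⟩).2 h0
      rw [hℓ] at this
      simp only at this
      linarith
    · exact ((hpos ⟨a, ha⟩).1 h0).le
  · obtain ⟨a, -, ha⟩ : ∃ a ∈ (Finset.univ : Finset S), 0 < p a := by
      refine Finset.exists_lt_of_sum_lt (f := fun _ => (0 : ℝ)) ?_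
      rw [Finset.sum_const_zero, hp.2]
      exact one_pos
    exact ⟨a.1, a.2, (hpos a).1 ha⟩
  · have heq : ∑ a : S, d' a * p a = Real.exp w.2 *
        expSum (S.filter fun a => ∑ j, (a j : ℝ) * v.1 j = -v.2) d' w.1 := by
      rw [expSum, Finset.sum_filter, Finset.mul_sum, ← Finset.sum_coe_sort S]
      refine Finset.sum_congr rfl fun a _ => ?_
      split_ifs with ha
      · rw [← ((hwv a).1 ((hpos a).2 ha)).1, hℓ, Real.exp_add]
        ring
      · have : p a = 0 := le_antisymm (not_lt.1 fun h0 => ha ((hpos a).1 h0)) (hp.1 a)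
        simp [this]
    rw [heq] at hle
    exact nonpos_of_mul_nonpos_right hle (Real.exp_pos _)

theorem continuousAt_viroCoeff {n : ℕ} (Ap : Finset (Fin n → ℤ)) (c : (Fin n → ℤ) → ℝ)
    (h : (Fin n → ℤ) → ℤ) (a : Fin n → ℤ) {t : ℝ} (ht : 0 < t) :
    ContinuousAt (fun t => viroCoeff Ap c h t a) t := by
  unfold viroCoeff
  split_ifs
  · exact continuousAt_const
  · exact ((continuousAt_zpow₀ t _ (Or.inl ht.ne')).const_mul _).neg

/-- Truncated Viro signomials meeting `Am` strictly decrease in the parameter. -/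
theorem expSum_viroCoeff_lt {n : ℕ} {Ap Am : Finset (Fin n → ℤ)} (hdisj : Disjoint Ap Am)
    {c : (Fin n → ℤ) → ℝ} (hc : ∀ a ∈ Ap ∪ Am, 0 < c a)
    {h : (Fin n → ℤ) → ℤ} (hhm : ∀ b ∈ Am, 0 < h b) (q : (Fin n → ℤ) → Prop)
    (hq : ∃ b ∈ Am, q b) {s t : ℝ} (hs : 0 < s) (hst : s < t) (u : Fin n → ℝ) :
    expSum ((Ap ∪ Am).filter q) (viroCoeff Ap c h t) u <
      expSum ((Ap ∪ Am).filter q) (viroCoeff Ap c h s) u := by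
  rw [expSum, expSum, sum_viroCoeff hdisj c h t q fun a => Real.exp (∑ j, (a j : ℝ) * u j),
    sum_viroCoeff hdisj c h s q fun a => Real.exp (∑ j, (a j : ℝ) * u j)]
  obtain ⟨b, hb, hqb⟩ := hq
  refine sub_lt_sub_left (Finset.sum_lt_sum_of_nonempty ⟨b, Finset.mem_filter.2 ⟨hb, hqb⟩⟩
    fun a ha => ?_) _
  have ha := (Finset.mem_filter.1 ha).1
  exact mul_lt_mul_of_pos_right (mul_lt_mul_of_pos_left (zpow_lt_zpow_left₀ (hhm a ha) hs.le hst)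
    (hc a (Finset.mem_union_right _ ha))) (Real.exp_pos _)

/-- The signed sum of monomials at a positive point, in logarithmic coordinates. -/
theorem sum_sub_sum_eq_expSum {n : ℕ} {Ap Am : Finset (Fin n → ℤ)} (hdisj : Disjoint Ap Am)
    (c : (Fin n → ℤ) → ℝ) (h : (Fin n → ℤ) → ℤ) (t : ℝ) (q : (Fin n → ℤ) → Prop)
    {x : Fin n → ℝ} (hx : ∀ i, 0 < x i) :
    ∑ a ∈ Ap.filter q, c a * ∏ j, x j ^ a j
      - ∑ b ∈ Am.filter q, c b * t ^ h b * ∏ j, x j ^ b j =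
    expSum ((Ap ∪ Am).filter q) (viroCoeff Ap c h t) fun j => Real.log (x j) := by
  rw [← sum_viroCoeff hdisj c h t q fun a => ∏ j, x j ^ a j, expSum]
  exact Finset.sum_congr rfl fun a _ => by rw [prod_zpow_eq_exp x hx]

/-- There is a largest parameter for which the Viro signomial is copositive. -/
theorem exists_isGreatest_viro_nonneg {n : ℕ} {Ap Am : Finset (Fin n → ℤ)}
    (hdisj : Disjoint Ap Am) (hAmne : Am.Nonempty)
    (hhull : ∀ b ∈ Am, coeR b ∈ convexHull ℝ (coeR '' (Ap : Set (Fin n → ℤ))))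
    {c : (Fin n → ℤ) → ℝ} (hc : ∀ a ∈ Ap ∪ Am, 0 < c a)
    {h : (Fin n → ℤ) → ℤ} (hhm : ∀ b ∈ Am, 0 < h b) :
    ∃ t₀, IsGreatest {t : ℝ | 0 < t ∧ ∀ u, 0 ≤ expSum (Ap ∪ Am) (viroCoeff Ap c h t) u} t₀ := by
  set T := {t : ℝ | 0 < t ∧ ∀ u, 0 ≤ expSum (Ap ∪ Am) (viroCoeff Ap c h t) u}
  have hne : T.Nonempty := exists_viro_nonneg hdisj hAmne hhull hc hhm
  have hbdd : BddAbove T := by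
    obtain ⟨b, hb⟩ := hAmne
    have hcb := hc b (Finset.mem_union_right _ hb)
    refine ⟨max 1 ((∑ a ∈ Ap, c a) / c b), fun t ⟨ht, hnn⟩ => ?_⟩
    rcases le_total t 1 with h1 | h1
    · exact le_max_of_le_left h1
    refine le_max_of_le_right ((le_div_iff₀ hcb).2 ?_)
    have hsum := sum_viroCoeff hdisj c h t (fun _ => True) (fun _ => 1)
    have h0 := hnn 0
    simp only [Finset.filter_true, mul_one] at hsum
    simp only [expSum, Pi.zero_apply, mul_zero, Finset.sum_const_zero, Real.exp_zero, mul_one,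
      hsum] at h0
    have hle : c b * t ^ h b ≤ ∑ b ∈ Am, c b * t ^ h b :=
      Finset.single_le_sum (f := fun b => c b * t ^ h b) (fun b hb =>
        mul_nonneg (hc b (Finset.mem_union_right _ hb)).le (zpow_nonneg ht.le _)) hb
    have hth : t ≤ t ^ h b := by
      have := zpow_le_zpow_right₀ h1 (Int.add_one_le_iff.2 (hhm b hb))
      simpa using this
    have := mul_le_mul_of_nonneg_left hth hcb.le
    linarith
  obtain ⟨τ, -, hτ, hτT⟩ := exists_seq_tendsto_sSup hne hbdd
  have hpos : 0 < sSup T := by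
    obtain ⟨t, ht⟩ := hne
    exact ht.1.trans_le (le_csSup hbdd ht)
  refine ⟨sSup T, ⟨hpos, fun u => ?_⟩, fun t ht => le_csSup hbdd ht⟩
  refine ge_of_tendsto' (tendsto_finsetSum _ fun a _ => Filter.Tendsto.mul_const _
    ((continuousAt_viroCoeff Ap c h a hpos).tendsto.comp hτ)) fun k => (hτT k).2 u

/-- **Copositivity criterion via the signed discriminant (general case).**
Let `A₊, A₋ ⊆ ℤⁿ` be disjoint, `A₋ ≠ ∅`, with all extreme points of `conv(A₊ ∪ A₋)`
in `A₊`. Let `Γ` be the smallest nonempty (exposed) face of `conv(A₊ ∪ A₋)` containing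
`A₋`, and let `J` consist of the nonempty faces `Γ'` of `Γ` meeting `A₋`. With positive
coefficients `c` and a height function `h` lifting `A₋`, let `S` be the set of `t > 0`
such that the truncated Viro signomial
`f_t^{Γ'}(x) = ∑_{a∈A₊∩Γ'} c_a x^a − ∑_{b∈A₋∩Γ'} c_b t^{h(b)} x^b` has a positive
singular zero for some `Γ' ∈ J`. Then `S` has a minimum `t⋆`, and the signomial
`f(x) = ∑_{a∈A₊} c_a x^a − ∑_{b∈A₋} c_b x^b` is copositive iff `t⋆ ≥ 1`. -/
theorem stmt0 {n : ℕ} (Ap Am : Finset (Fin n → ℤ)) (hdisj : Disjoint Ap Am)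
    (hAmne : Am.Nonempty)
    (hext : ∀ p ∈ Set.extremePoints ℝ
        (convexHull ℝ (coeR '' ((Ap ∪ Am : Finset (Fin n → ℤ)) : Set (Fin n → ℤ)))),
      p ∈ coeR '' (Ap : Set (Fin n → ℤ)))
    (c : (Fin n → ℤ) → ℝ) (hc : ∀ a ∈ Ap ∪ Am, 0 < c a)
    (h : (Fin n → ℤ) → ℤ) (hhp : ∀ a ∈ Ap, h a = 0) (hhm : ∀ b ∈ Am, 0 < h b)
    (Γ : Set (Fin n → ℝ)) (hΓne : Γ.Nonempty)
    (hΓface : IsExposed ℝ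
      (convexHull ℝ (coeR '' ((Ap ∪ Am : Finset (Fin n → ℤ)) : Set (Fin n → ℤ)))) Γ)
    (hΓcontains : coeR '' (Am : Set (Fin n → ℤ)) ⊆ Γ)
    (hΓmin : ∀ Γ'' : Set (Fin n → ℝ), Γ''.Nonempty →
      IsExposed ℝ
        (convexHull ℝ (coeR '' ((Ap ∪ Am : Finset (Fin n → ℤ)) : Set (Fin n → ℤ)))) Γ'' →
      coeR '' (Am : Set (Fin n → ℤ)) ⊆ Γ'' → Γ ⊆ Γ'') :
    ∃ tstar : ℝ,
      IsLeast {t : ℝ | 0 < t ∧ ∃ Γ' : Set (Fin n → ℝ),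
        (Γ'.Nonempty ∧ IsExposed ℝ Γ Γ' ∧ (Γ' ∩ coeR '' (Am : Set (Fin n → ℤ))).Nonempty) ∧
        ∃ x : Fin n → ℝ, (∀ i, 0 < x i) ∧
          (∑ a ∈ Ap.filter (fun a => coeR a ∈ Γ'), c a * ∏ j, x j ^ a j
            - ∑ b ∈ Am.filter (fun b => coeR b ∈ Γ'), c b * t ^ h b * ∏ j, x j ^ b j
            = 0) ∧
          ∀ i : Fin n,
            ∑ a ∈ Ap.filter (fun a => coeR a ∈ Γ'), c a * (a i : ℝ) * ∏ j, x j ^ a j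
              - ∑ b ∈ Am.filter (fun b => coeR b ∈ Γ'),
                  c b * (b i : ℝ) * t ^ h b * ∏ j, x j ^ b j = 0} tstar ∧
      ((∀ x : Fin n → ℝ, (∀ i, 0 < x i) →
          0 ≤ ∑ a ∈ Ap, c a * ∏ j, x j ^ a j - ∑ b ∈ Am, c b * ∏ j, x j ^ b j) ↔
        1 ≤ tstar) := by
  set A := Ap ∪ Am
  set K := convexHull ℝ (coeR '' ((A : Finset (Fin n → ℤ)) : Set (Fin n → ℤ)))
  have hAK : ∀ a ∈ A, coeR a ∈ K := fun a ha =>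
    subset_convexHull ℝ _ (Set.mem_image_of_mem _ ha)
  have hhull : ∀ b ∈ Am, coeR b ∈ convexHull ℝ (coeR '' (Ap : Set (Fin n → ℤ))) := fun b hb =>
    mem_convexHull_of_extremePoints_subset (A.finite_toSet.image _) (Ap.finite_toSet.image _) hext
      (Set.mem_image_of_mem _ (Finset.mem_coe.2 (Finset.mem_union_right _ hb)))
  obtain ⟨t₀, ⟨ht₀, hnn⟩, hmax⟩ := exists_isGreatest_viro_nonneg hdisj hAmne hhull hc hhm
  have htrunc : ∀ Γ' : Set (Fin n → ℝ), Γ'.Nonempty → IsExposed ℝ Γ Γ' → ∀ u,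
      0 ≤ expSum (A.filter fun a => coeR a ∈ Γ') (viroCoeff Ap c h t₀) u := by
    intro Γ' hne hexp u
    have := expSum_filter_nonneg (A.filter fun a => coeR a ∈ Γ) _
      (fun a ha => (Finset.mem_filter.1 ha).2) hexp hne
      (expSum_filter_nonneg A _ hAK hΓface hΓne hnn) u
    rwa [Finset.filter_filter, Finset.filter_congr fun a _ =>
      and_iff_right_of_imp fun ha => hexp.subset ha] at this
  refine ⟨t₀, ⟨⟨ht₀, ?_⟩, ?_⟩, ?_⟩
  · have hneg : ∀ k : ℕ, ∃ u, expSum A (viroCoeff Ap c h (t₀ + 1 / ((k : ℝ) + 1))) u < 0 := by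
      intro k
      by_contra! hcon
      have hk : (0 : ℝ) < 1 / ((k : ℝ) + 1) := Nat.one_div_pos_of_nat
      have := hmax ⟨by linarith, hcon⟩
      linarith
    have hτ : Filter.Tendsto (fun k : ℕ => t₀ + 1 / ((k : ℝ) + 1)) Filter.atTop (nhds t₀) := by
      simpa using tendsto_one_div_add_atTop_nhds_zero_nat.const_add t₀
    obtain ⟨v, m, w, hle, ⟨a₀, ha₀, ha₀m⟩, hw⟩ := exists_face_of_tendsto_coeff A
      (hAmne.mono Finset.subset_union_right) _ _
      (fun a _ => (continuousAt_viroCoeff Ap c h a ht₀).tendsto.comp hτ) hneg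
    have hcoeff : ∀ a ∈ A, a ∉ Am → 0 < viroCoeff Ap c h t₀ a := fun a ha ham => by
      rw [viroCoeff, if_pos ((Finset.mem_union.1 ha).resolve_right ham)]
      exact hc a ha
    obtain ⟨b, hb, hbm⟩ : ∃ b ∈ Am, ∑ j, (b j : ℝ) * v j = m := by
      by_contra! hcon
      refine hw.not_gt (Finset.sum_pos (fun a ha => ?_) ⟨a₀, Finset.mem_filter.2 ⟨ha₀, ha₀m⟩⟩)
      obtain ⟨ha, ham⟩ := Finset.mem_filter.1 ha
      exact mul_pos (hcoeff a ha fun h' => hcon a h' ham) (Real.exp_pos _)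
    let l : (Fin n → ℝ) →L[ℝ] ℝ := (Fintype.linearCombination ℝ v).toContinuousLinearMap
    have hl : ∀ x, l x = ∑ j, x j * v j := fun x => by
      simp [l, Fintype.linearCombination_apply]
    have hKm : ∀ x ∈ K, l x ≤ m := by
      refine fun x hx => convexHull_min ?_ (convex_halfSpace_le l.isLinear m) hx
      rintro _ ⟨a, ha, rfl⟩
      exact (hl _).trans_le (hle a ha)
    have hbΓ : coeR b ∈ Γ := hΓcontains (Set.mem_image_of_mem _ hb)
    have hbl : l (coeR b) = m := (hl _).trans hbm
    obtain ⟨Γ', hΓ'⟩ : ∃ Γ' : Set (Fin n → ℝ), Γ' = {x ∈ Γ | l x = m} := ⟨_, rfl⟩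
    have hmem : ∀ x, x ∈ Γ' ↔ x ∈ Γ ∧ l x = m := fun x => by rw [hΓ']; rfl
    have hexp : IsExposed ℝ Γ Γ' := fun _ => by
      rw [hΓ']
      refine ⟨l, Set.ext fun x => and_congr_right fun hx => ⟨fun h' y hy => ?_, fun h' => ?_⟩⟩
      · exact (hKm y (hΓface.subset hy)).trans h'.ge
      · exact le_antisymm (hKm x (hΓface.subset hx)) (hbl ▸ h' _ hbΓ)
    have hbΓ' : coeR b ∈ Γ' := (hmem _).2 ⟨hbΓ, hbl⟩
    have hne : Γ'.Nonempty := ⟨coeR b, hbΓ'⟩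
    have hzero : expSum (A.filter fun a => coeR a ∈ Γ') (viroCoeff Ap c h t₀) w = 0 := by
      refine le_antisymm (le_trans (Finset.sum_le_sum_of_subset_of_nonneg ?_ ?_) hw)
        (htrunc _ hne hexp w)
      · exact Finset.monotone_filter_right A fun a _ ha => (hl _).symm.trans ((hmem _).1 ha).2
      · intro a ha ha'
        obtain ⟨ha, ham⟩ := Finset.mem_filter.1 ha
        refine mul_nonneg (hcoeff a ha fun h' => ha' (Finset.mem_filter.2 ⟨ha, ?_⟩)).le
          (Real.exp_pos _).le
        exact (hmem _).2 ⟨hΓcontains (Set.mem_image_of_mem _ h'), (hl _).trans ham⟩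
    have hx : ∀ i, 0 < Real.exp (w i) := fun i => Real.exp_pos _
    refine ⟨_, ⟨hne, hexp, coeR b, hbΓ', Set.mem_image_of_mem _ hb⟩,
      fun j => Real.exp (w j), hx, ?_, fun i => ?_⟩
    · rw [sum_sub_sum_eq_expSum hdisj c h t₀ _ hx]
      simpa only [Real.log_exp] using hzero
    · have hcrit := expSum_critical _ _ (htrunc _ hne hexp) hzero i
      rw [sum_viroCoeff hdisj c h t₀ _ fun a => (a i : ℝ) * Real.exp (∑ j, (a j : ℝ) * w j)]
        at hcrit
      rw [← hcrit]
      congr 1 <;> refine Finset.sum_congr rfl fun a _ => ?_ <;>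
        rw [prod_zpow_eq_exp _ hx] <;> simp only [Real.log_exp] <;> ring
  · rintro t ⟨ht, Γ', ⟨hne, hexp, _, hbΓ', b, hb, rfl⟩, x, hx, hzero, -⟩
    rw [sum_sub_sum_eq_expSum hdisj c h t _ hx] at hzero
    by_contra! hlt
    have := expSum_viroCoeff_lt hdisj hc hhm (fun a => coeR a ∈ Γ') ⟨b, hb, hbΓ'⟩ ht hlt
      fun j => Real.log (x j)
    exact (htrunc Γ' hne hexp _).not_gt (this.trans_eq hzero)
  · have hone : ∀ x : Fin n → ℝ, (∀ i, 0 < x i) →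
        ∑ a ∈ Ap, c a * ∏ j, x j ^ a j - ∑ b ∈ Am, c b * ∏ j, x j ^ b j =
          expSum A (viroCoeff Ap c h 1) fun j => Real.log (x j) := fun x hx => by
      simpa using sum_sub_sum_eq_expSum hdisj c h 1 (fun _ => True) hx
    constructor
    · refine fun hcop => hmax ⟨one_pos, fun u => ?_⟩
      have hx : ∀ i, 0 < Real.exp (u i) := fun i => Real.exp_pos _
      have := hcop (fun j => Real.exp (u j)) hx
      rw [hone _ hx] at this
      simpa only [Real.log_exp] using this
    · intro h1 x hx
      rw [hone x hx]
      rcases h1.eq_or_lt with rfl | h1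
      · exact hnn _
      · have := expSum_viroCoeff_lt hdisj hc hhm (fun _ => True)
          (hAmne.imp fun b hb => ⟨hb, trivial⟩) one_pos h1 fun j => Real.log (x j)
        simp only [Finset.filter_true] at this
        exact (hnn _).trans this.le
end

section
/- Let A₊, A₋ ⊆ ℝⁿ be disjoint finite sets with A := A₊ ∪ A₋, let f be a signomial with signed support (A₊,A₋) and positive coefficients c, and let Γ be a nonempty face of conv(A). Define the truncated signomial f^Γ(x) = ∑_{a∈A₊∩Γ} c_a x^a − ∑_{b∈A₋∩Γ} c_b x^b. Then for every x ∈ ℝⁿ_{>0} with f^Γ(x) ≠ 0 there exists y ∈ ℝⁿ_{>0} such that f(y) and f^Γ(x) have the same sign, i.e. f(y) > 0 if f^Γ(x) > 0 and f(y) < 0 if f^Γ(x) < 0. -/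
open Finset

attribute [local instance] Classical.propDecidable

/-- Translating the logarithms of the coordinates of `x` by `s • v` multiplies the monomial
with exponent `a` by `exp (s * ⟨a, v⟩)`. -/
lemma prod_mul_exp_rpow {ι : Type*} [Fintype ι] (x v a : ι → ℝ) (hx : ∀ i, 0 < x i) (s : ℝ) :
    ∏ j, (x j * Real.exp (s * v j)) ^ a j
      = (∏ j, x j ^ a j) * Real.exp (s * ∑ j, a j * v j) := by
  rw [Finset.mul_sum, Real.exp_sum, ← Finset.prod_mul_distrib]
  refine Finset.prod_congr rfl fun j _ => ?_
  rw [Real.mul_rpow (hx j).le (Real.exp_pos _).le, ← Real.exp_mul]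
  congr 2
  ring

/-- If `M` bounds a family of exponents `e`, then the rescaled exponential sum
`∑ k a * exp (s * e a) * exp (-(s * M))` tends to the sum of the coefficients whose exponent
equals `M`. -/
lemma tendsto_sum_mul_exp_mul_exp_neg {α : Type*} (S : Finset α) (k e : α → ℝ) (M : ℝ)
    (p : α → Prop) (hp : ∀ a ∈ S, p a → e a = M) (hnp : ∀ a ∈ S, ¬ p a → e a < M) :
    Filter.Tendsto (fun s : ℝ => (∑ a ∈ S, k a * Real.exp (s * e a)) * Real.exp (-(s * M)))
      Filter.atTop (nhds (∑ a ∈ S.filter p, k a)) := by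
  rw [Finset.sum_filter]
  simp_rw [Finset.sum_mul]
  refine tendsto_finsetSum _ fun a ha => ?_
  have hrw (s : ℝ) : k a * Real.exp (s * e a) * Real.exp (-(s * M))
      = k a * Real.exp (s * (e a - M)) := by
    rw [mul_assoc, ← Real.exp_add]
    congr 2
    ring
  simp_rw [hrw]
  split_ifs with h
  · simp [hp a ha h]
  · have hlim : Filter.Tendsto (fun s : ℝ => Real.exp (s * (e a - M))) Filter.atTop (nhds 0) :=
      Real.tendsto_exp_atBot.comp
        (Filter.tendsto_id.atTop_mul_const_of_neg (sub_neg.2 (hnp a ha h)))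
    simpa using hlim.const_mul (k a)

/-- **Signs of truncations are attained by the full signomial.**
If `Γ` is a nonempty (exposed) face of `conv(A₊ ∪ A₋)` and the truncated signomial
`f^Γ` is nonzero at some positive `x`, then the full signomial `f` attains a value of
the same sign at some positive `y`. -/
theorem stmt2 {n : ℕ} (Ap Am : Finset (Fin n → ℝ)) (hdisj : Disjoint Ap Am)
    (c : (Fin n → ℝ) → ℝ) (hc : ∀ a ∈ Ap ∪ Am, 0 < c a)
    (Γ : Set (Fin n → ℝ)) (hΓne : Γ.Nonempty)
    (hΓ : IsExposed ℝ (convexHull ℝ ((Ap ∪ Am : Finset (Fin n → ℝ)) : Set (Fin n → ℝ))) Γ)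
    (x : Fin n → ℝ) (hx : ∀ i, 0 < x i)
    (hfx : ∑ a ∈ Ap.filter (fun a => a ∈ Γ), c a * ∏ j, x j ^ a j
        - ∑ b ∈ Am.filter (fun b => b ∈ Γ), c b * ∏ j, x j ^ b j ≠ 0) :
    ∃ y : Fin n → ℝ, (∀ i, 0 < y i) ∧
      (0 < ∑ a ∈ Ap.filter (fun a => a ∈ Γ), c a * ∏ j, x j ^ a j
          - ∑ b ∈ Am.filter (fun b => b ∈ Γ), c b * ∏ j, x j ^ b j →
        0 < ∑ a ∈ Ap, c a * ∏ j, y j ^ a j - ∑ b ∈ Am, c b * ∏ j, y j ^ b j) ∧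
      (∑ a ∈ Ap.filter (fun a => a ∈ Γ), c a * ∏ j, x j ^ a j
          - ∑ b ∈ Am.filter (fun b => b ∈ Γ), c b * ∏ j, x j ^ b j < 0 →
        ∑ a ∈ Ap, c a * ∏ j, y j ^ a j - ∑ b ∈ Am, c b * ∏ j, y j ^ b j < 0) := by
  obtain ⟨l, hl⟩ := hΓ hΓne
  obtain ⟨p, hpΓ⟩ := hΓne
  set K := convexHull ℝ ((Ap ∪ Am : Finset (Fin n → ℝ)) : Set (Fin n → ℝ))
  have hp : p ∈ K ∧ ∀ z ∈ K, l z ≤ l p := by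
    rw [hl] at hpΓ
    exact hpΓ
  set v : Fin n → ℝ := fun j => l (Pi.single j 1) with hv
  have hlv (a : Fin n → ℝ) : ∑ j, a j * v j = l a := by
    conv_rhs => rw [pi_eq_sum_univ' a]
    simp [hv, map_sum]
  have hsub (a : Fin n → ℝ) (ha : a ∈ Ap ∪ Am) : a ∈ K :=
    subset_convexHull ℝ _ (Finset.mem_coe.2 ha)
  have hin (a : Fin n → ℝ) (_ : a ∈ Ap ∪ Am) (h : a ∈ Γ) : l a = l p := by
    rw [hl] at h
    exact le_antisymm (hp.2 a h.1) (h.2 p hp.1)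
  have hout (a : Fin n → ℝ) (ha : a ∈ Ap ∪ Am) (h : a ∉ Γ) : l a < l p := by
    refine lt_of_le_of_ne (hp.2 a (hsub a ha)) fun heq => h ?_
    rw [hl]
    exact ⟨hsub a ha, fun z hz => heq ▸ hp.2 z hz⟩
  have hlim (S : Finset (Fin n → ℝ)) (hS : S ⊆ Ap ∪ Am) :=
    tendsto_sum_mul_exp_mul_exp_neg S (fun a => c a * ∏ j, x j ^ a j) l (l p) (fun a => a ∈ Γ)
      (fun a ha => hin a (hS ha)) (fun a ha => hout a (hS ha))
  have hmain := (hlim Ap Finset.subset_union_left).sub (hlim Am Finset.subset_union_right)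
  simp_rw [← sub_mul] at hmain
  have hval (s : ℝ) (S : Finset (Fin n → ℝ)) :
      ∑ a ∈ S, c a * ∏ j, (x j * Real.exp (s * v j)) ^ a j
        = ∑ a ∈ S, c a * (∏ j, x j ^ a j) * Real.exp (s * l a) :=
    Finset.sum_congr rfl fun a _ => by rw [prod_mul_exp_rpow x v a hx s, hlv, mul_assoc]
  have hpos (s : ℝ) (i : Fin n) : 0 < x i * Real.exp (s * v i) :=
    mul_pos (hx i) (Real.exp_pos _)
  rcases hfx.lt_or_gt with h | h
  · obtain ⟨s, hs⟩ := (hmain.eventually_lt_const h).exists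
    refine ⟨fun j => x j * Real.exp (s * v j), hpos s, fun h' => absurd h h'.not_gt, fun _ => ?_⟩
    rw [hval, hval]
    exact neg_of_mul_neg_left hs (Real.exp_pos _).le
  · obtain ⟨s, hs⟩ := (hmain.eventually_const_lt h).exists
    refine ⟨fun j => x j * Real.exp (s * v j), hpos s, fun _ => ?_, fun h' => absurd h h'.not_gt⟩
    rw [hval, hval]
    exact (mul_pos_iff_of_pos_right (Real.exp_pos _)).1 hs
end

section
/- Let A₊, A₋ ⊆ ℝⁿ be disjoint finite sets with A := A₊ ∪ A₋, and let f be a signomial with signed support (A₊,A₋) and positive coefficients. If some extreme point of conv(A) belongs to A₋, then f is not copositive; that is, there exists y ∈ ℝⁿ_{>0} with f(y) < 0. -/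
open Finset

attribute [local instance] Classical.propDecidable

/-- An extreme point of the convex hull of a finite set is strictly separated by a linear
functional from the other points of the set. -/
theorem exists_strongDual_lt_of_mem_extremePoints {E : Type*} [AddCommGroup E] [Module ℝ E]
    [TopologicalSpace E] [IsTopologicalAddGroup E] [ContinuousSMul ℝ E] [LocallyConvexSpace ℝ E]
    [T2Space E] {s : Set E} (hs : s.Finite) {p : E}
    (hp : p ∈ Set.extremePoints ℝ (convexHull ℝ s)) :
    ∃ l : StrongDual ℝ E, ∀ a ∈ s, a ≠ p → l a < l p := by
  have hnot : p ∉ convexHull ℝ (s \ {p}) := fun h =>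
    ((convex_convexHull ℝ s).mem_extremePoints_iff_mem_sdiff_convexHull_sdiff.1 hp).2
      (convexHull_mono (Set.sdiff_subset_sdiff_left (subset_convexHull ℝ s)) h)
  obtain ⟨l, u, hl, hu⟩ := geometric_hahn_banach_closed_point (convex_convexHull ℝ _)
    (hs.sdiff.isClosed_convexHull ℝ) hnot
  exact ⟨l, fun a ha hne => (hl a (subset_convexHull ℝ _ ⟨ha, hne⟩)).trans hu⟩

/-- Along the curve `t ↦ exp (t v)`, monomials become exponentials of a linear functional. -/
theorem prod_exp_rpow_eq_exp_strongDual {n : ℕ} (l : StrongDual ℝ (Fin n → ℝ)) (t : ℝ)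
    (a : Fin n → ℝ) :
    ∏ j, Real.exp (t * l (Pi.single j 1)) ^ a j = Real.exp (t * l a) := by
  have hla : l a = ∑ j, a j * l (Pi.single j 1) := by
    conv_lhs => rw [pi_eq_sum_univ' a]
    simp [map_sum, Pi.single]
  simp_rw [← Real.exp_mul]
  rw [← Real.exp_sum, hla, Finset.mul_sum]
  congr 1
  exact Finset.sum_congr rfl fun j _ => by ring

open Filter Topology in
/-- A finite combination of decaying exponentials is eventually below any positive constant. -/
theorem exists_sum_mul_exp_lt {ι : Type*} (s : Finset ι) (c m : ι → ℝ)
    (hm : ∀ i ∈ s, m i < 0) {ε : ℝ} (hε : 0 < ε) :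
    ∃ t : ℝ, ∑ i ∈ s, c i * Real.exp (t * m i) < ε := by
  have h : Tendsto (fun t : ℝ => ∑ i ∈ s, c i * Real.exp (t * m i)) atTop (𝓝 0) := by
    have h0 : ∑ i ∈ s, c i * (0 : ℝ) = 0 := by simp
    rw [← h0]
    exact tendsto_finsetSum s fun i hi =>
      (Real.tendsto_exp_atBot.comp (tendsto_id.atTop_mul_const_of_neg (hm i hi))).const_mul _
  exact (h.eventually_lt_const hε).exists

/-- **A signomial with a negative extreme point of its Newton polytope is not copositive.**
If some extreme point of `conv(A₊ ∪ A₋)` belongs to `A₋`, then the signomial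
`f(x) = ∑_{a∈A₊} c_a x^a − ∑_{b∈A₋} c_b x^b` attains a negative value on the
positive orthant. -/
theorem stmt3 {n : ℕ} (Ap Am : Finset (Fin n → ℝ)) (hdisj : Disjoint Ap Am)
    (c : (Fin n → ℝ) → ℝ) (hc : ∀ a ∈ Ap ∪ Am, 0 < c a)
    (hext : ∃ p ∈ Set.extremePoints ℝ
        (convexHull ℝ ((Ap ∪ Am : Finset (Fin n → ℝ)) : Set (Fin n → ℝ))), p ∈ Am) :
    ∃ y : Fin n → ℝ, (∀ i, 0 < y i) ∧
      ∑ a ∈ Ap, c a * ∏ j, y j ^ a j - ∑ b ∈ Am, c b * ∏ j, y j ^ b j < 0 := by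
  obtain ⟨p, hp, hpm⟩ := hext
  obtain ⟨l, hl⟩ := exists_strongDual_lt_of_mem_extremePoints (Finset.finite_toSet _) hp
  have hm : ∀ a ∈ Ap, l a - l p < 0 := fun a ha => sub_neg.2 <|
    hl a (Finset.mem_coe.2 (Finset.mem_union_left _ ha))
      fun h => Finset.disjoint_left.1 hdisj ha (h ▸ hpm)
  obtain ⟨t, ht⟩ := exists_sum_mul_exp_lt Ap c (fun a => l a - l p) hm
    (hc p (Finset.mem_union_right _ hpm))
  refine ⟨fun j => Real.exp (t * l (Pi.single j 1)), fun j => Real.exp_pos _, ?_⟩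
  simp only [prod_exp_rpow_eq_exp_strongDual]
  have hneg : c p * Real.exp (t * l p) ≤ ∑ b ∈ Am, c b * Real.exp (t * l b) :=
    Finset.single_le_sum (f := fun b => c b * Real.exp (t * l b))
      (fun b hb => (mul_pos (hc b (Finset.mem_union_right _ hb)) (Real.exp_pos _)).le) hpm
  have hpos : ∑ a ∈ Ap, c a * Real.exp (t * l a) < c p * Real.exp (t * l p) := by
    calc ∑ a ∈ Ap, c a * Real.exp (t * l a)
        = (∑ a ∈ Ap, c a * Real.exp (t * (l a - l p))) * Real.exp (t * l p) := by
          rw [Finset.sum_mul]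
          refine Finset.sum_congr rfl fun a _ => ?_
          rw [mul_assoc, ← Real.exp_add]
          ring_nf
      _ < c p * Real.exp (t * l p) := mul_lt_mul_of_pos_right ht (Real.exp_pos _)
  linarith
end

section
/- Let A₊, A₋ ⊆ ℝⁿ be disjoint finite sets with A := A₊ ∪ A₋ full dimensional (the affine span of A is all of ℝⁿ), and assume A₋ is contained in the interior of conv(A₊). Then for every signomial f with signed support (A₊,A₋) and positive coefficients, the positive zero set V_{>0}(f) := {x ∈ ℝⁿ_{>0} : f(x) = 0} is a compact subset of ℝⁿ_{>0}. -/
open Finset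

attribute [local instance] Classical.propDecidable

/-- In logarithmic coordinates a monomial is the exponential of a dot product. -/
lemma prod_exp_rpow_eq_exp_dotProduct {ι : Type*} [Fintype ι] (a y : ι → ℝ) :
    ∏ j, Real.exp (y j) ^ a j = Real.exp (a ⬝ᵥ y) := by
  rw [dotProduct, Real.exp_sum]
  refine Finset.prod_congr rfl fun j _ => ?_
  rw [← Real.exp_mul, mul_comm]

/-- A linear functional bounded by `M` on `s` is bounded by `M` on the convex hull of `s`. -/
lemma dotProduct_le_of_mem_convexHull {ι : Type*} [Fintype ι] {s : Set (ι → ℝ)} {y v : ι → ℝ}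
    {M : ℝ} (hs : ∀ a ∈ s, a ⬝ᵥ y ≤ M) (hv : v ∈ convexHull ℝ s) : v ⬝ᵥ y ≤ M := by
  have hlin : IsLinearMap ℝ fun w : ι → ℝ => w ⬝ᵥ y :=
    ⟨fun _ _ => add_dotProduct _ _ _, fun _ _ => smul_dotProduct _ _ _⟩
  exact convexHull_min hs (convex_halfSpace_le hlin M) hv

/-- If a sup-norm ball around `b` lies in the convex hull of `s`, the value at `b` of a linear
functional lies below its bound on `s` by a margin. -/
lemma dotProduct_add_mul_abs_le {ι : Type*} [Fintype ι] {s : Set (ι → ℝ)} {y b : ι → ℝ}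
    {M δ : ℝ} (hδ : 0 ≤ δ) (hs : ∀ a ∈ s, a ⬝ᵥ y ≤ M)
    (hb : Metric.closedBall b δ ⊆ convexHull ℝ s) (i : ι) : b ⬝ᵥ y + δ * |y i| ≤ M := by
  have key : ∀ t : ℝ, |t| ≤ δ → b ⬝ᵥ y + t * y i ≤ M := by
    intro t ht
    have hmem : b + Pi.single i t ∈ Metric.closedBall b δ := by
      simpa [Metric.mem_closedBall, dist_eq_norm, Pi.norm_single] using ht
    simpa [add_dotProduct] using dotProduct_le_of_mem_convexHull hs (hb hmem)
  rcases abs_cases (y i) with h | h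
  · simpa [h.1] using key δ (abs_of_nonneg hδ).le
  · simpa [h.1] using key (-δ) (by simp [abs_of_nonneg hδ])

/-- The zeros of an exponential sum whose negative exponents lie in the interior of the convex
hull of the positive ones are bounded. -/
lemma exists_forall_abs_le_of_sum_exp_eq {ι : Type*} [Fintype ι] {Ap Am : Finset (ι → ℝ)}
    (hne : Ap.Nonempty)
    (hAm : (Am : Set (ι → ℝ)) ⊆ interior (convexHull ℝ (Ap : Set (ι → ℝ))))
    {c : (ι → ℝ) → ℝ} (hp : ∀ a ∈ Ap, 0 < c a) (hm : ∀ b ∈ Am, 0 < c b) :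
    ∃ R : ℝ, ∀ y : ι → ℝ,
      ∑ a ∈ Ap, c a * Real.exp (a ⬝ᵥ y) = ∑ b ∈ Am, c b * Real.exp (b ⬝ᵥ y) →
      ∀ i, |y i| ≤ R := by
  obtain ⟨δ, hδ, hsub⟩ :=
    Am.finite_toSet.isCompact.exists_cthickening_subset_open isOpen_interior hAm
  obtain ⟨a₁, ha₁, hmin⟩ := Ap.exists_min_image c hne
  refine ⟨(∑ b ∈ Am, c b) / c a₁ / δ, fun y hy i => ?_⟩
  obtain ⟨a₀, ha₀, hmax⟩ := Ap.exists_max_image (fun a => a ⬝ᵥ y) hne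
  have hb : ∀ b ∈ Am, b ⬝ᵥ y + δ * |y i| ≤ a₀ ⬝ᵥ y := fun b hb =>
    dotProduct_add_mul_abs_le hδ.le hmax
      ((Metric.closedBall_subset_cthickening (Finset.mem_coe.2 hb) δ).trans
        (hsub.trans interior_subset)) i
  have h₁ : c a₁ * Real.exp (a₀ ⬝ᵥ y) ≤ ∑ a ∈ Ap, c a * Real.exp (a ⬝ᵥ y) :=
    (mul_le_mul_of_nonneg_right (hmin a₀ ha₀) (Real.exp_pos _).le).trans
      (Finset.single_le_sum (f := fun a => c a * Real.exp (a ⬝ᵥ y))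
        (fun a ha => mul_nonneg (hp a ha).le (Real.exp_pos _).le) ha₀)
  have h₂ : (∑ b ∈ Am, c b * Real.exp (b ⬝ᵥ y)) * Real.exp (δ * |y i|) ≤
      (∑ b ∈ Am, c b) * Real.exp (a₀ ⬝ᵥ y) := by
    rw [Finset.sum_mul, Finset.sum_mul]
    refine Finset.sum_le_sum fun b hbm => ?_
    rw [mul_assoc, ← Real.exp_add]
    exact mul_le_mul_of_nonneg_left (Real.exp_le_exp.2 (hb b hbm)) (hm b hbm).le
  have h₃ : c a₁ * Real.exp (δ * |y i|) ≤ ∑ b ∈ Am, c b := by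
    refine le_of_mul_le_mul_right ?_ (Real.exp_pos (a₀ ⬝ᵥ y))
    rw [← hy] at h₂
    refine le_trans (le_of_eq (by ring))
      ((mul_le_mul_of_nonneg_right h₁ (Real.exp_pos (δ * |y i|)).le).trans h₂)
  rw [le_div_iff₀ hδ, le_div_iff₀ (hp a₁ ha₁)]
  nlinarith [Real.add_one_le_exp (δ * |y i|), hp a₁ ha₁]

/-- **Compactness of the positive zero set.** If `A = A₊ ∪ A₋` is full dimensional and
`A₋` lies in the interior of `conv(A₊)`, then for every signomial `f` with signed
support `(A₊, A₋)` and positive coefficients, the positive zero set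
`V_{>0}(f) = {x ∈ ℝⁿ_{>0} : f(x) = 0}` is compact. -/
theorem stmt7 {n : ℕ} (Ap Am : Finset (Fin n → ℝ)) (hdisj : Disjoint Ap Am)
    (hspan : affineSpan ℝ ((Ap ∪ Am : Finset (Fin n → ℝ)) : Set (Fin n → ℝ)) = ⊤)
    (hAm : (Am : Set (Fin n → ℝ)) ⊆ interior (convexHull ℝ (Ap : Set (Fin n → ℝ))))
    (c : (Fin n → ℝ) → ℝ) (hc : ∀ a ∈ Ap ∪ Am, 0 < c a) :
    IsCompact {x : Fin n → ℝ | (∀ i, 0 < x i) ∧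
      ∑ a ∈ Ap, c a * ∏ j, x j ^ a j - ∑ b ∈ Am, c b * ∏ j, x j ^ b j = 0} := by
  have hp : ∀ a ∈ Ap, 0 < c a := fun a ha => hc a (Finset.mem_union_left _ ha)
  have hm : ∀ b ∈ Am, 0 < c b := fun b hb => hc b (Finset.mem_union_right _ hb)
  have hne : Ap.Nonempty := by
    rw [Finset.nonempty_iff_ne_empty]
    rintro rfl
    have hAm' : Am = ∅ := by simpa [Set.subset_empty_iff] using hAm
    subst hAm'
    simp at hspan
  obtain ⟨R, hR⟩ := exists_forall_abs_le_of_sum_exp_eq hne hAm hp hm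
  have hK : IsCompact (Set.Icc (fun _ => -R) (fun _ => R) ∩ {y : Fin n → ℝ |
      ∑ a ∈ Ap, c a * Real.exp (a ⬝ᵥ y) = ∑ b ∈ Am, c b * Real.exp (b ⬝ᵥ y)}) := by
    refine isCompact_Icc.inter_right (isClosed_eq ?_ ?_) <;>
    · unfold dotProduct
      fun_prop
  convert hK.image (f := fun y j => Real.exp (y j)) (by fun_prop) using 1
  ext x
  constructor
  · rintro ⟨hx, hf⟩
    have hexp : (fun j => Real.exp (Real.log (x j))) = x :=
      funext fun j => Real.exp_log (hx j)
    have hz : ∑ a ∈ Ap, c a * Real.exp (a ⬝ᵥ fun j => Real.log (x j)) =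
        ∑ b ∈ Am, c b * Real.exp (b ⬝ᵥ fun j => Real.log (x j)) := by
      simp_rw [← prod_exp_rpow_eq_exp_dotProduct, Real.exp_log (hx _)]
      exact sub_eq_zero.1 hf
    have hb := hR _ hz
    exact ⟨fun j => Real.log (x j),
      ⟨⟨fun j => (abs_le.1 (hb j)).1, fun j => (abs_le.1 (hb j)).2⟩, hz⟩, hexp⟩
  · rintro ⟨y, ⟨-, hy⟩, rfl⟩
    refine ⟨fun i => Real.exp_pos _, ?_⟩
    simp_rw [prod_exp_rpow_eq_exp_dotProduct]
    exact sub_eq_zero.2 hy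
end

section
/- Let A₊, A₋ ⊆ ℤⁿ be disjoint finite sets with A := A₊ ∪ A₋ full dimensional (the affine span of A is ℝⁿ). Let σ_a = +1 for a ∈ A₊ and σ_a = −1 for a ∈ A₋, and let τ : ℂ^A → ℂ^A be the involution τ(y)_a = σ_a y_a. For a subset S ⊆ ℂ^A define its Zariski closure Zar(S) := {z ∈ ℂ^A : p(z) = 0 for every polynomial p in the variables (y_a)_{a∈A} that vanishes identically on S}. Define the A-discriminant variety ∇_ℂ(A) := Zar({y ∈ ℂ^A : ∃ x ∈ (ℂ∖{0})ⁿ with ∑_{a∈A} y_a x^a = 0 and ∑_{a∈A} y_a a_i x^a = 0 for all i = 1,…,n}), and the signed discriminant ∇_{>0}(A₊,A₋) := {c ∈ ℝ^A_{>0} : ∃ x ∈ ℝⁿ_{>0} with ∑_{a∈A} σ_a c_a x^a = 0 and ∑_{a∈A} σ_a c_a a_i x^a = 0 for all i}, viewed as a subset of ℂ^A. If ∇_{>0}(A₊,A₋) ≠ ∅, then Zar(∇_{>0}(A₊,A₋)) = τ(∇_ℂ(A)). -/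
open Finset

attribute [local instance] Classical.propDecidable

/-- The Zariski closure of a subset of `ℂ^σ`: the common zero set of all polynomials
vanishing identically on `S`. -/
def zarClosure {σ : Type*} (S : Set (σ → ℂ)) : Set (σ → ℂ) :=
  {z | ∀ p : MvPolynomial σ ℂ,
    (∀ s ∈ S, MvPolynomial.eval s p = 0) → MvPolynomial.eval z p = 0}

variable {n : ℕ}

/-- The set of coefficient vectors `y ∈ ℂ^A` whose Laurent polynomial
`∑_{a∈A} y_a x^a` has a singular zero in the complex torus. Its Zariski closure is the
`A`-discriminant variety `∇_ℂ(A)`. -/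
def rawDiscC (Ap Am : Finset (Fin n → ℤ)) :
    Set ({a : Fin n → ℤ // a ∈ Ap ∪ Am} → ℂ) :=
  {y | ∃ x : Fin n → ℂ, (∀ i, x i ≠ 0) ∧
    (∑ a ∈ (Ap ∪ Am).attach, y a * ∏ i, x i ^ a.1 i = 0) ∧
    ∀ i : Fin n, ∑ a ∈ (Ap ∪ Am).attach, y a * (a.1 i : ℂ) * ∏ i', x i' ^ a.1 i' = 0}

/-- The signed `(A₊,A₋)`-discriminant, viewed inside `ℂ^A`: positive real coefficient
vectors `c` such that `∑_{a∈A} σ_a c_a x^a` has a positive singular zero. -/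
def signedDiscC (Ap Am : Finset (Fin n → ℤ)) :
    Set ({a : Fin n → ℤ // a ∈ Ap ∪ Am} → ℂ) :=
  {y | ∃ c : {a : Fin n → ℤ // a ∈ Ap ∪ Am} → ℝ, (∀ a, 0 < c a) ∧
    (∀ a, y a = (c a : ℂ)) ∧
    ∃ x : Fin n → ℝ, (∀ i, 0 < x i) ∧
      (∑ a ∈ (Ap ∪ Am).attach,
        (if a.1 ∈ Ap then (1 : ℝ) else -1) * c a * ∏ j, x j ^ a.1 j = 0) ∧
      ∀ i : Fin n, ∑ a ∈ (Ap ∪ Am).attach,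
        (if a.1 ∈ Ap then (1 : ℝ) else -1) * c a * (a.1 i : ℝ) * ∏ j, x j ^ a.1 j = 0}

/-- The sign involution `τ : ℂ^A → ℂ^A`, `τ(y)_a = σ_a y_a`. -/
def tauC (Ap Am : Finset (Fin n → ℤ)) :
    ({a : Fin n → ℤ // a ∈ Ap ∪ Am} → ℂ) → {a : Fin n → ℤ // a ∈ Ap ∪ Am} → ℂ :=
  fun y a => (if a.1 ∈ Ap then (1 : ℂ) else -1) * y a

/-- The involution `τ` commutes with taking Zariski closures. -/
theorem zarClosure_image_tauC (Ap Am : Finset (Fin n → ℤ))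
    (R : Set ({a : Fin n → ℤ // a ∈ Ap ∪ Am} → ℂ)) :
    zarClosure (tauC Ap Am '' R) = tauC Ap Am '' zarClosure R := by
  have hinv : ∀ y, tauC Ap Am (tauC Ap Am y) = y := by
    intro y
    funext a
    simp only [tauC]
    split_ifs <;> simp
  let Φ (p : MvPolynomial {a : Fin n → ℤ // a ∈ Ap ∪ Am} ℂ) :=
    MvPolynomial.bind₁ (fun a : {a : Fin n → ℤ // a ∈ Ap ∪ Am} =>
      MvPolynomial.C (if a.1 ∈ Ap then (1 : ℂ) else -1) * MvPolynomial.X a) p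
  have hΦ : ∀ p y, MvPolynomial.eval y (Φ p) = MvPolynomial.eval (tauC Ap Am y) p := by
    intro p y
    have h := MvPolynomial.eval₂Hom_bind₁ (RingHom.id ℂ) y
      (fun a : {a : Fin n → ℤ // a ∈ Ap ∪ Am} =>
        MvPolynomial.C (if a.1 ∈ Ap then (1 : ℂ) else -1) * MvPolynomial.X a) p
    refine h.trans ?_
    change _ = MvPolynomial.eval₂Hom (RingHom.id ℂ) _ p
    congr 2
    funext a
    simp [tauC]
  ext z
  constructor
  · intro hz
    refine ⟨tauC Ap Am z, fun p hp => ?_, hinv z⟩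
    rw [← hΦ]
    refine hz _ ?_
    rintro _ ⟨y, hy, rfl⟩
    rw [hΦ, hinv]
    exact hp y hy
  · rintro ⟨y, hy, rfl⟩ p hp
    rw [← hΦ]
    refine hy _ fun s hs => ?_
    rw [hΦ]
    exact hp _ ⟨s, hs, rfl⟩

/-- A positive coefficient vector with a positive singular zero yields, after twisting by the
signs, a coefficient vector with a singular zero in the complex torus. -/
theorem signedDiscC_subset_image_rawDiscC (Ap Am : Finset (Fin n → ℤ)) :
    signedDiscC Ap Am ⊆ tauC Ap Am '' rawDiscC Ap Am := by
  rintro y ⟨c, -, hy, x, hx, h0, h1⟩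
  refine ⟨tauC Ap Am y, ⟨fun i => (x i : ℂ), fun i => ?_, ?_, fun i => ?_⟩, ?_⟩
  · exact Complex.ofReal_ne_zero.2 (hx i).ne'
  · have := congrArg (fun r : ℝ => (r : ℂ)) h0
    push_cast at this
    rw [← this]
    refine Finset.sum_congr rfl fun a _ => ?_
    simp only [tauC, hy]
    split_ifs <;> simp
  · have := congrArg (fun r : ℝ => (r : ℂ)) (h1 i)
    push_cast at this
    rw [← this]
    refine Finset.sum_congr rfl fun a _ => ?_
    simp only [tauC, hy]
    split_ifs <;> simp
  · funext a
    simp only [tauC]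
    split_ifs <;> simp

/-- An entire function vanishing at all real points near `0` vanishes identically. -/
theorem eq_zero_of_eventually_ofReal_eq_zero {g : ℂ → ℂ} (hg : Differentiable ℂ g)
    (h : ∀ᶠ t : ℝ in nhds 0, g t = 0) (z : ℂ) : g z = 0 := by
  have hfreq : ∃ᶠ w in nhdsWithin (0 : ℂ) {0}ᶜ, g w = 0 := by
    have ht : Filter.Tendsto (fun t : ℝ => (t : ℂ)) (nhdsWithin 0 {0}ᶜ)
        (nhdsWithin (0 : ℂ) {0}ᶜ) := by
      refine tendsto_nhdsWithin_iff.2 ⟨?_, ?_⟩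
      · exact (Complex.continuous_ofReal.tendsto' 0 0 (by simp)).mono_left nhdsWithin_le_nhds
      · filter_upwards [self_mem_nhdsWithin] with t ht
        simpa using ht
    exact ht.frequently (h.filter_mono nhdsWithin_le_nhds).frequently
  have han : AnalyticOnNhd ℂ g Set.univ := fun w _ => hg.analyticAt w
  exact han.eqOn_zero_of_preconnected_of_frequently_eq_zero isPreconnected_univ
    (Set.mem_univ 0) hfreq (Set.mem_univ z)

theorem prod_exp_zpow (z : Fin n → ℂ) (a : Fin n → ℤ) :
    ∏ i, Complex.exp (z i) ^ a i = Complex.exp (∑ i, a i * z i) := by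
  simp [Complex.exp_sum, Complex.exp_int_mul]

theorem prod_real_exp_zpow (z : Fin n → ℝ) (a : Fin n → ℤ) :
    ∏ i, Real.exp (z i) ^ a i = Real.exp (∑ i, a i * z i) := by
  simp [Real.exp_sum, mul_comm (_ : ℝ) (z _), Real.exp_mul, Real.rpow_intCast]

/-- Given real affine relations `w` among the exponents with the prescribed strict signs, and any
`z`, the coefficients `σ_a w_a e^{-⟨a, z⟩}` lie in the signed discriminant. -/
theorem mem_signedDiscC_of_relation (Ap Am : Finset (Fin n → ℤ))
    (w : {a : Fin n → ℤ // a ∈ Ap ∪ Am} → ℝ) (z : Fin n → ℝ)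
    (hpos : ∀ a, 0 < (if a.1 ∈ Ap then (1 : ℝ) else -1) * w a)
    (h0 : ∑ a ∈ (Ap ∪ Am).attach, w a = 0)
    (h1 : ∀ i, ∑ a ∈ (Ap ∪ Am).attach, w a * (a.1 i : ℝ) = 0) :
    (fun a => (((if a.1 ∈ Ap then (1 : ℝ) else -1) * w a *
      Real.exp (-∑ i, a.1 i * z i) : ℝ) : ℂ)) ∈ signedDiscC Ap Am := by
  have key : ∀ a : {a : Fin n → ℤ // a ∈ Ap ∪ Am}, (if a.1 ∈ Ap then (1 : ℝ) else -1) *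
      ((if a.1 ∈ Ap then (1 : ℝ) else -1) * w a * Real.exp (-∑ i, a.1 i * z i)) *
      Real.exp (∑ i, a.1 i * z i) = w a := by
    intro a
    rw [Real.exp_neg]
    have := Real.exp_ne_zero (∑ i, a.1 i * z i)
    split_ifs <;> field_simp
  refine ⟨_, fun a => mul_pos (hpos a) (Real.exp_pos _), fun a => rfl,
    fun i => Real.exp (z i), fun i => Real.exp_pos _, ?_, fun i => ?_⟩
  · simp only [prod_real_exp_zpow, key, h0]
  · rw [← h1 i]
    refine Finset.sum_congr rfl fun a _ => ?_
    rw [prod_real_exp_zpow, mul_right_comm, key]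

/-- A polynomial vanishing on a nonempty signed discriminant vanishes on the sign twist of every
coefficient vector with a singular zero in the complex torus: both are joined by an entire curve
which runs in the signed discriminant for small real times. -/
theorem eval_tauC_eq_zero_of_mem_rawDiscC (Ap Am : Finset (Fin n → ℤ))
    (hne : (signedDiscC Ap Am).Nonempty)
    (p : MvPolynomial {a : Fin n → ℤ // a ∈ Ap ∪ Am} ℂ)
    (hp : ∀ s ∈ signedDiscC Ap Am, MvPolynomial.eval s p = 0)
    {y : {a : Fin n → ℤ // a ∈ Ap ∪ Am} → ℂ} (hy : y ∈ rawDiscC Ap Am) :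
    MvPolynomial.eval (tauC Ap Am y) p = 0 := by
  obtain ⟨_, c, hc, -, x₀, hx₀, hc0, hc1⟩ := hne
  obtain ⟨x, hx, hy0, hy1⟩ := hy
  let w₀ : {a : Fin n → ℤ // a ∈ Ap ∪ Am} → ℝ :=
    fun a => (if a.1 ∈ Ap then (1 : ℝ) else -1) * c a * ∏ j, x₀ j ^ a.1 j
  let w : {a : Fin n → ℤ // a ∈ Ap ∪ Am} → ℂ := fun a => y a * ∏ j, x j ^ a.1 j
  let ζ : Fin n → ℂ := fun i => Complex.log (x i)
  have hw₀pos : ∀ a, 0 < (if a.1 ∈ Ap then (1 : ℝ) else -1) * w₀ a := by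
    intro a
    have h := mul_pos (hc a) (Finset.prod_pos fun j (_ : j ∈ univ) => zpow_pos (hx₀ j) (a.1 j))
    simp only [w₀]
    split_ifs <;> linarith
  have hw₀1 : ∀ i, ∑ a ∈ (Ap ∪ Am).attach, w₀ a * (a.1 i : ℝ) = 0 := by
    intro i
    rw [← hc1 i]
    exact Finset.sum_congr rfl fun a _ => mul_right_comm _ _ _
  have hw1 : ∀ i, ∑ a ∈ (Ap ∪ Am).attach, w a * (a.1 i : ℂ) = 0 := by
    intro i
    rw [← hy1 i]
    exact Finset.sum_congr rfl fun a _ => mul_right_comm _ _ _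
  have hre0 : ∑ a ∈ (Ap ∪ Am).attach, (w a).re = 0 := by
    rw [← Complex.re_sum, hy0, Complex.zero_re]
  have him0 : ∑ a ∈ (Ap ∪ Am).attach, (w a).im = 0 := by
    rw [← Complex.im_sum, hy0, Complex.zero_im]
  have hre1 : ∀ i, ∑ a ∈ (Ap ∪ Am).attach, (w a).re * (a.1 i : ℝ) = 0 := by
    intro i
    simpa using congrArg Complex.re (hw1 i)
  have him1 : ∀ i, ∑ a ∈ (Ap ∪ Am).attach, (w a).im * (a.1 i : ℝ) = 0 := by
    intro i
    simpa using congrArg Complex.im (hw1 i)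
  let γ : ℝ → {a : Fin n → ℤ // a ∈ Ap ∪ Am} → ℝ :=
    fun t a => (w a).re + t * (w a).im + (t ^ 2 + 1) * (w₀ a - (w a).re)
  have hγ0 : ∀ t, ∑ a ∈ (Ap ∪ Am).attach, γ t a = 0 := by
    intro t
    simp only [γ, Finset.sum_add_distrib, ← Finset.mul_sum, Finset.sum_sub_distrib, hre0, him0]
    rw [show ∑ a ∈ (Ap ∪ Am).attach, w₀ a = 0 from hc0]
    ring
  have hγ1 : ∀ t i, ∑ a ∈ (Ap ∪ Am).attach, γ t a * (a.1 i : ℝ) = 0 := by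
    intro t i
    simp only [γ, add_mul, sub_mul, mul_assoc, Finset.sum_add_distrib, ← Finset.mul_sum,
      Finset.sum_sub_distrib, hre1, him1, hw₀1]
    ring
  have hγpos : ∀ᶠ t in nhds 0, ∀ a, 0 < (if a.1 ∈ Ap then (1 : ℝ) else -1) * γ t a := by
    refine Filter.eventually_all.2 fun a => ?_
    have hcont : Continuous fun t => (if a.1 ∈ Ap then (1 : ℝ) else -1) * γ t a := by
      simp only [γ]
      fun_prop
    refine hcont.continuousAt.eventually (lt_mem_nhds ?_)
    simpa [γ] using hw₀pos a
  let F : ℂ → {a : Fin n → ℤ // a ∈ Ap ∪ Am} → ℂ := fun t a =>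
    (if a.1 ∈ Ap then (1 : ℂ) else -1) *
      ((w a).re + t * (w a).im + (t ^ 2 + 1) * (w₀ a - (w a).re)) *
      Complex.exp (-∑ i, a.1 i * ((ζ i).re + t * (ζ i).im))
  have hF : Differentiable ℂ fun t => MvPolynomial.eval (F t) p := by
    simp only [MvPolynomial.eval_eq, F]
    fun_prop
  have hreal : ∀ᶠ t : ℝ in nhds 0, MvPolynomial.eval (F t) p = 0 := by
    filter_upwards [hγpos] with t ht
    have h := hp _ (mem_signedDiscC_of_relation Ap Am (γ t) (fun i => (ζ i).re + t * (ζ i).im)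
      ht (hγ0 t) (hγ1 t))
    convert h using 3
    funext a
    simp only [F, γ]
    split_ifs <;> push_cast <;> rfl
  have hI := eq_zero_of_eventually_ofReal_eq_zero hF hreal Complex.I
  convert hI using 3
  funext a
  have hprod : ∏ j, x j ^ a.1 j = Complex.exp (∑ i, a.1 i * ζ i) := by
    rw [← prod_exp_zpow]
    exact Finset.prod_congr rfl fun j _ => by rw [Complex.exp_log (hx j)]
  have hrw : ∀ z : ℂ, (z.re : ℂ) + Complex.I * z.im = z := fun z => by
    rw [mul_comm, Complex.re_add_im]
  simp only [F, tauC, hrw, Complex.I_sq, neg_add_cancel, zero_mul, add_zero]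
  simp only [w, hprod]
  rw [mul_assoc, mul_assoc, ← Complex.exp_add, add_neg_cancel, Complex.exp_zero, mul_one]

/-- **Zariski closure of the signed discriminant.** For a full-dimensional signed
support `(A₊, A₋)` in `ℤⁿ` with nonempty signed discriminant, the Zariski closure of
`∇_{>0}(A₊,A₋)` in `ℂ^A` equals `τ(∇_ℂ(A))`. -/
theorem stmt8 {n : ℕ} (Ap Am : Finset (Fin n → ℤ)) (hdisj : Disjoint Ap Am)
    (hspan : affineSpan ℝ
      (coeR '' ((Ap ∪ Am : Finset (Fin n → ℤ)) : Set (Fin n → ℤ))) = ⊤)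
    (hne : (signedDiscC Ap Am).Nonempty) :
    zarClosure (signedDiscC Ap Am) = tauC Ap Am '' zarClosure (rawDiscC Ap Am) := by
  rw [← zarClosure_image_tauC]
  apply Set.Subset.antisymm
  · exact fun z hz p hp => hz p fun s hs => hp s (signedDiscC_subset_image_rawDiscC Ap Am hs)
  · refine fun z hz p hp => hz p ?_
    rintro _ ⟨y, hy, rfl⟩
    exact eval_tauC_eq_zero_of_mem_rawDiscC Ap Am hne p hp hy
end

section
/- Let a_1, …, a_{n+1} ∈ ℝⁿ be affinely independent points whose affine span is ℝⁿ, let λ_1, …, λ_{n+1} > 0 with ∑_{i=1}^{n+1} λ_i = 1, and set b := ∑_{i=1}^{n+1} λ_i a_i (so b lies in the interior of the simplex conv{a_1,…,a_{n+1}}). Let c_1, …, c_{n+1} > 0 and d > 0, and consider the circuit signomial f(x) = ∑_{i=1}^{n+1} c_i x^{a_i} − d x^b on ℝⁿ_{>0}. Then f is copositive if and only if d ≤ ∏_{i=1}^{n+1} (c_i / λ_i)^{λ_i} (the circuit number). -/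
open Finset

/-- Affinely independent spanning points can be interpolated by an affine function. -/
theorem exists_affine_interpolation {ι κ : Type*} [Fintype ι] [Fintype κ] (a : ι → κ → ℝ)
    (haff : AffineIndependent ℝ a) (hspan : affineSpan ℝ (Set.range a) = ⊤) (w : ι → ℝ) :
    ∃ (y : κ → ℝ) (s : ℝ), ∀ i, ∑ j, a i j * y j + s = w i := by
  classical
  let B : AffineBasis ι ℝ (κ → ℝ) := ⟨a, haff, hspan⟩
  let φ : (κ → ℝ) →ᵃ[ℝ] ℝ := ∑ k, w k • B.coord k
  have hφ (p : κ → ℝ) : φ p = ∑ k, w k * B.coord k p :=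
    map_sum (AddMonoidHom.mk' (fun f : (κ → ℝ) →ᵃ[ℝ] ℝ => f p) (fun _ _ => rfl))
      (fun k => w k • B.coord k) univ
  refine ⟨fun j => φ.linear (Pi.single j 1), φ 0, fun i => ?_⟩
  have h_lin : φ.linear (a i) = ∑ j, a i j * φ.linear (Pi.single j 1) := by
    conv_lhs => rw [pi_eq_sum_univ' (a i), map_sum]
    refine sum_congr rfl fun j _ => ?_
    rw [map_smul, smul_eq_mul]
  have h_val : φ (a i) = w i := by
    rw [hφ, sum_eq_single i]
    · rw [show a i = B i from rfl, B.coord_apply_eq, mul_one]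
    · intro k _ hk
      rw [show a i = B i from rfl, B.coord_apply_ne hk, mul_zero]
    · simp
  rw [← h_lin, ← h_val]
  exact (congrFun φ.decomp (a i)).symm

/-- Monomials with real exponents turn linear combinations of exponents into products of powers. -/
theorem prod_rpow_sum_smul {ι κ : Type*} [Fintype ι] [Fintype κ] (a : ι → κ → ℝ) (lam : ι → ℝ)
    {x : κ → ℝ} (hx : ∀ j, 0 < x j) :
    ∏ j, x j ^ (∑ i, lam i • a i) j = ∏ i, (∏ j, x j ^ a i j) ^ lam i := by
  simp_rw [← Real.finsetProd_rpow _ _ (fun j _ => (Real.rpow_pos_of_pos (hx j) _).le)]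
  rw [prod_comm]
  refine prod_congr rfl fun j _ => ?_
  rw [Finset.sum_apply, Real.rpow_sum_of_pos (hx j)]
  refine prod_congr rfl fun i _ => ?_
  rw [← Real.rpow_mul (hx j).le, Pi.smul_apply, smul_eq_mul, mul_comm]

/-- **The circuit number characterises copositivity of circuit signomials.**
For affinely independent `a₁,…,a_{n+1}` spanning `ℝⁿ`, positive barycentric weights `λᵢ`
summing to `1`, `b = ∑ λᵢ aᵢ`, positive coefficients `cᵢ` and `d > 0`, the circuit
signomial `f(x) = ∑ cᵢ x^{aᵢ} − d x^b` is copositive iff `d ≤ ∏ (cᵢ/λᵢ)^{λᵢ}`. -/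
theorem stmt9 {n : ℕ} (a : Fin (n + 1) → Fin n → ℝ)
    (haff : AffineIndependent ℝ a)
    (hspan : affineSpan ℝ (Set.range a) = ⊤)
    (lam : Fin (n + 1) → ℝ) (hlam : ∀ i, 0 < lam i) (hsum : ∑ i, lam i = 1)
    (b : Fin n → ℝ) (hb : b = ∑ i, lam i • a i)
    (c : Fin (n + 1) → ℝ) (hc : ∀ i, 0 < c i) (d : ℝ) (hd : 0 < d) :
    (∀ x : Fin n → ℝ, (∀ i, 0 < x i) →
        0 ≤ ∑ i, c i * ∏ j, x j ^ a i j - d * ∏ j, x j ^ b j) ↔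
    d ≤ ∏ i, (c i / lam i) ^ lam i := by
  have h_quot (i) : 0 < c i / lam i := div_pos (hc i) (hlam i)
  have h_prod (x : Fin n → ℝ) (hx : ∀ i, 0 < x i) :
      ∏ i, (c i / lam i * ∏ j, x j ^ a i j) ^ lam i =
        (∏ i, (c i / lam i) ^ lam i) * ∏ j, x j ^ b j := by
    rw [hb, prod_rpow_sum_smul a lam hx, ← prod_mul_distrib]
    exact prod_congr rfl fun i _ => Real.mul_rpow (h_quot i).le
      (prod_nonneg fun j _ => (Real.rpow_pos_of_pos (hx j) _).le)
  have h_sum (x : Fin n → ℝ) :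
      ∑ i, c i * ∏ j, x j ^ a i j = ∑ i, lam i * (c i / lam i * ∏ j, x j ^ a i j) :=
    sum_congr rfl fun i _ => by rw [← mul_assoc, mul_div_cancel₀ _ (hlam i).ne']
  constructor
  · intro h
    obtain ⟨y, s, hys⟩ := exists_affine_interpolation a haff hspan
      fun i => -Real.log (c i / lam i)
    have hx (j) : 0 < Real.exp (y j) := Real.exp_pos _
    have h_term (i) : c i / lam i * ∏ j, Real.exp (y j) ^ a i j = Real.exp (-s) := by
      simp_rw [← Real.exp_mul]
      rw [← Real.exp_sum, ← Real.exp_log (h_quot i), ← Real.exp_add]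
      have := hys i
      simp_rw [mul_comm (a i _)] at this
      congr 1
      linarith
    have h_nonneg := h _ hx
    have h_eq := h_prod _ hx
    rw [h_sum] at h_nonneg
    simp_rw [h_term] at h_nonneg h_eq
    rw [← Real.rpow_sum_of_pos (Real.exp_pos _), hsum, Real.rpow_one] at h_eq
    rw [← sum_mul, hsum, one_mul, h_eq] at h_nonneg
    exact le_of_mul_le_mul_right (sub_nonneg.mp h_nonneg)
      (prod_pos fun j _ => Real.rpow_pos_of_pos (hx j) _)
  · intro h x hx
    rw [sub_nonneg, h_sum]
    calc d * ∏ j, x j ^ b j ≤ (∏ i, (c i / lam i) ^ lam i) * ∏ j, x j ^ b j :=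
          mul_le_mul_of_nonneg_right h
            (prod_nonneg fun j _ => (Real.rpow_pos_of_pos (hx j) _).le)
      _ = ∏ i, (c i / lam i * ∏ j, x j ^ a i j) ^ lam i := (h_prod x hx).symm
      _ ≤ _ := Real.geom_mean_le_arith_mean_weighted univ _ _ (fun i _ => (hlam i).le) hsum
          fun i _ => mul_nonneg (h_quot i).le
            (prod_nonneg fun j _ => (Real.rpow_pos_of_pos (hx j) _).le)
end

section
/- Let c_0, c_1, c_2, c_3, c_4 > 0 and consider f(x_1,x_2) = c_0 + c_1 x_1² + c_2 x_2² + c_3 x_1² x_2² − c_4 x_1 x_2. Then f(x_1,x_2) ≥ 0 for all x_1, x_2 > 0 if and only if c_4² ≤ 4(c_0 c_3 + c_1 c_2) + 8·√(c_0 c_1 c_2 c_3). -/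
/-- A positive real number is the fourth power of a positive real number. -/
lemma exists_pos_pow_four_eq {c : ℝ} (hc : 0 < c) : ∃ a : ℝ, 0 < a ∧ a ^ 4 = c :=
  ⟨√√c, by positivity, by
    rw [show (4 : ℕ) = 2 * 2 from rfl, pow_mul, Real.sq_sqrt (by positivity),
      Real.sq_sqrt hc.le]⟩

/-- Nonnegativity on the positive quadrant when the coefficients are given as fourth powers. -/
lemma forall_pos_nonneg_iff_le {a0 a1 a2 a3 c : ℝ} (h0 : 0 < a0) (h1 : 0 < a1) (h2 : 0 < a2)
    (h3 : 0 < a3) :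
    (∀ x y : ℝ, 0 < x → 0 < y →
      0 ≤ a0 ^ 4 + a1 ^ 4 * x ^ 2 + a2 ^ 4 * y ^ 2 + a3 ^ 4 * x ^ 2 * y ^ 2 - c * (x * y)) ↔
    c ≤ 2 * (a0 ^ 2 * a3 ^ 2 + a1 ^ 2 * a2 ^ 2) := by
  constructor
  · intro h
    have hmin := h (a0 * a2 / (a3 * a1)) (a0 * a1 / (a3 * a2)) (by positivity) (by positivity)
    have heq : a0 ^ 4 + a1 ^ 4 * (a0 * a2 / (a3 * a1)) ^ 2 + a2 ^ 4 * (a0 * a1 / (a3 * a2)) ^ 2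
          + a3 ^ 4 * (a0 * a2 / (a3 * a1)) ^ 2 * (a0 * a1 / (a3 * a2)) ^ 2
          - c * (a0 * a2 / (a3 * a1) * (a0 * a1 / (a3 * a2)))
        = a0 ^ 2 / a3 ^ 2 * (2 * (a0 ^ 2 * a3 ^ 2 + a1 ^ 2 * a2 ^ 2) - c) := by
      field_simp
      ring
    rw [heq] at hmin
    exact sub_nonneg.1 (nonneg_of_mul_nonneg_right hmin (by positivity))
  · intro h x y hx hy
    have hxy := mul_nonneg (sub_nonneg.2 h) (mul_pos hx hy).le
    linarith [sq_nonneg (a0 ^ 2 - a3 ^ 2 * (x * y)), sq_nonneg (a1 ^ 2 * x - a2 ^ 2 * y)]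


/-- **Copositivity of the square-support polynomial.**
`f(x₁,x₂) = c₀ + c₁x₁² + c₂x₂² + c₃x₁²x₂² − c₄x₁x₂` is nonnegative on the positive
orthant iff `c₄² ≤ 4(c₀c₃ + c₁c₂) + 8√(c₀c₁c₂c₃)`. -/
theorem stmt10 (c0 c1 c2 c3 c4 : ℝ) (h0 : 0 < c0) (h1 : 0 < c1) (h2 : 0 < c2)
    (h3 : 0 < c3) (h4 : 0 < c4) :
    (∀ x1 x2 : ℝ, 0 < x1 → 0 < x2 →
      0 ≤ c0 + c1 * x1 ^ 2 + c2 * x2 ^ 2 + c3 * x1 ^ 2 * x2 ^ 2 - c4 * (x1 * x2)) ↔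
    c4 ^ 2 ≤ 4 * (c0 * c3 + c1 * c2) + 8 * Real.sqrt (c0 * c1 * c2 * c3) := by
  obtain ⟨a0, ha0, rfl⟩ := exists_pos_pow_four_eq h0
  obtain ⟨a1, ha1, rfl⟩ := exists_pos_pow_four_eq h1
  obtain ⟨a2, ha2, rfl⟩ := exists_pos_pow_four_eq h2
  obtain ⟨a3, ha3, rfl⟩ := exists_pos_pow_four_eq h3
  have hsqrt : Real.sqrt (a0 ^ 4 * a1 ^ 4 * a2 ^ 4 * a3 ^ 4) = (a0 * a1 * a2 * a3) ^ 2 := by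
    rw [← Real.sqrt_sq (sq_nonneg (a0 * a1 * a2 * a3))]
    congr 1
    ring
  have hsq : 4 * (a0 ^ 4 * a3 ^ 4 + a1 ^ 4 * a2 ^ 4) + 8 * (a0 * a1 * a2 * a3) ^ 2
      = (2 * (a0 ^ 2 * a3 ^ 2 + a1 ^ 2 * a2 ^ 2)) ^ 2 := by
    ring
  rw [forall_pos_nonneg_iff_le ha0 ha1 ha2 ha3, hsqrt, hsq,
    sq_le_sq₀ h4.le (by positivity)]
end

section
/- Let A₊, A₋ ⊆ ℝⁿ be disjoint finite sets with A := A₊ ∪ A₋ full dimensional (affine span of A equal to ℝⁿ) and A₋ contained in the interior of conv(A₊). Let f be a signomial with signed support (A₊,A₋) and positive coefficients. If f can be written as a finite sum f = q_1 + … + q_r of copositive circuit signomials, then f has at most one positive singular zero. -/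
open Finset

attribute [local instance] Classical.propDecidable

variable {n : ℕ}

/-- A circuit signomial: either a single positive monomial term, or a signomial whose
positive support is a finite affinely independent set `B`, with a single negative term
whose exponent `b` lies in the relative interior of `conv B`. Equality is only required
on the positive orthant. -/
def IsCircuitSig (q : (Fin n → ℝ) → ℝ) : Prop :=
  (∃ d : ℝ, 0 < d ∧ ∃ a : Fin n → ℝ,
    ∀ x : Fin n → ℝ, (∀ i, 0 < x i) → q x = d * ∏ j, x j ^ a j) ∨
  (∃ B : Finset (Fin n → ℝ),
    AffineIndependent ℝ (fun p : {x // x ∈ B} => (p : Fin n → ℝ)) ∧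
    ∃ d : (Fin n → ℝ) → ℝ, (∀ a ∈ B, 0 < d a) ∧
    ∃ e : ℝ, 0 < e ∧ ∃ b : Fin n → ℝ,
      b ∈ intrinsicInterior ℝ (convexHull ℝ (B : Set (Fin n → ℝ))) ∧
      ∀ x : Fin n → ℝ, (∀ i, 0 < x i) →
        q x = ∑ a ∈ B, d a * ∏ j, x j ^ a j - e * ∏ j, x j ^ b j)

/-- Monomials in logarithmic coordinates. -/
theorem prod_exp_rpow (u a : Fin n → ℝ) :
    ∏ j, Real.exp (u j) ^ a j = Real.exp (a ⬝ᵥ u) := by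
  simp only [← Real.exp_mul, dotProduct, Real.exp_sum]
  exact Finset.prod_congr rfl fun j _ => by rw [mul_comm]

/-- Two zeros of a nonnegative exponential sum with a single negative term differ by a vector on
which all exponents agree. -/
theorem dotProduct_sub_eq_of_zeros {B : Finset (Fin n → ℝ)} {d : (Fin n → ℝ) → ℝ}
    (hd : ∀ a ∈ B, 0 < d a) {e : ℝ} {b u w : Fin n → ℝ}
    (hnonneg : ∀ z : Fin n → ℝ,
      0 ≤ ∑ a ∈ B, d a * Real.exp (a ⬝ᵥ z) - e * Real.exp (b ⬝ᵥ z))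
    (hu : ∑ a ∈ B, d a * Real.exp (a ⬝ᵥ u) - e * Real.exp (b ⬝ᵥ u) = 0)
    (hw : ∑ a ∈ B, d a * Real.exp (a ⬝ᵥ w) - e * Real.exp (b ⬝ᵥ w) = 0) :
    ∀ a ∈ B, a ⬝ᵥ (w - u) = b ⬝ᵥ (w - u) := by
  have key : ∀ z : Fin n → ℝ, ∑ a ∈ B, d a * Real.exp (a ⬝ᵥ z - b ⬝ᵥ z) - e =
      (∑ a ∈ B, d a * Real.exp (a ⬝ᵥ z) - e * Real.exp (b ⬝ᵥ z)) * Real.exp (-(b ⬝ᵥ z)) := by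
    intro z
    rw [sub_mul, Finset.sum_mul, mul_assoc, ← Real.exp_add, add_neg_cancel, Real.exp_zero, mul_one]
    congr 1
    refine Finset.sum_congr rfl fun a _ => ?_
    rw [mul_assoc, ← Real.exp_add, sub_eq_add_neg]
  have hu' := key u
  have hw' := key w
  rw [hu, zero_mul] at hu'
  rw [hw, zero_mul] at hw'
  have hm' : 0 ≤ ∑ a ∈ B, d a * Real.exp
      (a ⬝ᵥ ((1 / 2 : ℝ) • (u + w)) - b ⬝ᵥ ((1 / 2 : ℝ) • (u + w))) - e := by
    rw [key]
    exact mul_nonneg (hnonneg _) (Real.exp_pos _).le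
  have hsq : ∀ a : Fin n → ℝ,
      d a * (Real.exp ((a ⬝ᵥ u - b ⬝ᵥ u) / 2) - Real.exp ((a ⬝ᵥ w - b ⬝ᵥ w) / 2)) ^ 2 =
      d a * Real.exp (a ⬝ᵥ u - b ⬝ᵥ u) + d a * Real.exp (a ⬝ᵥ w - b ⬝ᵥ w) - 2 * (d a * Real.exp
        (a ⬝ᵥ ((1 / 2 : ℝ) • (u + w)) - b ⬝ᵥ ((1 / 2 : ℝ) • (u + w)))) := by
    intro a
    have h1 : a ⬝ᵥ ((1 / 2 : ℝ) • (u + w)) - b ⬝ᵥ ((1 / 2 : ℝ) • (u + w)) =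
        (a ⬝ᵥ u - b ⬝ᵥ u) / 2 + (a ⬝ᵥ w - b ⬝ᵥ w) / 2 := by
      simp only [dotProduct_smul, dotProduct_add, smul_eq_mul]
      ring
    have h2 : ∀ t : ℝ, Real.exp t = Real.exp (t / 2) * Real.exp (t / 2) := fun t => by
      rw [← Real.exp_add, add_halves]
    rw [h1, Real.exp_add, h2 (a ⬝ᵥ u - b ⬝ᵥ u), h2 (a ⬝ᵥ w - b ⬝ᵥ w)]
    ring
  have hsum : ∑ a ∈ B, d a *
      (Real.exp ((a ⬝ᵥ u - b ⬝ᵥ u) / 2) - Real.exp ((a ⬝ᵥ w - b ⬝ᵥ w) / 2)) ^ 2 ≤ 0 := by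
    simp only [hsq, Finset.sum_sub_distrib, Finset.sum_add_distrib, ← Finset.mul_sum]
    linarith
  have hterm : ∀ a ∈ B, 0 ≤ d a *
      (Real.exp ((a ⬝ᵥ u - b ⬝ᵥ u) / 2) - Real.exp ((a ⬝ᵥ w - b ⬝ᵥ w) / 2)) ^ 2 :=
    fun a ha => mul_nonneg (hd a ha).le (sq_nonneg _)
  intro a ha
  have h0 := (Finset.sum_eq_zero_iff_of_nonneg hterm).1
    (le_antisymm hsum (Finset.sum_nonneg hterm)) a ha
  have h1 := Real.exp_injective (sub_eq_zero.1
    (pow_eq_zero_iff two_ne_zero |>.1 ((mul_eq_zero.1 h0).resolve_left (hd a ha).ne')))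
  rw [dotProduct_sub, dotProduct_sub]
  linarith

/-- A copositive circuit signomial with two positive zeros vanishes on the whole line through them
in logarithmic coordinates. -/
theorem IsCircuitSig.eq_zero_on_line {q : (Fin n → ℝ) → ℝ} (hq : IsCircuitSig q)
    (hnonneg : ∀ x : Fin n → ℝ, (∀ i, 0 < x i) → 0 ≤ q x) {u w : Fin n → ℝ}
    (hu : q (fun i => Real.exp (u i)) = 0) (hw : q (fun i => Real.exp (w i)) = 0) (s : ℝ) :
    q (fun i => Real.exp ((u + s • (w - u)) i)) = 0 := by
  have hpos : ∀ (z : Fin n → ℝ) (i : Fin n), 0 < Real.exp (z i) := fun z i => Real.exp_pos _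
  obtain ⟨d, hd, a, h⟩ | ⟨B, -, d, hd, e, -, b, -, h⟩ := hq
  · rw [h _ (hpos u), prod_exp_rpow] at hu
    exact absurd hu (mul_pos hd (Real.exp_pos _)).ne'
  · have h' : ∀ z : Fin n → ℝ, q (fun i => Real.exp (z i)) =
        ∑ a ∈ B, d a * Real.exp (a ⬝ᵥ z) - e * Real.exp (b ⬝ᵥ z) := fun z => by
      rw [h _ (hpos z)]
      simp only [prod_exp_rpow]
    have hagree := dotProduct_sub_eq_of_zeros hd (fun z => h' z ▸ hnonneg _ (hpos z))
      (h' u ▸ hu) (h' w ▸ hw)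
    rw [h'] at hu ⊢
    rw [← zero_mul (Real.exp (s * b ⬝ᵥ (w - u))), ← hu, sub_mul, Finset.sum_mul, mul_assoc,
      ← Real.exp_add, dotProduct_add, dotProduct_smul, smul_eq_mul]
    congr 1
    refine Finset.sum_congr rfl fun a ha => ?_
    rw [mul_assoc, ← Real.exp_add, dotProduct_add, dotProduct_smul, smul_eq_mul, hagree a ha]

/-- A linear functional does not attain its maximum over a convex hull at an interior point. -/
theorem exists_dotProduct_lt_of_mem_interior_convexHull {S : Set (Fin n → ℝ)} {b v : Fin n → ℝ}
    (hb : b ∈ interior (convexHull ℝ S)) (hv : v ≠ 0) : ∃ a ∈ S, b ⬝ᵥ v < a ⬝ᵥ v := by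
  by_contra! hcon
  have hsub : convexHull ℝ S ⊆ {z | z ⬝ᵥ v ≤ b ⬝ᵥ v} :=
    convexHull_min hcon (convex_halfSpace_le
      ⟨fun x y => add_dotProduct x y v, fun t x => smul_dotProduct t x v⟩ _)
  have hcont : Filter.Tendsto (fun ε : ℝ => b + ε • v) (nhdsWithin 0 (Set.Ioi 0)) (nhds b) := by
    have : Continuous fun ε : ℝ => b + ε • v := by fun_prop
    simpa using (this.tendsto 0).mono_left nhdsWithin_le_nhds
  obtain ⟨ε, hε, hpos⟩ := ((hcont.eventually (mem_interior_iff_mem_nhds.1 hb)).and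
    self_mem_nhdsWithin).exists
  have hle : (b + ε • v) ⬝ᵥ v ≤ b ⬝ᵥ v := hsub hε
  rw [add_dotProduct, smul_dotProduct, smul_eq_mul] at hle
  have hvv : 0 < v ⬝ᵥ v :=
    lt_of_le_of_ne (Finset.sum_nonneg fun i _ => mul_self_nonneg _)
      fun h => hv (dotProduct_self_eq_zero.1 h.symm)
  have := mul_pos (Set.mem_Ioi.1 hpos) hvv
  linarith

/-- An exponential sum along a line is nonzero somewhere if its largest growth rate occurs only
among the positive terms. -/
theorem exists_exp_sum_ne_zero {Ap Am : Finset (Fin n → ℝ)} (hAp : Ap.Nonempty)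
    {c : (Fin n → ℝ) → ℝ} (hc : ∀ a ∈ Ap, 0 < c a) {v : Fin n → ℝ}
    (hAm : ∀ b ∈ Am, ∃ a ∈ Ap, b ⬝ᵥ v < a ⬝ᵥ v) (u : Fin n → ℝ) :
    ∃ s : ℝ, ∑ a ∈ Ap, c a * Real.exp (a ⬝ᵥ (u + s • v))
      - ∑ b ∈ Am, c b * Real.exp (b ⬝ᵥ (u + s • v)) ≠ 0 := by
  obtain ⟨m, hm, hmax⟩ := Ap.exists_max_image (fun a => a ⬝ᵥ v) hAp
  have htend : Filter.Tendsto
      (fun s : ℝ => ∑ b ∈ Am, c b * Real.exp (b ⬝ᵥ u + s * (b ⬝ᵥ v - m ⬝ᵥ v)))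
      Filter.atTop (nhds 0) := by
    rw [← Finset.sum_const_zero (s := Am) (M := ℝ)]
    refine tendsto_finsetSum _ fun b hb => ?_
    obtain ⟨a, ha, hlt⟩ := hAm b hb
    have hneg : b ⬝ᵥ v - m ⬝ᵥ v < 0 := sub_neg.2 (hlt.trans_le (hmax a ha))
    rw [← mul_zero (c b)]
    exact (Real.tendsto_exp_atBot.comp (Filter.tendsto_atBot_add_const_left _ _
      (Filter.tendsto_id.atTop_mul_const_of_neg hneg))).const_mul _
  obtain ⟨s, hs⟩ := (htend.eventually
    (gt_mem_nhds (mul_pos (hc m hm) (Real.exp_pos (m ⬝ᵥ u))))).exists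
  refine ⟨s, fun h0 => hs.not_ge ?_⟩
  have hshift : ∀ a : Fin n → ℝ, c a * Real.exp (a ⬝ᵥ (u + s • v)) * Real.exp (-(s * m ⬝ᵥ v)) =
      c a * Real.exp (a ⬝ᵥ u + s * (a ⬝ᵥ v - m ⬝ᵥ v)) := fun a => by
    rw [mul_assoc, ← Real.exp_add, dotProduct_add, dotProduct_smul, smul_eq_mul]
    ring_nf
  have h1 := congrArg (· * Real.exp (-(s * m ⬝ᵥ v))) h0
  simp only [sub_mul, Finset.sum_mul, hshift, zero_mul] at h1
  rw [← sub_eq_zero.1 h1]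
  simpa using Finset.single_le_sum
    (f := fun a => c a * Real.exp (a ⬝ᵥ u + s * (a ⬝ᵥ v - m ⬝ᵥ v)))
    (fun a ha => (mul_pos (hc a ha) (Real.exp_pos _)).le) hm

/-- **SONC signomials have at most one positive singular zero.** If `A = A₊ ∪ A₋` is
full dimensional, `A₋ ⊆ int(conv A₊)`, and the signomial `f` with signed support
`(A₊,A₋)` is a finite sum of copositive circuit signomials, then `f` has at most one
positive singular zero. -/
theorem stmt11 {n : ℕ} (Ap Am : Finset (Fin n → ℝ)) (hdisj : Disjoint Ap Am)
    (hspan : affineSpan ℝ ((Ap ∪ Am : Finset (Fin n → ℝ)) : Set (Fin n → ℝ)) = ⊤)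
    (hAm : (Am : Set (Fin n → ℝ)) ⊆ interior (convexHull ℝ (Ap : Set (Fin n → ℝ))))
    (c : (Fin n → ℝ) → ℝ) (hc : ∀ a ∈ Ap ∪ Am, 0 < c a)
    (hSONC : ∃ r : ℕ, ∃ q : Fin r → (Fin n → ℝ) → ℝ,
      (∀ j, IsCircuitSig (q j) ∧ ∀ x : Fin n → ℝ, (∀ i, 0 < x i) → 0 ≤ q j x) ∧
      ∀ x : Fin n → ℝ, (∀ i, 0 < x i) →
        ∑ a ∈ Ap, c a * ∏ j, x j ^ a j - ∑ b ∈ Am, c b * ∏ j, x j ^ b j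
          = ∑ j, q j x) :
    ∀ x y : Fin n → ℝ,
      ((∀ i, 0 < x i) ∧
        (∑ a ∈ Ap, c a * ∏ j, x j ^ a j - ∑ b ∈ Am, c b * ∏ j, x j ^ b j = 0) ∧
        ∀ i : Fin n, ∑ a ∈ Ap, c a * a i * ∏ j, x j ^ a j
          - ∑ b ∈ Am, c b * b i * ∏ j, x j ^ b j = 0) →
      ((∀ i, 0 < y i) ∧
        (∑ a ∈ Ap, c a * ∏ j, y j ^ a j - ∑ b ∈ Am, c b * ∏ j, y j ^ b j = 0) ∧
        ∀ i : Fin n, ∑ a ∈ Ap, c a * a i * ∏ j, y j ^ a j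
          - ∑ b ∈ Am, c b * b i * ∏ j, y j ^ b j = 0) →
      x = y := by
  obtain ⟨r, q, hq, hf⟩ := hSONC
  rintro x y ⟨hx, hfx, -⟩ ⟨hy, hfy, -⟩
  set u : Fin n → ℝ := fun i => Real.log (x i) with hu
  set w : Fin n → ℝ := fun i => Real.log (y i) with hw
  have hxu : x = fun i => Real.exp (u i) := funext fun i => (Real.exp_log (hx i)).symm
  have hyw : y = fun i => Real.exp (w i) := funext fun i => (Real.exp_log (hy i)).symm
  have hzero : ∀ z : Fin n → ℝ, (∀ i, 0 < z i) →
      ∑ a ∈ Ap, c a * ∏ j, z j ^ a j - ∑ b ∈ Am, c b * ∏ j, z j ^ b j = 0 →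
      ∀ j, q j z = 0 := fun z hz h0 j =>
    (Finset.sum_eq_zero_iff_of_nonneg fun j _ => (hq j).2 z hz).1 ((hf z hz).symm.trans h0) j
      (Finset.mem_univ j)
  by_contra hne
  have hv : w - u ≠ 0 := fun h => hne (by rw [hxu, hyw, sub_eq_zero.1 h])
  have hAp : Ap.Nonempty := by
    rw [Finset.nonempty_iff_ne_empty]
    rintro rfl
    have hAm' : Am = ∅ := by simpa using hAm
    simp [hAm'] at hspan
  obtain ⟨s, hs⟩ := exists_exp_sum_ne_zero hAp
    (fun a ha => hc a (Finset.mem_union_left _ ha))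
    (fun b hb => exists_dotProduct_lt_of_mem_interior_convexHull (hAm hb) hv) u
  refine hs ?_
  have hline := hf (fun i => Real.exp ((u + s • (w - u)) i)) fun i => Real.exp_pos _
  simp only [prod_exp_rpow] at hline
  rw [hline]
  exact Finset.sum_eq_zero fun j _ => (hq j).1.eq_zero_on_line (hq j).2
    (hxu ▸ hzero x hx hfx j) (hyw ▸ hzero y hy hfy j) s
end

section
/- Let B = {a_1, …, a_k} ⊆ ℝⁿ be a finite affinely independent set, let λ_1, …, λ_k > 0 with ∑_{i=1}^k λ_i = 1, and set b := ∑_{i=1}^k λ_i a_i (so b lies in the relative interior of conv(B) and b ∉ B). Let d_1, …, d_k > 0 and e > 0, and let q(x) = ∑_{i=1}^k d_i x^{a_i} − e x^b on ℝⁿ_{>0}. If q has a positive singular zero, then q is copositive. -/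
open Finset

/-- Weighted AM-GM for monomials with real exponents. -/
lemma prod_rpow_sum_le_sum_mul_prod_rpow {ι κ : Type*} [Fintype ι] [Fintype κ]
    (a : ι → κ → ℝ) (w : ι → ℝ) (hw : ∀ i, 0 ≤ w i) (hsum : ∑ i, w i = 1)
    (z : κ → ℝ) (hz : ∀ j, 0 < z j) :
    ∏ j, z j ^ (∑ i, w i * a i j) ≤ ∑ i, w i * ∏ j, z j ^ a i j := by
  have h := Real.geom_mean_le_arith_mean_weighted univ w (fun i => ∏ j, z j ^ a i j)
    (fun i _ => hw i) hsum
    (fun i _ => prod_nonneg fun j _ => (Real.rpow_pos_of_pos (hz j) _).le)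
  refine le_trans (le_of_eq ?_) h
  simp_rw [Real.rpow_sum_of_pos (hz _)]
  rw [prod_comm]
  refine prod_congr rfl fun i _ => ?_
  rw [← Real.finsetProd_rpow _ _ fun j _ => (Real.rpow_pos_of_pos (hz j) _).le]
  refine prod_congr rfl fun j _ => ?_
  rw [← Real.rpow_mul (hz j).le, mul_comm]

/-- **A circuit signomial with a positive singular zero is copositive.**
Here `B = {a₁,…,a_k}` is affinely independent, `b = ∑ λᵢ aᵢ` with all `λᵢ > 0` summing
to `1`, so `b` is in the relative interior of `conv B`, and
`q(x) = ∑ dᵢ x^{aᵢ} − e x^b`. -/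
theorem stmt12 {n k : ℕ} (a : Fin k → Fin n → ℝ) (haff : AffineIndependent ℝ a)
    (lam : Fin k → ℝ) (hlam : ∀ i, 0 < lam i) (hsum : ∑ i, lam i = 1)
    (b : Fin n → ℝ) (hb : b = ∑ i, lam i • a i)
    (d : Fin k → ℝ) (hd : ∀ i, 0 < d i) (e : ℝ) (he : 0 < e)
    (x : Fin n → ℝ) (hx : ∀ i, 0 < x i)
    (hzero : ∑ i, d i * ∏ j, x j ^ a i j - e * ∏ j, x j ^ b j = 0)
    (hsing : ∀ i : Fin n,
      ∑ l, d l * a l i * ∏ j, x j ^ a l j - e * b i * ∏ j, x j ^ b j = 0) :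
    ∀ y : Fin n → ℝ, (∀ i, 0 < y i) →
      0 ≤ ∑ i, d i * ∏ j, y j ^ a i j - e * ∏ j, y j ^ b j := by
  intro y hy
  set E := e * ∏ j, x j ^ b j with hE
  have hE0 : 0 < E := mul_pos he (prod_pos fun j _ => Real.rpow_pos_of_pos (hx j) _)
  have hcoeff : ∀ i, d i * ∏ j, x j ^ a i j = E * lam i := by
    intro i
    refine sub_eq_zero.mp (affineIndependent_iff.mp haff univ
      (fun i => d i * ∏ j, x j ^ a i j - E * lam i) ?_ ?_ i (mem_univ i))
    · rw [sum_sub_distrib, ← mul_sum, hsum, mul_one, hzero]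
    · ext j
      have hbj : b j = ∑ l, lam l * a l j := by simp [hb]
      have h := hsing j
      rw [show e * b j * ∏ j, x j ^ b j = E * b j by rw [hE]; ring, hbj, mul_sum,
        ← sum_sub_distrib] at h
      simp only [Finset.sum_apply, Pi.smul_apply, smul_eq_mul, Pi.zero_apply]
      rw [← h]
      exact sum_congr rfl fun l _ => by ring
  have hsplit : ∀ c : Fin n → ℝ,
      ∏ j, y j ^ c j = (∏ j, x j ^ c j) * ∏ j, (y j / x j) ^ c j := by
    intro c
    rw [← prod_mul_distrib]
    refine prod_congr rfl fun j _ => ?_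
    rw [← Real.mul_rpow (hx j).le (div_pos (hy j) (hx j)).le, mul_div_cancel₀ _ (hx j).ne']
  have hamgm := prod_rpow_sum_le_sum_mul_prod_rpow a lam (fun i => (hlam i).le) hsum
    (fun j => y j / x j) fun j => div_pos (hy j) (hx j)
  have hbj : ∀ j, ∑ i, lam i * a i j = b j := fun j => by simp [hb]
  simp only [hbj] at hamgm
  simp_rw [hsplit, ← mul_assoc, hcoeff, mul_assoc E, ← mul_sum]
  rw [← hE]
  exact sub_nonneg.mpr (mul_le_mul_of_nonneg_left hamgm hE0.le)
end

section
/- Let a_1, …, a_{n+1} ∈ ℝⁿ be affinely independent points whose affine span is ℝⁿ, so that every point of conv{a_1,…,a_{n+1}} has unique barycentric coordinates. Let A₋ ⊆ conv{a_1,…,a_{n+1}} be a nonempty finite set disjoint from {a_1,…,a_{n+1}}, and for b ∈ A₋ let λ^b_1, …, λ^b_{n+1} ≥ 0 be the barycentric coordinates of b (∑_i λ^b_i = 1 and ∑_i λ^b_i a_i = b). Let f(x) = ∑_{i=1}^{n+1} c_i x^{a_i} − ∑_{b∈A₋} c_b x^b with all c_i, c_b > 0. Then the all-ones point 𝟙 =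 (1,…,1) is a positive singular zero of f if and only if c_i = ∑_{b∈A₋} λ^b_i c_b for all i = 1,…,n+1. -/
open Finset

/-- **Barycentric characterisation of the all-ones point being a positive singular zero.**
For an extended circuit with simplex vertices `a₁,…,a_{n+1}` and negative support `A₋`
with barycentric coordinates `λ^b`, the point `𝟙` is a positive singular zero of
`f(x) = ∑ cᵢ x^{aᵢ} − ∑_{b∈A₋} c_b x^b` iff `cᵢ = ∑_{b∈A₋} λ^b_i c_b` for all `i`. -/
theorem stmt13 {n : ℕ} (a : Fin (n + 1) → Fin n → ℝ)
    (haff : AffineIndependent ℝ a) (hspan : affineSpan ℝ (Set.range a) = ⊤)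
    (Am : Finset (Fin n → ℝ)) (hAmne : Am.Nonempty)
    (hAmconv : (Am : Set (Fin n → ℝ)) ⊆ convexHull ℝ (Set.range a))
    (hdisj : ∀ b ∈ Am, b ∉ Set.range a)
    (lam : (Fin n → ℝ) → Fin (n + 1) → ℝ)
    (hlam0 : ∀ b ∈ Am, ∀ i, 0 ≤ lam b i)
    (hlam1 : ∀ b ∈ Am, ∑ i, lam b i = 1)
    (hlamb : ∀ b ∈ Am, ∑ i, lam b i • a i = b)
    (ci : Fin (n + 1) → ℝ) (hci : ∀ i, 0 < ci i)
    (cb : (Fin n → ℝ) → ℝ) (hcb : ∀ b ∈ Am, 0 < cb b) :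
    ((∑ i, ci i * ∏ j, (1 : ℝ) ^ a i j
        - ∑ b ∈ Am, cb b * ∏ j, (1 : ℝ) ^ b j = 0) ∧
      ∀ j : Fin n,
        ∑ i, ci i * a i j * ∏ l, (1 : ℝ) ^ a i l
          - ∑ b ∈ Am, cb b * b j * ∏ l, (1 : ℝ) ^ b l = 0) ↔
    ∀ i, ci i = ∑ b ∈ Am, lam b i * cb b := by
  have hmass : ∑ i, ∑ b ∈ Am, lam b i * cb b = ∑ b ∈ Am, cb b := by
    rw [Finset.sum_comm]
    refine Finset.sum_congr rfl fun b hb => ?_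
    rw [← Finset.sum_mul, hlam1 b hb, one_mul]
  have hmoment (j : Fin n) :
      ∑ i, (∑ b ∈ Am, lam b i * cb b) * a i j = ∑ b ∈ Am, cb b * b j := by
    simp_rw [Finset.sum_mul]
    rw [Finset.sum_comm]
    refine Finset.sum_congr rfl fun b hb => ?_
    have hbj : ∑ i, lam b i * a i j = b j := by
      simpa using congrFun (hlamb b hb) j
    rw [← hbj, Finset.mul_sum]
    exact Finset.sum_congr rfl fun i _ => by ring
  simp only [Real.one_rpow, Finset.prod_const_one, mul_one, sub_eq_zero]
  constructor
  · rintro ⟨hsum, hgrad⟩ i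
    refine sub_eq_zero.mp (affineIndependent_iff.mp haff Finset.univ
      (fun i => ci i - ∑ b ∈ Am, lam b i * cb b) ?_ ?_ i (Finset.mem_univ i))
    · rw [Finset.sum_sub_distrib, hmass, hsum, sub_self]
    · ext j
      simp only [Finset.sum_apply, Pi.smul_apply, smul_eq_mul, sub_mul,
        Finset.sum_sub_distrib, hmoment, hgrad, sub_self, Pi.zero_apply]
  · intro h
    simp only [h, hmass, hmoment, implies_true, and_self]
end

section
/- Let A₊, A₋ ⊆ ℝⁿ be disjoint finite sets with A := A₊ ∪ A₋ having affine span equal to ℝⁿ. Let V_1, …, V_r ⊆ A₊ be affinely independent subsets of cardinality n+1 (so each Δ_k := conv(V_k) is a full-dimensional simplex) with A₋ ⊆ Δ_k for every k. For b ∈ A₋ and k ∈ {1,…,r}, let λ^b_{a,k} (a ∈ V_k) be the barycentric coordinates of b with respect to V_k, and set λ^b_{a,k} := 0 for a ∈ A₊ ∖ V_k. Let f be the signomial with signed support (A₊,A₋) and positive coefficients c such that 𝟙 = (1,…,1) is a positive singular zero of f. Suppose δ = (δ_1,…,δ_r) ∈ ℝ^r satisfies c_a = ∑_{k=1}^r δ_k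 (∑_{b∈A₋} λ^b_{a,k} c_b) for all a ∈ A₊. Then: (i) ∑_{k=1}^r δ_k = 1; (ii) if moreover δ_k ≥ 0 for all k, then setting J := {j : δ_j > 0} and q_j(x) := ∑_{a∈V_j} δ_j (∑_{b∈A₋} λ^b_{a,j} c_b) x^a − ∑_{b∈A₋} δ_j c_b x^b, one has f = ∑_{j∈J} q_j on ℝⁿ_{>0}, each q_j has 𝟙 as a positive singular zero, each q_j is copositive, and f is a finite sum of copositive circuit signomials. -/
open Finset

attribute [local instance] Classical.propDecidable

variable {n : ℕ}

/-- The signomial with signed support `(A₊, A₋)` and coefficients `c`. -/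
noncomputable def signomial (Ap Am : Finset (Fin n → ℝ)) (c : (Fin n → ℝ) → ℝ)
    (x : Fin n → ℝ) : ℝ :=
  ∑ a ∈ Ap, c a * ∏ j, x j ^ a j - ∑ b ∈ Am, c b * ∏ j, x j ^ b j

/-- The `i`-th component `x_i ∂f/∂x_i` of the critical system of the signomial. -/
noncomputable def sigD (Ap Am : Finset (Fin n → ℝ)) (c : (Fin n → ℝ) → ℝ)
    (x : Fin n → ℝ) (i : Fin n) : ℝ :=
  ∑ a ∈ Ap, c a * a i * ∏ j, x j ^ a j - ∑ b ∈ Am, c b * b i * ∏ j, x j ^ b j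

/-- `x` is a positive singular zero of the signomial with signed support `(A₊, A₋)`
and coefficients `c`. -/
def IsPosSingZero (Ap Am : Finset (Fin n → ℝ)) (c : (Fin n → ℝ) → ℝ)
    (x : Fin n → ℝ) : Prop :=
  (∀ i, 0 < x i) ∧ signomial Ap Am c x = 0 ∧ ∀ i, sigD Ap Am c x i = 0

/-- The coefficients of the summand `q_j` in the decomposition of the critical system:
`δ_j (∑_{b∈A₋} λ^b_{a,j} c_b)` on the vertex set `V_j` and `δ_j c_b` on `A₋`. -/
noncomputable def qCoeff (Vj : Finset (Fin n → ℝ)) (lamj : (Fin n → ℝ) → (Fin n → ℝ) → ℝ)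
    (Am : Finset (Fin n → ℝ)) (c : (Fin n → ℝ) → ℝ) (δj : ℝ) :
    (Fin n → ℝ) → ℝ :=
  fun p => if p ∈ Vj then δj * ∑ b ∈ Am, lamj b p * c b else δj * c p

/-- A convex combination of a finite set with strictly positive weights lies in the relative
interior of its convex hull. -/
theorem sum_smul_mem_intrinsicInterior_convexHull {E : Type*} [NormedAddCommGroup E]
    [NormedSpace ℝ E] [FiniteDimensional ℝ E] (B : Finset E) (w : E → ℝ)
    (hw : ∀ a ∈ B, 0 < w a) (hw1 : ∑ a ∈ B, w a = 1) :
    ∑ a ∈ B, w a • a ∈ intrinsicInterior ℝ (convexHull ℝ (B : Set E)) := by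
  have hB : B.Nonempty := by
    rw [Finset.nonempty_iff_ne_empty]
    rintro rfl
    simp at hw1
  obtain ⟨y, hy⟩ := Set.Nonempty.intrinsicInterior (convex_convexHull ℝ (B : Set E))
    hB.to_set.convexHull
  obtain ⟨u, hu0, hu1, huy⟩ := Finset.mem_convexHull'.1 (intrinsicInterior_subset hy)
  obtain ⟨t, ht0, ht1, htw⟩ : ∃ t : ℝ, 0 < t ∧ t < 1 ∧ ∀ a ∈ B, t ≤ w a := by
    refine ⟨min (1 / 2) (B.inf' hB w), ?_, ?_, ?_⟩
    · rw [lt_min_iff, Finset.lt_inf'_iff]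
      exact ⟨by norm_num, hw⟩
    · exact (min_le_left _ _).trans_lt (by norm_num)
    · exact fun a ha => (min_le_right _ _).trans (Finset.inf'_le _ ha)
  have hs : 0 < 1 - t := by linarith
  set b := ∑ a ∈ B, w a • a with hb
  set d := (1 - t)⁻¹ • (b - t • y) with hd
  have hdmem : d ∈ convexHull ℝ (B : Set E) := by
    refine Finset.mem_convexHull'.2 ⟨fun a => (1 - t)⁻¹ * (w a - t * u a), ?_, ?_, ?_⟩
    · intro a ha
      have hua : u a ≤ 1 := hu1 ▸ Finset.single_le_sum hu0 ha
      have : t * u a ≤ w a := by nlinarith [htw a ha]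
      exact mul_nonneg (inv_nonneg.2 hs.le) (by linarith)
    · rw [← Finset.mul_sum, Finset.sum_sub_distrib, ← Finset.mul_sum, hw1, hu1, mul_one,
        inv_mul_cancel₀ hs.ne']
    · simp_rw [mul_smul, sub_smul, mul_smul]
      rw [← Finset.smul_sum, Finset.sum_sub_distrib, ← Finset.smul_sum, huy]
  have hby : b = t • y + (1 - t) • d := by
    rw [hd, smul_smul, mul_inv_cancel₀ hs.ne', one_smul]
    abel
  set S := convexHull ℝ (B : Set E) with hS
  have hdS : d ∈ affineSpan ℝ S := subset_affineSpan _ _ hdmem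
  obtain ⟨y', hy', rfl⟩ := mem_intrinsicInterior.1 hy
  let g : affineSpan ℝ S → affineSpan ℝ S := fun z =>
    ⟨AffineMap.lineMap d (z : E) t⁻¹, AffineMap.lineMap_mem _ hdS z.2⟩
  have hg : Continuous g := by
    refine Continuous.subtype_mk ?_ _
    simp only [AffineMap.lineMap_apply_module]
    fun_prop
  have hgz : ∀ z : affineSpan ℝ S, (z : E) = t • (g z : E) + (1 - t) • d := by
    intro z
    simp only [g, AffineMap.lineMap_apply_module, smul_add, sub_smul, smul_sub, smul_smul,
      mul_inv_cancel₀ ht0.ne', one_smul]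
    abel
  have hbS : b ∈ affineSpan ℝ S := by
    refine subset_affineSpan _ _ (Finset.mem_convexHull'.2 ⟨w, fun a ha => (hw a ha).le, hw1, rfl⟩)
  refine mem_intrinsicInterior.2 ⟨⟨b, hbS⟩, ?_, rfl⟩
  refine mem_interior.2 ⟨g ⁻¹' interior ((↑) ⁻¹' S), ?_, isOpen_interior.preimage hg, ?_⟩
  · intro z hz
    have hz' : g z ∈ ((↑) ⁻¹' S : Set (affineSpan ℝ S)) := interior_subset hz
    change (z : E) ∈ S
    rw [hgz z]
    exact convex_convexHull ℝ _ hz' hdmem ht0.le hs.le (by ring)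
  · have : g ⟨b, hbS⟩ = y' := by
      have h := hgz ⟨b, hbS⟩
      apply Subtype.ext
      have h2 : t • (g ⟨b, hbS⟩ : E) = t • (y' : E) := add_right_cancel (h.symm.trans hby)
      exact smul_right_injective E ht0.ne' h2
    rw [Set.mem_preimage, this]
    exact hy'

/-- Weighted arithmetic-geometric mean inequality for monomials with real exponents. -/
theorem prod_rpow_le_sum_mul_prod_rpow (V : Finset (Fin n → ℝ)) (w : (Fin n → ℝ) → ℝ)
    (b x : Fin n → ℝ) (hw : ∀ a ∈ V, 0 ≤ w a) (hw1 : ∑ a ∈ V, w a = 1)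
    (hwb : ∑ a ∈ V, w a • a = b) (hx : ∀ i, 0 < x i) :
    ∏ j, x j ^ b j ≤ ∑ a ∈ V, w a * ∏ j, x j ^ a j := by
  have h := Real.geom_mean_le_arith_mean_weighted V w (fun a => ∏ j, x j ^ a j) hw hw1
    fun a _ => Finset.prod_nonneg fun j _ => Real.rpow_nonneg (hx j).le _
  refine le_of_eq_of_le ?_ h
  have h1 : ∀ a ∈ V, (∏ j, x j ^ a j) ^ w a = ∏ j, x j ^ (w a * a j) := by
    intro a _
    rw [← Real.finsetProd_rpow _ _ fun j _ => Real.rpow_nonneg (hx j).le _]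
    exact Finset.prod_congr rfl fun j _ => by rw [← Real.rpow_mul (hx j).le, mul_comm]
  rw [Finset.prod_congr rfl h1, Finset.prod_comm]
  refine Finset.prod_congr rfl fun j _ => ?_
  rw [← Real.rpow_sum_of_pos (hx j), ← hwb, Finset.sum_apply]
  simp

/-- A point with nonnegative barycentric coordinates in an affinely independent set yields a
circuit signomial supported on the vertices with positive coordinate. -/
theorem isCircuitSig_of_barycentric (V : Finset (Fin n → ℝ))
    (hV : AffineIndependent ℝ (fun p : {x // x ∈ V} => (p : Fin n → ℝ)))
    (w : (Fin n → ℝ) → ℝ) (b : Fin n → ℝ) (hw : ∀ a ∈ V, 0 ≤ w a) (hw1 : ∑ a ∈ V, w a = 1)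
    (hwb : ∑ a ∈ V, w a • a = b) (e : ℝ) (he : 0 < e) :
    IsCircuitSig (fun x : Fin n → ℝ =>
      e * (∑ a ∈ V, w a * ∏ j, x j ^ a j - ∏ j, x j ^ b j)) := by
  have hzero : ∀ a ∈ V, a ∉ V.filter (fun a => 0 < w a) → w a = 0 := by
    intro a ha hna
    rw [Finset.mem_filter, not_and, not_lt] at hna
    exact le_antisymm (hna ha) (hw a ha)
  refine Or.inr ⟨V.filter (fun a => 0 < w a), ?_, fun a => e * w a, ?_, e, he, b, ?_, ?_⟩
  · exact AffineIndependent.mono (s := {x | x ∈ V.filter (fun a => 0 < w a)})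
      (t := {x | x ∈ V}) hV fun a ha => (Finset.mem_filter.1 ha).1
  · exact fun a ha => mul_pos he (Finset.mem_filter.1 ha).2
  · have h1 : ∑ a ∈ V.filter (fun a => 0 < w a), w a = 1 := by
      rw [← hw1]
      exact Finset.sum_subset (Finset.filter_subset _ _) hzero
    have h2 : ∑ a ∈ V.filter (fun a => 0 < w a), w a • a = b := by
      rw [← hwb]
      exact Finset.sum_subset (Finset.filter_subset _ _) fun a ha hna => by
        rw [hzero a ha hna, zero_smul]
    rw [← h2]
    exact sum_smul_mem_intrinsicInterior_convexHull _ _ (fun a ha => (Finset.mem_filter.1 ha).2) h1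
  · intro x _
    have h3 : ∑ a ∈ V.filter (fun a => 0 < w a), e * w a * ∏ j, x j ^ a j =
        ∑ a ∈ V, e * w a * ∏ j, x j ^ a j :=
      Finset.sum_subset (Finset.filter_subset _ _) fun a ha hna => by
        rw [hzero a ha hna, mul_zero, zero_mul]
    rw [h3]
    simp only [mul_sub, Finset.mul_sum, mul_assoc]

/-- Barycentric coordinates of a point in the convex hull of an affinely independent set are
nonnegative. -/
theorem barycentric_nonneg {E : Type*} [AddCommGroup E] [Module ℝ E] (V : Finset E)
    (hV : AffineIndependent ℝ (fun p : {x // x ∈ V} => (p : E)))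
    (w : E → ℝ) (b : E) (hb : b ∈ convexHull ℝ (V : Set E)) (hw1 : ∑ a ∈ V, w a = 1)
    (hwb : ∑ a ∈ V, w a • a = b) : ∀ a ∈ V, 0 ≤ w a := by
  obtain ⟨u, hu0, hu1, hub⟩ := Finset.mem_convexHull'.1 hb
  intro a ha
  rw [hV.eq_of_sum_eq_sum_subtype (hw1.trans hu1.symm) (hwb.trans hub.symm) a ha]
  exact hu0 a ha

/-- Pairing the coefficients `qCoeff` with an arbitrary function on exponents. -/
theorem sum_qCoeff_mul_sub (Vj Am : Finset (Fin n → ℝ)) (hdisj : Disjoint Vj Am)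
    (lamj : (Fin n → ℝ) → (Fin n → ℝ) → ℝ) (c : (Fin n → ℝ) → ℝ) (δj : ℝ)
    (g : (Fin n → ℝ) → ℝ) :
    ∑ a ∈ Vj, qCoeff Vj lamj Am c δj a * g a - ∑ b ∈ Am, qCoeff Vj lamj Am c δj b * g b =
      ∑ b ∈ Am, δj * c b * (∑ a ∈ Vj, lamj b a * g a - g b) := by
  have h1 : ∀ a ∈ Vj, qCoeff Vj lamj Am c δj a * g a =
      ∑ b ∈ Am, δj * c b * (lamj b a * g a) := by
    intro a ha
    rw [qCoeff, if_pos ha, Finset.mul_sum, Finset.sum_mul]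
    exact Finset.sum_congr rfl fun b _ => by ring
  have h2 : ∀ b ∈ Am, qCoeff Vj lamj Am c δj b * g b = δj * c b * g b := by
    intro b hb
    rw [qCoeff, if_neg (Finset.disjoint_right.1 hdisj hb)]
  rw [Finset.sum_congr rfl h1, Finset.sum_congr rfl h2, Finset.sum_comm,
    ← Finset.sum_sub_distrib]
  exact Finset.sum_congr rfl fun b _ => by rw [mul_sub, Finset.mul_sum]

/-- A sum over a finset can be reindexed by `Fin m`, preserving a pointwise property. -/
theorem exists_fin_sum_eq {ι α : Type*} (s : Finset ι) (q : ι → α → ℝ)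
    (P : (α → ℝ) → Prop) (hP : ∀ i ∈ s, P (q i)) :
    ∃ m : ℕ, ∃ Q : Fin m → α → ℝ, (∀ j, P (Q j)) ∧ ∀ x, ∑ i ∈ s, q i x = ∑ j, Q j x := by
  refine ⟨s.card, fun j => q (s.equivFin.symm j), fun j => hP _ (s.equivFin.symm j).2, fun x => ?_⟩
  rw [Equiv.sum_comp s.equivFin.symm (fun i : s => q i x)]
  exact (Finset.sum_coe_sort s (fun i => q i x)).symm

/-- **Decomposing the critical system over a family of simplices.** Let `V₁,…,V_r ⊆ A₊`
be vertex sets of full-dimensional simplices each containing `A₋`, with barycentric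
coordinates `λ^b_{·,k}` (extended by `0` off `V_k`). Suppose `𝟙` is a positive singular
zero of the signomial `f`, and `δ ∈ ℝ^r` satisfies
`c_a = ∑_k δ_k (∑_{b} λ^b_{a,k} c_b)` for all `a ∈ A₊`. Then `∑ δ_k = 1`; and if all
`δ_k ≥ 0`, then `f = ∑_{j : δ_j>0} q_j` on the positive orthant, each `q_j` has `𝟙` as a
positive singular zero, each `q_j` is copositive, and `f` is a finite sum of copositive
circuit signomials. -/
theorem stmt15 {n r : ℕ} (Ap Am : Finset (Fin n → ℝ)) (hdisj : Disjoint Ap Am)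
    (hspan : affineSpan ℝ ((Ap ∪ Am : Finset (Fin n → ℝ)) : Set (Fin n → ℝ)) = ⊤)
    (V : Fin r → Finset (Fin n → ℝ))
    (hVsub : ∀ k, V k ⊆ Ap) (hVcard : ∀ k, (V k).card = n + 1)
    (hVaff : ∀ k, AffineIndependent ℝ (fun p : {x // x ∈ V k} => (p : Fin n → ℝ)))
    (hVconv : ∀ k, (Am : Set (Fin n → ℝ)) ⊆ convexHull ℝ ((V k : Set (Fin n → ℝ))))
    (lam : (Fin n → ℝ) → Fin r → (Fin n → ℝ) → ℝ)
    (hlam1 : ∀ b ∈ Am, ∀ k, ∑ a ∈ V k, lam b k a = 1)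
    (hlamb : ∀ b ∈ Am, ∀ k, ∑ a ∈ V k, lam b k a • a = b)
    (hlam0 : ∀ b ∈ Am, ∀ k, ∀ a, a ∉ V k → lam b k a = 0)
    (c : (Fin n → ℝ) → ℝ) (hc : ∀ a ∈ Ap ∪ Am, 0 < c a)
    (hone : IsPosSingZero Ap Am c 1)
    (δ : Fin r → ℝ)
    (hδ : ∀ a ∈ Ap, c a = ∑ k, δ k * ∑ b ∈ Am, lam b k a * c b) :
    (∑ k, δ k = 1) ∧
    ((∀ k, 0 ≤ δ k) →
      (∀ x : Fin n → ℝ, (∀ i, 0 < x i) →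
        signomial Ap Am c x = ∑ j ∈ Finset.univ.filter (fun j => 0 < δ j),
          signomial (V j) Am (qCoeff (V j) (fun b a => lam b j a) Am c (δ j)) x) ∧
      (∀ j, 0 < δ j →
        IsPosSingZero (V j) Am (qCoeff (V j) (fun b a => lam b j a) Am c (δ j)) 1) ∧
      (∀ j, 0 < δ j → ∀ x : Fin n → ℝ, (∀ i, 0 < x i) →
        0 ≤ signomial (V j) Am (qCoeff (V j) (fun b a => lam b j a) Am c (δ j)) x) ∧
      (∃ m : ℕ, ∃ Q : Fin m → (Fin n → ℝ) → ℝ,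
        (∀ j, IsCircuitSig (Q j) ∧ ∀ x : Fin n → ℝ, (∀ i, 0 < x i) → 0 ≤ Q j x) ∧
        ∀ x : Fin n → ℝ, (∀ i, 0 < x i) → signomial Ap Am c x = ∑ j, Q j x)) := by
  obtain ⟨-, hf1, -⟩ := hone
  simp only [signomial, Pi.one_apply, Real.one_rpow, Finset.prod_const_one, mul_one] at hf1
  have hext : ∀ b ∈ Am, ∀ k, ∀ g : (Fin n → ℝ) → ℝ,
      ∑ a ∈ Ap, lam b k a * g a = ∑ a ∈ V k, lam b k a * g a := by
    intro b hb k g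
    symm
    exact Finset.sum_subset (hVsub k) fun a _ ha => by rw [hlam0 b hb k a ha, zero_mul]
  have hpair : ∀ g : (Fin n → ℝ) → ℝ, ∑ a ∈ Ap, c a * g a =
      ∑ k, ∑ b ∈ Am, δ k * c b * ∑ a ∈ V k, lam b k a * g a := by
    intro g
    have h1 : ∀ a ∈ Ap, c a * g a = ∑ k, ∑ b ∈ Am, δ k * c b * (lam b k a * g a) := by
      intro a ha
      rw [hδ a ha, Finset.sum_mul]
      refine Finset.sum_congr rfl fun k _ => ?_
      rw [Finset.mul_sum, Finset.sum_mul]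
      exact Finset.sum_congr rfl fun b _ => by ring
    rw [Finset.sum_congr rfl h1, Finset.sum_comm]
    refine Finset.sum_congr rfl fun k _ => ?_
    rw [Finset.sum_comm]
    refine Finset.sum_congr rfl fun b hb => ?_
    rw [← Finset.mul_sum, hext b hb k g]
  have hAm : Am.Nonempty := by
    rw [Finset.nonempty_iff_ne_empty]
    rintro rfl
    rw [Finset.sum_empty, sub_zero] at hf1
    have hAp : Ap = ∅ := by
      by_contra hne
      have := Finset.sum_pos (fun a ha => hc a (Finset.mem_union_left _ ha))
        (Finset.nonempty_iff_ne_empty.2 hne)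
      linarith
    subst hAp
    simp at hspan
  have hC : 0 < ∑ b ∈ Am, c b :=
    Finset.sum_pos (fun b hb => hc b (Finset.mem_union_right _ hb)) hAm
  have hsum : ∑ k, δ k = 1 := by
    have h := hpair fun _ => 1
    simp only [mul_one] at h
    have h2 : ∀ k, ∑ b ∈ Am, δ k * c b * ∑ a ∈ V k, lam b k a = δ k * ∑ b ∈ Am, c b := by
      intro k
      rw [Finset.mul_sum]
      exact Finset.sum_congr rfl fun b hb => by rw [hlam1 b hb k, mul_one]
    rw [Finset.sum_congr rfl fun k _ => h2 k, ← Finset.sum_mul] at h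
    have h3 : (∑ k, δ k) * ∑ b ∈ Am, c b = 1 * ∑ b ∈ Am, c b := by linarith
    exact mul_right_cancel₀ hC.ne' h3
  refine ⟨hsum, fun hδ0 => ?_⟩
  have hVdisj : ∀ k, Disjoint (V k) Am := fun k => Finset.disjoint_of_subset_left (hVsub k) hdisj
  have hlamnn : ∀ b ∈ Am, ∀ k, ∀ a ∈ V k, 0 ≤ lam b k a := fun b hb k =>
    barycentric_nonneg (V k) (hVaff k) (lam b k) b (hVconv k hb) (hlam1 b hb k) (hlamb b hb k)
  have hq : ∀ j, ∀ x : Fin n → ℝ,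
      signomial (V j) Am (qCoeff (V j) (fun b a => lam b j a) Am c (δ j)) x =
        ∑ b ∈ Am, δ j * c b * (∑ a ∈ V j, lam b j a * ∏ i, x i ^ a i - ∏ i, x i ^ b i) :=
    fun j x => sum_qCoeff_mul_sub (V j) Am (hVdisj j) _ c (δ j) fun a => ∏ i, x i ^ a i
  have hdecomp : ∀ x : Fin n → ℝ, signomial Ap Am c x =
      ∑ j ∈ Finset.univ.filter (fun j => 0 < δ j),
        signomial (V j) Am (qCoeff (V j) (fun b a => lam b j a) Am c (δ j)) x := by
    intro x
    rw [Finset.sum_filter_of_ne]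
    · simp only [hq, mul_sub, Finset.sum_sub_distrib]
      rw [← hpair, signomial]
      congr 1
      simp only [mul_assoc]
      simp only [← Finset.mul_sum]
      rw [← Finset.sum_mul, hsum, one_mul]
    · intro j _ hne
      refine lt_of_le_of_ne (hδ0 j) fun h0 => hne ?_
      rw [hq]
      simp [← h0]
  have hterm : ∀ j, 0 < δ j → ∀ b ∈ Am, ∀ x : Fin n → ℝ, (∀ i, 0 < x i) →
      0 ≤ δ j * c b * (∑ a ∈ V j, lam b j a * ∏ i, x i ^ a i - ∏ i, x i ^ b i) := by
    intro j hj b hb x hx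
    refine mul_nonneg (mul_pos hj (hc b (Finset.mem_union_right _ hb))).le (sub_nonneg.2 ?_)
    exact prod_rpow_le_sum_mul_prod_rpow (V j) (lam b j) b x (hlamnn b hb j) (hlam1 b hb j)
      (hlamb b hb j) hx
  refine ⟨fun x _ => hdecomp x, fun j _ => ⟨fun _ => one_pos, ?_, fun i => ?_⟩, ?_, ?_⟩
  · rw [hq]
    refine Finset.sum_eq_zero fun b hb => ?_
    simp [hlam1 b hb j]
  · have h := sum_qCoeff_mul_sub (V j) Am (hVdisj j) (fun b a => lam b j a) c (δ j) fun a => a i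
    simp only [sigD, Pi.one_apply, Real.one_rpow, Finset.prod_const_one, mul_one]
    rw [h]
    refine Finset.sum_eq_zero fun b hb => ?_
    have hbi := congrFun (hlamb b hb j) i
    simp only [Finset.sum_apply, Pi.smul_apply, smul_eq_mul] at hbi
    rw [hbi, sub_self, mul_zero]
  · intro j hj x hx
    rw [hq]
    exact Finset.sum_nonneg fun b hb => hterm j hj b hb x hx
  · obtain ⟨m, Q, hQ, hQsum⟩ := exists_fin_sum_eq
      ((Finset.univ.filter fun j => 0 < δ j) ×ˢ Am)
      (fun p (x : Fin n → ℝ) => δ p.1 * c p.2 *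
        (∑ a ∈ V p.1, lam p.2 p.1 a * ∏ i, x i ^ a i - ∏ i, x i ^ p.2 i))
      (fun q => IsCircuitSig q ∧ ∀ x : Fin n → ℝ, (∀ i, 0 < x i) → 0 ≤ q x) (by
        rintro ⟨j, b⟩ hp
        obtain ⟨hj, hb⟩ := Finset.mem_product.1 hp
        replace hj : 0 < δ j := (Finset.mem_filter.1 hj).2
        exact ⟨isCircuitSig_of_barycentric (V j) (hVaff j) (lam b j) b (hlamnn b hb j)
          (hlam1 b hb j) (hlamb b hb j) _ (mul_pos hj (hc b (Finset.mem_union_right _ hb))),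
          hterm j hj b hb⟩)
    refine ⟨m, Q, hQ, fun x _ => ?_⟩
    rw [← hQsum, hdecomp, Finset.sum_product]
    exact Finset.sum_congr rfl fun j _ => hq j x
end

section
/- Let A₊, A₋ ⊆ ℤⁿ be disjoint finite sets with A := A₊ ∪ A₋ having affine span equal to ℝⁿ, A₋ ≠ ∅, and A₋ contained in the interior of conv(A₊). Let σ_a = +1 for a ∈ A₊ and σ_a = −1 for a ∈ A₋, and let h : A → ℤ satisfy h(a) = 0 for a ∈ A₊ and h(b) > 0 for b ∈ A₋. Then there exists a nonzero polynomial g in the variables (y_a)_{a∈A} with real coefficients such that for every c ∈ ℝ^A_{>0} with g(c) ≠ 0, the set {(t,x) ∈ (ℂ∖{0}) × (ℂ∖{0})ⁿ : ∑_{a∈A} σ_a c_a t^{h(a)} x^a = 0 and ∑_{a∈A} σ_a c_a a_i t^{h(a)} x^a = 0 for all i = 1,…,n} is finite. -/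
open Finset

attribute [local instance] Classical.propDecidable

/-- If a polynomial map has at most as many variables as components, then over a generic point
each coordinate takes only finitely many values on the fibre. -/
theorem MvPolynomial.exists_ne_zero_finite_coordinate {σ ι k K : Type*} [Finite σ] [Finite ι]
    [CommRing k] [IsDomain k] [CommRing K] [IsDomain K] [Algebra k K]
    (hcard : Nat.card σ ≤ Nat.card ι) (f : ι → MvPolynomial σ k) (s : σ) :
    ∃ g : MvPolynomial ι k, g ≠ 0 ∧ ∀ c : ι → K, MvPolynomial.aeval c g ≠ 0 →
      {z : K | ∃ v : σ → K, (∀ i, MvPolynomial.aeval v (f i) = c i) ∧ v s = z}.Finite := by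
  set F : Option ι → MvPolynomial σ k := fun o => o.elim (MvPolynomial.X s) f
  have hdep : ¬ AlgebraicIndependent k F := by
    intro hind
    have h1 := hind.lift_cardinalMk_le_trdeg
    rw [MvPolynomial.trdeg_of_isDomain, Cardinal.lift_lift, ← Nat.cast_card (α := Option ι),
      ← Nat.cast_card (α := σ), Cardinal.lift_natCast, Cardinal.lift_natCast, Nat.cast_le,
      Finite.card_option] at h1
    omega
  obtain ⟨P, hP0, hP⟩ : ∃ P, MvPolynomial.aeval F P = 0 ∧ P ≠ 0 := by
    rw [algebraicIndependent_iff] at hdep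
    push Not at hdep
    exact hdep
  set Q := MvPolynomial.optionEquivLeft k ι P with hQ
  have hQ0 : Q ≠ 0 := by simpa [hQ] using hP
  refine ⟨Q.leadingCoeff, by simpa using hQ0, fun c hc => ?_⟩
  set φ : MvPolynomial ι k →+* K := (MvPolynomial.aeval c : MvPolynomial ι k →ₐ[k] K).toRingHom
  have hmap : Q.map φ ≠ 0 := by
    intro h0
    apply hc
    simpa [φ] using congrArg (fun p => p.coeff Q.natDegree) h0
  refine (Polynomial.finite_setOfPred_isRoot hmap).subset ?_
  rintro z ⟨v, hv, rfl⟩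
  have key (R : MvPolynomial (Option ι) k) :
      Polynomial.eval₂ φ (v s) (MvPolynomial.optionEquivLeft k ι R) =
        MvPolynomial.aeval v (MvPolynomial.aeval F R) := by
    induction R using MvPolynomial.induction_on with
    | C a => simp [φ]
    | add p q hp hq => rw [map_add, Polynomial.eval₂_add, hp, hq, map_add, map_add]
    | mul_X p o hp =>
      rw [map_mul, Polynomial.eval₂_mul, hp, map_mul, map_mul, MvPolynomial.aeval_X]
      cases o <;> simp [φ, F, hv]
  rw [Set.mem_ofPred_eq, Polynomial.IsRoot, Polynomial.eval_map, key, hP0, map_zero]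

/-- A polynomial map with at most as many variables as components has finite generic fibres. -/
theorem MvPolynomial.exists_ne_zero_finite_fiber {σ ι k K : Type*} [Finite σ] [Finite ι]
    [CommRing k] [IsDomain k] [CommRing K] [IsDomain K] [Algebra k K]
    (hcard : Nat.card σ ≤ Nat.card ι) (f : ι → MvPolynomial σ k) :
    ∃ g : MvPolynomial ι k, g ≠ 0 ∧ ∀ c : ι → K, MvPolynomial.aeval c g ≠ 0 →
      {v : σ → K | ∀ i, MvPolynomial.aeval v (f i) = c i}.Finite := by
  have := Fintype.ofFinite σ
  choose g hg0 hg using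
    MvPolynomial.exists_ne_zero_finite_coordinate (K := K) hcard f
  refine ⟨∏ s, g s, Finset.prod_ne_zero_iff.mpr fun s _ => hg0 s, fun c hc => ?_⟩
  rw [map_prod, Finset.prod_ne_zero_iff] at hc
  refine (Set.Finite.pi' fun s => hg s c (hc s (Finset.mem_univ s))).subset ?_
  exact fun v hv s => ⟨v, hv, rfl⟩

/-- The complex kernel of a surjective real matrix is spanned by real vectors, as many as the
difference of the dimensions. -/
theorem Matrix.exists_real_parametrization_ker {κ ι : Type*} [Fintype κ] [Fintype ι]
    (M : Matrix κ ι ℝ) (hM : Function.Surjective M.mulVec) :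
    ∃ (d : ℕ) (B : Matrix ι (Fin d) ℝ), d + Fintype.card κ = Fintype.card ι ∧
      ∀ w : ι → ℂ, (∀ k, ∑ i, (M k i : ℂ) * w i = 0) →
        ∃ y : Fin d → ℂ, ∀ i, ∑ j, (B i j : ℂ) * y j = w i := by
  let b := Module.finBasis ℝ (LinearMap.ker M.mulVecLin)
  refine ⟨_, fun i j => (b j : ι → ℝ) i, ?_, fun w hw => ?_⟩
  · have h := LinearMap.finrank_range_add_finrank_ker M.mulVecLin
    rw [LinearMap.range_eq_top.mpr hM, finrank_top, Module.finrank_fintype_fun_eq_card,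
      Module.finrank_fintype_fun_eq_card] at h
    omega
  · have hre : (fun i => (w i).re) ∈ LinearMap.ker M.mulVecLin := by
      ext k
      simpa [Matrix.mulVec, dotProduct] using congrArg Complex.re (hw k)
    have him : (fun i => (w i).im) ∈ LinearMap.ker M.mulVecLin := by
      ext k
      simpa [Matrix.mulVec, dotProduct] using congrArg Complex.im (hw k)
    refine ⟨fun j => ⟨b.repr ⟨_, hre⟩ j, b.repr ⟨_, him⟩ j⟩, fun i => ?_⟩
    have h1 := congrFun (congrArg Subtype.val (b.sum_repr ⟨_, hre⟩)) i
    have h2 := congrFun (congrArg Subtype.val (b.sum_repr ⟨_, him⟩)) i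
    simp only [AddSubmonoidClass.coe_finsetSum, SetLike.val_smul, Finset.sum_apply,
      Pi.smul_apply, smul_eq_mul] at h1 h2
    apply Complex.ext
    · simpa [mul_comm] using h1
    · simpa [mul_comm] using h2

/-- The matrix whose columns are the points `(1, p i)`. -/
def homogenizedPoints {ι : Type*} {n : ℕ} (p : ι → Fin n → ℝ) : Matrix (Option (Fin n)) ι ℝ :=
  fun o i => o.elim 1 (p i)

theorem homogenizedPoints_mulVec_surjective {ι : Type*} [Fintype ι] {n : ℕ} (p : ι → Fin n → ℝ)
    (hp : affineSpan ℝ (Set.range p) = ⊤) :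
    Function.Surjective (homogenizedPoints p).mulVec := by
  have hpt (q : Fin n → ℝ) :
      ∃ w, (homogenizedPoints p).mulVec w = fun o => o.elim 1 q := by
    obtain ⟨w, hw, rfl⟩ := eq_affineCombination_of_mem_affineSpan_of_fintype
      (show q ∈ affineSpan ℝ (Set.range p) from hp ▸ AffineSubspace.mem_top ℝ _ q)
    refine ⟨w, funext fun o => ?_⟩
    rw [Finset.affineCombination_eq_linear_combination _ _ _ hw]
    cases o <;> simp [homogenizedPoints, Matrix.mulVec, dotProduct, hw, mul_comm]
  intro y
  obtain ⟨u, hu⟩ := hpt fun i => y (some i)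
  obtain ⟨v, hv⟩ := hpt 0
  refine ⟨u + (y none - 1) • v, ?_⟩
  rw [Matrix.mulVec_add, Matrix.mulVec_smul, hu, hv]
  ext o
  cases o <;> simp

/-- **Generic finiteness of the lifted critical system.** Let `(A₊,A₋)` be a
full-dimensional signed support in `ℤⁿ` with `A₋ ≠ ∅` inside the interior of
`conv(A₊)`, and `h` a height function lifting `A₋`. Then there is a nonzero polynomial
`g` in the coefficients such that whenever `g(c) ≠ 0` for positive coefficients `c`,
the critical system of the Viro polynomial has only finitely many solutions
`(t,x)` in the complex torus. -/
theorem stmt16 {n : ℕ} (Ap Am : Finset (Fin n → ℤ)) (hdisj : Disjoint Ap Am)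
    (hAmne : Am.Nonempty)
    (hspan : affineSpan ℝ
      (coeR '' ((Ap ∪ Am : Finset (Fin n → ℤ)) : Set (Fin n → ℤ))) = ⊤)
    (hAm : coeR '' (Am : Set (Fin n → ℤ)) ⊆
      interior (convexHull ℝ (coeR '' (Ap : Set (Fin n → ℤ)))))
    (h : (Fin n → ℤ) → ℤ) (hhp : ∀ a ∈ Ap, h a = 0) (hhm : ∀ b ∈ Am, 0 < h b) :
    ∃ g : MvPolynomial {a : Fin n → ℤ // a ∈ Ap ∪ Am} ℝ, g ≠ 0 ∧
      ∀ c : {a : Fin n → ℤ // a ∈ Ap ∪ Am} → ℝ, (∀ a, 0 < c a) →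
        MvPolynomial.eval c g ≠ 0 →
        {p : ℂ × (Fin n → ℂ) | p.1 ≠ 0 ∧ (∀ i, p.2 i ≠ 0) ∧
          (∑ a ∈ (Ap ∪ Am).attach,
            (if a.1 ∈ Ap then (1 : ℂ) else -1) * (c a : ℂ) * p.1 ^ h a.1
              * ∏ i, p.2 i ^ a.1 i = 0) ∧
          ∀ i : Fin n, ∑ a ∈ (Ap ∪ Am).attach,
            (if a.1 ∈ Ap then (1 : ℂ) else -1) * (c a : ℂ) * (a.1 i : ℂ) * p.1 ^ h a.1
              * ∏ i', p.2 i' ^ a.1 i' = 0}.Finite := by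
  set A := Ap ∪ Am with hA
  have hrange : Set.range (fun a : {a // a ∈ A} => coeR a.1) = coeR '' (A : Set (Fin n → ℤ)) := by
    ext; simp
  obtain ⟨d, B, hd, hB⟩ := Matrix.exists_real_parametrization_ker _
    (homogenizedPoints_mulVec_surjective (fun a : {a // a ∈ A} => coeR a.1) (hrange ▸ hspan))
  obtain ⟨m, hm⟩ : ∃ m : Fin n → ℤ, ∀ a ∈ A, a ≤ m := A.exists_le
  let ε : (Fin n → ℤ) → ℝ := fun a => if a ∈ Ap then 1 else -1
  have hε (a) : (ε a : ℂ) * ε a = 1 := by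
    by_cases ha : a ∈ Ap <;> simp [ε, ha]
  have hh : ∀ a ∈ A, 0 ≤ h a := fun a ha =>
    (Finset.mem_union.mp ha).elim (fun hp => (hhp a hp).ge) fun hm => (hhm a hm).le
  -- Pairs of a coefficient vector and a solution are parametrized by kernel vectors and points;
  -- inverting `t` and twisting by a monomial make this parametrization polynomial.
  let f : {a // a ∈ A} → MvPolynomial (Fin d ⊕ Option (Fin n)) ℝ := fun a =>
    MvPolynomial.C (ε a) * (∑ j, MvPolynomial.C (B a j) * MvPolynomial.X (.inl j)) *
      MvPolynomial.X (.inr none) ^ (h a).toNat *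
      ∏ i, MvPolynomial.X (.inr (some i)) ^ (m i - a.1 i).toNat
  obtain ⟨g, hg0, hg⟩ := MvPolynomial.exists_ne_zero_finite_fiber (K := ℂ)
    (by simpa using hd.le) f
  refine ⟨g, hg0, fun c _ hgc => ?_⟩
  have hgc' : MvPolynomial.aeval (fun a => (c a : ℂ)) g ≠ 0 := by
    have hcast := MvPolynomial.aeval_algebraMap_apply ℂ c g
    rw [show (fun a => (c a : ℂ)) = algebraMap ℝ ℂ ∘ c from rfl, hcast]
    simpa [MvPolynomial.aeval_eq_eval] using hgc
  refine ((hg _ hgc').image fun v => ((v (.inr none))⁻¹, fun i => v (.inr (some i)))).subset ?_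
  rintro ⟨t, x⟩ ⟨ht, hx, h0, h1⟩
  simp only at ht hx h0 h1
  let w : {a // a ∈ A} → ℂ := fun a =>
    (ε a * c a * t ^ h a.1 * ∏ i, x i ^ a.1 i) * (∏ i, x i ^ m i)⁻¹
  have hε' (a : Fin n → ℤ) : (if a ∈ Ap then (1 : ℂ) else -1) = ε a := by
    by_cases ha : a ∈ Ap <;> simp [ε, ha]
  simp only [hε', ← Finset.univ_eq_attach] at h0 h1
  obtain ⟨y, hy⟩ := hB w (by
    intro o
    cases o with
    | none =>
      simp only [homogenizedPoints, Option.elim, Complex.ofReal_one, one_mul, w]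
      rw [← Finset.sum_mul, h0, zero_mul]
    | some i =>
      simp only [homogenizedPoints, Option.elim, coeR, w]
      rw [← zero_mul (∏ i, x i ^ m i)⁻¹, ← h1 i, Finset.sum_mul]
      refine Finset.sum_congr rfl fun a _ => ?_
      push_cast
      ring)
  refine ⟨Sum.elim y fun o => o.elim t⁻¹ x, fun a => ?_, by simp⟩
  have hxm : ∏ i, x i ^ (m i - a.1 i).toNat = (∏ i, x i ^ m i) * (∏ i, x i ^ a.1 i)⁻¹ := by
    rw [← Finset.prod_inv_distrib, ← Finset.prod_mul_distrib]
    refine Finset.prod_congr rfl fun i _ => ?_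
    rw [← zpow_natCast, Int.toNat_of_nonneg (sub_nonneg.mpr (hm a a.2 i)), zpow_sub₀ (hx i),
      div_eq_mul_inv]
  have htm : t⁻¹ ^ (h a).toNat = (t ^ h a.1)⁻¹ := by
    rw [← zpow_natCast, Int.toNat_of_nonneg (hh a a.2), inv_zpow]
  have hp (e : Fin n → ℤ) : ∏ i, x i ^ e i ≠ 0 :=
    Finset.prod_ne_zero_iff.mpr fun i _ => zpow_ne_zero _ (hx i)
  have hm0 := hp m
  have ha0 := hp a.1
  have ht0 : t ^ h a.1 ≠ 0 := zpow_ne_zero _ ht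
  simp only [f, map_mul, map_sum, map_pow, map_prod, MvPolynomial.aeval_C, MvPolynomial.aeval_X,
    Sum.elim_inl, Sum.elim_inr, Option.elim, Complex.coe_algebraMap, hy, hxm, htm, w]
  field_simp
  linear_combination (c a : ℂ) * hε a.1
end

section
/- Let A₊, A₋ ⊆ ℝⁿ be disjoint finite sets with A := A₊ ∪ A₋, A₋ ≠ ∅, and such that every extreme point of conv(A) belongs to A₊. Fix coefficients c_a > 0 (a ∈ A) and h : A → ℝ with h(a) = 0 for a ∈ A₊ and h(b) > 0 for b ∈ A₋, and for t > 0 define the Viro signomial f_t(x) = ∑_{a∈A₊} c_a x^a − ∑_{b∈A₋} c_b t^{h(b)} x^b on ℝⁿ_{>0}. Then there exists T > 0 such that for every t ≥ T the equation f_t(x) = 0 has a solution x ∈ ℝⁿ_{>0}. -/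
open Finset

attribute [local instance] Classical.propDecidable

/-- A point of maximal Euclidean norm in a set is an extreme point of its convex hull. -/
theorem mem_extremePoints_convexHull_of_sum_sq_le {ι : Type*} [Fintype ι] {s : Set (ι → ℝ)}
    {p : ι → ℝ} (hp : p ∈ s) (hmax : ∀ a ∈ s, ∑ i, a i ^ 2 ≤ ∑ i, p i ^ 2) :
    p ∈ Set.extremePoints ℝ (convexHull ℝ s) := by
  have key : ∀ (x y : ι → ℝ) (u v : ℝ), u + v = 1 →
      ∑ i, (u • x + v • y) i ^ 2 =
        u * ∑ i, x i ^ 2 + v * ∑ i, y i ^ 2 - u * v * ∑ i, (x i - y i) ^ 2 := by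
    intro x y u v huv
    obtain rfl : v = 1 - u := by linarith
    simp only [Finset.mul_sum, ← Finset.sum_add_distrib, ← Finset.sum_sub_distrib]
    refine Finset.sum_congr rfl fun i _ => ?_
    simp only [Pi.add_apply, Pi.smul_apply, smul_eq_mul]
    ring
  have hball : ∀ x ∈ convexHull ℝ s, ∑ i, x i ^ 2 ≤ ∑ i, p i ^ 2 := by
    have hconv : Convex ℝ {x : ι → ℝ | ∑ i, x i ^ 2 ≤ ∑ i, p i ^ 2} := by
      intro x hx y hy u v hu hv huv
      simp only [Set.mem_ofPred_eq] at hx hy ⊢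
      rw [key x y u v huv]
      have h1 : 0 ≤ u * v * ∑ i, (x i - y i) ^ 2 := by positivity
      have h2 := mul_le_mul_of_nonneg_left hx hu
      have h3 := mul_le_mul_of_nonneg_left hy hv
      have h4 : u * ∑ i, p i ^ 2 + v * ∑ i, p i ^ 2 = ∑ i, p i ^ 2 := by
        rw [← add_mul, huv, one_mul]
      linarith
    exact fun x hx => convexHull_min (fun a ha => hmax a ha) hconv hx
  rw [mem_extremePoints_iff_left]
  refine ⟨subset_convexHull ℝ s hp, ?_⟩
  rintro x hx y hy ⟨u, v, hu, hv, huv, hpe⟩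
  have h1 := key x y u v huv
  rw [hpe] at h1
  have h2 := mul_le_mul_of_nonneg_left (hball x hx) hu.le
  have h3 := mul_le_mul_of_nonneg_left (hball y hy) hv.le
  have h4 : u * ∑ i, p i ^ 2 + v * ∑ i, p i ^ 2 = ∑ i, p i ^ 2 := by
    rw [← add_mul, huv, one_mul]
  have h5 : ∑ i, (x i - y i) ^ 2 ≤ 0 := by
    by_contra! hlt
    have := mul_pos (mul_pos hu hv) hlt
    linarith
  have h6 : x = y := by
    have h7 := (Finset.sum_eq_zero_iff_of_nonneg fun i _ => sq_nonneg (x i - y i)).1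
      (le_antisymm h5 (Finset.sum_nonneg fun i _ => sq_nonneg _))
    ext i
    have := pow_eq_zero_iff two_ne_zero |>.1 (h7 i (Finset.mem_univ i))
    linarith
  rw [← hpe, ← h6, ← add_smul, huv, one_smul]

/-- If `p` has maximal Euclidean norm, it strictly maximizes the linear form `⟨p, ·⟩`. -/
theorem sum_mul_lt_of_sum_sq_le {ι : Type*} [Fintype ι] {p a : ι → ℝ} (hne : a ≠ p)
    (hle : ∑ i, a i ^ 2 ≤ ∑ i, p i ^ 2) : ∑ i, p i * a i < ∑ i, p i * p i := by
  obtain ⟨i, hi⟩ := Function.ne_iff.1 hne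
  have h1 : 0 < ∑ i, (a i - p i) ^ 2 :=
    Finset.sum_pos' (fun i _ => sq_nonneg _)
      ⟨i, Finset.mem_univ i, by have := sub_ne_zero.2 hi; positivity⟩
  have h2 : ∑ i, (a i - p i) ^ 2 = ∑ i, a i ^ 2 - 2 * ∑ i, p i * a i + ∑ i, p i ^ 2 := by
    rw [Finset.mul_sum, ← Finset.sum_sub_distrib, ← Finset.sum_add_distrib]
    exact Finset.sum_congr rfl fun i _ => by ring
  have h3 : ∑ i, p i * p i = ∑ i, p i ^ 2 := Finset.sum_congr rfl fun i _ => by ring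
  linarith

/-- Exponential sums with slower rates are eventually dominated by a positive multiple of a
faster exponential. -/
theorem eventually_sum_mul_exp_lt {α : Type*} (S : Finset α) (d L : α → ℝ) {l k : ℝ}
    (hL : ∀ b ∈ S, L b < l) (hk : 0 < k) :
    ∀ᶠ s : ℝ in Filter.atTop,
      ∑ b ∈ S, d b * Real.exp (s * L b) < k * Real.exp (s * l) := by
  have hlim : Filter.Tendsto (fun s : ℝ => ∑ b ∈ S, d b * Real.exp (s * (L b - l)))
      Filter.atTop (nhds 0) := by
    rw [← Finset.sum_const_zero (s := S)]
    refine tendsto_finsetSum _ fun b hb => ?_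
    rw [← mul_zero (d b)]
    exact (Real.tendsto_exp_atBot.comp
      (Filter.tendsto_id.atTop_mul_const_of_neg (sub_neg.2 (hL b hb)))).const_mul _
  filter_upwards [hlim.eventually (gt_mem_nhds hk)] with s hs
  have h1 := mul_lt_mul_of_pos_right hs (Real.exp_pos (s * l))
  rw [Finset.sum_mul] at h1
  refine lt_of_eq_of_lt (Finset.sum_congr rfl fun b _ => ?_) h1
  rw [mul_assoc, ← Real.exp_add]
  ring_nf

theorem prod_exp_mul_rpow {ι : Type*} [Fintype ι] (s : ℝ) (p a : ι → ℝ) :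
    ∏ j, Real.exp (s * p j) ^ a j = Real.exp (s * ∑ j, p j * a j) := by
  rw [Finset.mul_sum, Real.exp_sum]
  refine Finset.prod_congr rfl fun j _ => ?_
  rw [← Real.exp_mul, mul_assoc]

/-- **Viro signomials lifting the negative support eventually have positive zeros.**
If all extreme points of `conv(A₊ ∪ A₋)` lie in `A₊`, `A₋ ≠ ∅`, and `h` is a height
function vanishing on `A₊` and positive on `A₋`, then the Viro signomial
`f_t(x) = ∑_{a∈A₊} c_a x^a − ∑_{b∈A₋} c_b t^{h(b)} x^b` has a positive zero for all
sufficiently large `t`. -/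
theorem stmt17 {n : ℕ} (Ap Am : Finset (Fin n → ℝ)) (hdisj : Disjoint Ap Am)
    (hAmne : Am.Nonempty)
    (hext : ∀ p ∈ Set.extremePoints ℝ
        (convexHull ℝ ((Ap ∪ Am : Finset (Fin n → ℝ)) : Set (Fin n → ℝ))), p ∈ Ap)
    (c : (Fin n → ℝ) → ℝ) (hc : ∀ a ∈ Ap ∪ Am, 0 < c a)
    (h : (Fin n → ℝ) → ℝ) (hhp : ∀ a ∈ Ap, h a = 0) (hhm : ∀ b ∈ Am, 0 < h b) :
    ∃ T : ℝ, 0 < T ∧ ∀ t : ℝ, T ≤ t → ∃ x : Fin n → ℝ, (∀ i, 0 < x i) ∧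
      ∑ a ∈ Ap, c a * ∏ j, x j ^ a j
        - ∑ b ∈ Am, c b * t ^ h b * ∏ j, x j ^ b j = 0 := by
  obtain ⟨b₀, hb₀⟩ := hAmne
  obtain ⟨p, hpA, hpmax⟩ := Finset.exists_max_image (Ap ∪ Am) (fun a => ∑ i, a i ^ 2)
    ⟨b₀, Finset.mem_union_right _ hb₀⟩
  have hpAp : p ∈ Ap := hext p (mem_extremePoints_convexHull_of_sum_sq_le
    (Finset.mem_coe.2 hpA) fun a ha => hpmax a (Finset.mem_coe.1 ha))
  have hlt : ∀ b ∈ Am, ∑ i, p i * b i < ∑ i, p i * p i := fun b hb =>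
    sum_mul_lt_of_sum_sq_le (fun hbp => Finset.disjoint_left.1 hdisj hpAp (hbp ▸ hb))
      (hpmax b (Finset.mem_union_right _ hb))
  have hlarge : ∀ᶠ t : ℝ in Filter.atTop, ∑ a ∈ Ap, c a < c b₀ * t ^ h b₀ :=
    ((tendsto_rpow_atTop (hhm b₀ hb₀)).const_mul_atTop
      (hc b₀ (Finset.mem_union_right _ hb₀))).eventually_gt_atTop _
  obtain ⟨T, hT⟩ := Filter.eventually_atTop.1 hlarge
  refine ⟨max T 1, by positivity, fun t ht => ?_⟩
  have ht0 : 0 < t := lt_of_lt_of_le one_pos ((le_max_right _ _).trans ht)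
  set F : ℝ → ℝ := fun s => ∑ a ∈ Ap, c a * Real.exp (s * ∑ j, p j * a j)
    - ∑ b ∈ Am, c b * t ^ h b * Real.exp (s * ∑ j, p j * b j) with hF
  have hF0 : F 0 ≤ 0 := by
    have h1 := Finset.single_le_sum (f := fun b => c b * t ^ h b)
      (fun b hb => mul_nonneg (hc b (Finset.mem_union_right _ hb)).le
        (Real.rpow_nonneg ht0.le _)) hb₀
    have h2 := hT t ((le_max_left _ _).trans ht)
    simp only [hF, zero_mul, Real.exp_zero, mul_one]
    linarith
  obtain ⟨s₁, hs₁, hs₁0⟩ := ((eventually_sum_mul_exp_lt Am (fun b => c b * t ^ h b)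
    (fun b => ∑ j, p j * b j) hlt (hc p hpA)).and (Filter.eventually_ge_atTop 0)).exists
  have hF1 : 0 ≤ F s₁ := by
    have h1 := Finset.single_le_sum (f := fun a => c a * Real.exp (s₁ * ∑ j, p j * a j))
      (fun a ha => mul_nonneg (hc a (Finset.mem_union_left _ ha)).le (Real.exp_pos _).le) hpAp
    simp only [hF]
    linarith
  have hcont : Continuous F := by fun_prop
  obtain ⟨s, -, hs⟩ := intermediate_value_Icc hs₁0 hcont.continuousOn ⟨hF0, hF1⟩
  refine ⟨fun j => Real.exp (s * p j), fun j => Real.exp_pos _, ?_⟩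
  simpa only [prod_exp_mul_rpow] using hs
end

section
/- Let A₊ ⊆ ℝⁿ be a finite set with conv(A₊) full dimensional, and let A₋ ⊆ ℝⁿ be a finite set disjoint from A₊. Let Λ be a nonempty finite collection of full-dimensional simplices, each of the form Δ = conv(V) with V ⊆ A₊ affinely independent of cardinality n+1, and set D := ⋂_{Δ∈Λ} Δ. Assume D has nonempty interior, interior(D) ⊆ interior(Δ) for every Δ ∈ Λ, and A₋ ⊆ D. Then the following are equivalent: (i) there exists a facet of D (a nonempty exposed face of D whose affine span has dimension n−1) containing A₋; (ii) there exist Δ ∈ Λ and a facet of Δ containing A₋. -/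
open Finset

attribute [local instance] Classical.propDecidable

/-- `Γ` is a facet of the full-dimensional compact convex set `K ⊆ ℝⁿ`: a nonempty
exposed face whose affine span has dimension `n − 1`. -/
def IsFacetOf {n : ℕ} (K Γ : Set (Fin n → ℝ)) : Prop :=
  Γ.Nonempty ∧ IsExposed ℝ K Γ ∧
    Module.finrank ℝ (affineSpan ℝ Γ).direction = n - 1

/-- The polyhedron cut out by the inequalities `0 ≤ g j x` for `j ∈ J`. -/
def polyhedron {n : ℕ} {ι : Type*} (g : ι → ((Fin n → ℝ) →ᵃ[ℝ] ℝ)) (J : Finset ι) :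
    Set (Fin n → ℝ) :=
  {x | ∀ j ∈ J, 0 ≤ g j x}

section Polyhedron

variable {n : ℕ} {ι : Type*} (g : ι → ((Fin n → ℝ) →ᵃ[ℝ] ℝ))

theorem AffineMap.apply_add_smul (f : (Fin n → ℝ) →ᵃ[ℝ] ℝ) (x v : Fin n → ℝ) (ε : ℝ) :
    f (x + ε • v) = f x + ε * f.linear v := by
  have := f.map_vadd x (ε • v)
  simp only [vadd_eq_add, map_smul, smul_eq_mul] at this
  rw [add_comm x, this, add_comm]

theorem eventually_add_smul_mem {s : Set (Fin n → ℝ)} {x : Fin n → ℝ} (hx : s ∈ nhds x)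
    (v : Fin n → ℝ) : ∃ ε : ℝ, 0 < ε ∧ x + ε • v ∈ s := by
  have hc : Filter.Tendsto (fun ε : ℝ => x + ε • v) (nhds 0) (nhds x) := by
    have : Continuous fun ε : ℝ => x + ε • v := by fun_prop
    simpa using this.tendsto 0
  have h := (hc.eventually hx).filter_mono (nhdsWithin_le_nhds (s := Set.Ioi 0))
  obtain ⟨ε, h₁, h₂⟩ := (h.and self_mem_nhdsWithin).exists
  exact ⟨ε, h₂, h₁⟩

theorem isOpen_forall_pos (J : Finset ι) : IsOpen {x | ∀ j ∈ J, 0 < g j x} := by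
  have : {x | ∀ j ∈ J, 0 < g j x} = ⋂ j ∈ J, {x | 0 < g j x} := by ext; simp
  rw [this]
  refine isOpen_biInter_finset fun j _ => isOpen_lt continuous_const ?_
  exact (g j).continuous_of_finiteDimensional

theorem mem_interior_polyhedron {J : Finset ι} {x : Fin n → ℝ} (hx : ∀ j ∈ J, 0 < g j x) :
    x ∈ interior (polyhedron g J) :=
  interior_maximal (fun _ hy j hj => (hy j hj).le) (isOpen_forall_pos g J) hx

theorem pos_of_mem_interior_polyhedron {J : Finset ι} {x : Fin n → ℝ}
    (hx : x ∈ interior (polyhedron g J)) {j : ι} (hj : j ∈ J) (hg : (g j).linear ≠ 0) :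
    0 < g j x := by
  obtain ⟨v, hv⟩ : ∃ v, (g j).linear v ≠ 0 := by
    by_contra! h
    exact hg (LinearMap.ext h)
  obtain ⟨ε, hε, h⟩ := eventually_add_smul_mem (mem_interior_iff_mem_nhds.1 hx)
    (-(g j).linear v • v)
  have := h j hj
  rw [AffineMap.apply_add_smul, map_smul, smul_eq_mul] at this
  nlinarith [mul_pos hε (mul_self_pos.2 hv)]

theorem exists_eq_zero_of_disjoint_interior {J : Finset ι} (hJ : J.Nonempty)
    {S : Set (Fin n → ℝ)} (hS : Convex ℝ S) (hSD : S ⊆ polyhedron g J)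
    (hd : Disjoint S (interior (polyhedron g J))) :
    ∃ j ∈ J, ∀ x ∈ S, g j x = 0 := by
  by_contra! h
  choose! s hs hne using h
  have hcard : (0 : ℝ) < (#J : ℝ) := by exact_mod_cast hJ.card_pos
  have hw : ∑ _j ∈ J, (#J : ℝ)⁻¹ = 1 := by
    rw [sum_const, nsmul_eq_mul, mul_inv_cancel₀ hcard.ne']
  have hmem : J.centerMass (fun _ => (#J : ℝ)⁻¹) s ∈ S :=
    hS.centerMass_mem (fun _ _ => by positivity) (by rw [hw]; exact one_pos) hs
  refine Set.disjoint_left.1 hd hmem (mem_interior_polyhedron g fun i hi => ?_)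
  have key : g i (J.centerMass (fun _ => (#J : ℝ)⁻¹) s) = ∑ j ∈ J, (#J : ℝ)⁻¹ * g i (s j) := by
    rw [← affineCombination_eq_centerMass hw, map_affineCombination _ _ _ hw,
      affineCombination_eq_linear_combination _ _ _ hw]
    simp
  rw [key]
  refine sum_pos' (fun j hj => mul_nonneg (by positivity) (hSD (hs j hj) i hi)) ⟨i, hi, ?_⟩
  exact mul_pos (by positivity) ((hSD (hs i hi) i hi).lt_of_ne' (hne i hi))

theorem isFacetOf_polyhedron {J : Finset ι} (hg : ∀ j ∈ J, (g j).linear ≠ 0)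
    (hint : (interior (polyhedron g J)).Nonempty) {j : ι} (hj : j ∈ J)
    (hirr : ∃ y, g j y < 0 ∧ ∀ i ∈ J, i ≠ j → 0 ≤ g i y) :
    IsFacetOf (polyhedron g J) (polyhedron g J ∩ {x | g j x = 0}) := by
  obtain ⟨x, hx⟩ := hint
  obtain ⟨y, hyj, hy⟩ := hirr
  have hpos : ∀ i ∈ J, 0 < g i x := fun i hi => pos_of_mem_interior_polyhedron g hx hi (hg i hi)
  have hxj := hpos j hj
  obtain ⟨z, hzj, hz⟩ : ∃ z, g j z = 0 ∧ ∀ i ∈ J, i ≠ j → 0 < g i z := by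
    have hd : 0 < g j x - g j y := by linarith
    refine ⟨AffineMap.lineMap x y (g j x / (g j x - g j y)), ?_, fun i hi hij => ?_⟩
    · rw [AffineMap.apply_lineMap, AffineMap.lineMap_apply_ring]
      field_simp
      ring
    · rw [AffineMap.apply_lineMap, AffineMap.lineMap_apply_ring]
      have ht : 0 < 1 - g j x / (g j x - g j y) := by
        rw [sub_pos, div_lt_one hd]
        linarith
      have := mul_pos ht (hpos i hi)
      have := mul_nonneg (div_pos hxj hd).le (hy i hi hij)
      linarith
  have hzD : z ∈ polyhedron g J ∩ {x | g j x = 0} := by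
    refine ⟨fun i hi => ?_, hzj⟩
    by_cases hij : i = j
    · exact (hij ▸ hzj).ge
    · exact (hz i hi hij).le
  refine ⟨⟨z, hzD⟩, fun _ => ⟨(-(g j).linear).toContinuousLinearMap, ?_⟩, ?_⟩
  · have hle : ∀ a b, (-(g j).linear).toContinuousLinearMap a ≤
        (-(g j).linear).toContinuousLinearMap b ↔ g j b ≤ g j a := by
      intro a b
      have := (g j).linearMap_vsub b a
      simp only [vsub_eq_sub, map_sub] at this
      simp only [LinearMap.coe_toContinuousLinearMap', LinearMap.neg_apply]
      constructor <;> intro <;> linarith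
    ext p
    simp only [hle, Set.mem_inter_iff, Set.mem_ofPred_eq]
    refine and_congr_right fun hp => ⟨fun h q hq => h ▸ hq j hj, fun h => ?_⟩
    exact le_antisymm (hzj ▸ h z hzD.1) (hp j hj)
  · have hdir : (affineSpan ℝ (polyhedron g J ∩ {x | g j x = 0})).direction
        = LinearMap.ker (g j).linear := by
      rw [direction_affineSpan]
      apply le_antisymm
      · rw [vectorSpan_def, Submodule.span_le]
        rintro _ ⟨p, hp, q, hq, rfl⟩
        have := (g j).linearMap_vsub p q
        rw [show g j p = 0 from hp.2, show g j q = 0 from hq.2] at this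
        simpa using this
      · intro v hv
        obtain ⟨ε, hε, h⟩ := eventually_add_smul_mem
          ((isOpen_forall_pos g (J.erase j)).mem_nhds
            (fun i hi => hz i (mem_of_mem_erase hi) (ne_of_mem_erase hi))) v
        have h0 : g j (z + ε • v) = 0 := by
          rw [AffineMap.apply_add_smul, hzj, LinearMap.mem_ker.1 hv]
          simp
        have hmem : z + ε • v ∈ polyhedron g J ∩ {x | g j x = 0} := by
          refine ⟨fun i hi => ?_, h0⟩
          by_cases hij : i = j
          · exact (hij ▸ h0).ge
          · exact (h i (mem_erase.2 ⟨hij, hi⟩)).le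
        have := vsub_mem_vectorSpan ℝ hmem hzD
        rw [vsub_eq_sub, add_sub_cancel_left] at this
        exact (Submodule.smul_mem_iff _ hε.ne').1 this
    rw [hdir]
    have := Module.Dual.finrank_ker_add_one_of_ne_zero (f := (g j).linear) (hg j hj)
    rw [Module.finrank_fin_fun] at this
    omega

/-- The constraints defining a polyhedron can be thinned out to an irredundant subfamily. -/
theorem exists_irredundant (J : Finset ι) :
    ∃ I ⊆ J, polyhedron g I = polyhedron g J ∧
      ∀ j ∈ I, ∃ y, g j y < 0 ∧ ∀ i ∈ I, i ≠ j → 0 ≤ g i y := by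
  obtain ⟨I, ⟨hIJ, hI⟩, hmin⟩ := exists_minimal_of_wellFoundedLT
    (fun I : Finset ι => I ⊆ J ∧ polyhedron g I = polyhedron g J) ⟨J, subset_rfl, rfl⟩
  refine ⟨I, hIJ, hI, fun j hj => ?_⟩
  by_contra! h
  refine notMem_erase j I (hmin ⟨(erase_subset j I).trans hIJ, ?_⟩ (erase_subset j I) hj)
  rw [← hI]
  refine subset_antisymm (fun y hy i hi => ?_) (fun y hy i hi => hy i (mem_of_mem_erase hi))
  by_cases hij : i = j
  · subst hij
    by_contra! hneg
    obtain ⟨k, hk, hki, hlt⟩ := h y hneg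
    exact hlt.not_ge (hy k (mem_erase.2 ⟨hki, hk⟩))
  · exact hy i (mem_erase.2 ⟨hij, hi⟩)

end Polyhedron

theorem IsFacetOf.disjoint_interior {n : ℕ} (hn : n ≠ 0) {K Γ : Set (Fin n → ℝ)}
    (h : IsFacetOf K Γ) : Disjoint Γ (interior K) := by
  obtain ⟨hne, hexp, hdim⟩ := h
  obtain ⟨l, hl⟩ := hexp hne
  rw [Set.disjoint_left]
  intro x hxΓ hx
  have hx' := hxΓ
  rw [hl] at hx'
  have hl0 : ∀ v, l v = 0 := by
    have hle : ∀ v, l v ≤ 0 := by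
      intro v
      obtain ⟨ε, hε, hm⟩ := eventually_add_smul_mem (mem_interior_iff_mem_nhds.1 hx) v
      have := hx'.2 _ hm
      rw [map_add, map_smul, smul_eq_mul] at this
      nlinarith
    intro v
    have := hle (-v)
    rw [map_neg] at this
    linarith [hle v]
  have hΓ : Γ = K := by
    rw [hl]
    ext y
    simp [hl0]
  have htop : affineSpan ℝ Γ = ⊤ := affineSpan_eq_top_of_nonempty_interior
    (hΓ ▸ ⟨x, interior_mono (subset_convexHull ℝ K) hx⟩)
  rw [htop, AffineSubspace.direction_top, finrank_top, Module.finrank_fin_fun] at hdim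
  omega

section Simplex

variable {n : ℕ}

theorem exists_affineBasis_of_card {V : Finset (Fin n → ℝ)} (hcard : #V = n + 1)
    (hV : AffineIndependent ℝ (fun p : {x // x ∈ V} => (p : Fin n → ℝ))) :
    ∃ b : AffineBasis {x // x ∈ V} ℝ (Fin n → ℝ), ∀ i, b i = i := by
  refine ⟨⟨fun p => p, hV, ?_⟩, fun _ => rfl⟩
  rw [hV.affineSpan_eq_top_iff_card_eq_finrank_add_one]
  simp [hcard]

theorem convexHull_eq_polyhedron {V : Finset (Fin n → ℝ)}
    (b : AffineBasis {x // x ∈ V} ℝ (Fin n → ℝ)) (hb : ∀ i, b i = i) :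
    convexHull ℝ (V : Set (Fin n → ℝ)) = polyhedron b.coord univ := by
  have hr : Set.range b = (V : Set (Fin n → ℝ)) := by
    ext x
    simp [hb]
  rw [← hr, b.convexHull_eq_nonneg_coord]
  simp [polyhedron]

theorem exists_coord_neg {ι : Type*} [Nontrivial ι] (b : AffineBasis ι ℝ (Fin n → ℝ)) (i : ι) :
    ∃ y, b.coord i y < 0 ∧ ∀ j, j ≠ i → 0 ≤ b.coord j y := by
  obtain ⟨k, hk⟩ := exists_ne i
  refine ⟨AffineMap.lineMap (b k) (b i) (-1 : ℝ), ?_, fun j hj => ?_⟩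
  · rw [AffineMap.apply_lineMap, AffineMap.lineMap_apply_ring, b.coord_apply_ne hk.symm,
      b.coord_apply_eq]
    norm_num
  · rw [AffineMap.apply_lineMap, AffineMap.lineMap_apply_ring, b.coord_apply_ne hj]
    by_cases hjk : j = k
    · subst hjk
      rw [b.coord_apply_eq]
      norm_num
    · rw [b.coord_apply_ne hjk]
      norm_num

theorem coord_linear_ne_zero {ι : Type*} [Nontrivial ι] (b : AffineBasis ι ℝ (Fin n → ℝ))
    (i : ι) : (b.coord i).linear ≠ 0 := by
  intro h
  obtain ⟨k, hk⟩ := exists_ne i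
  have := (b.coord i).linearMap_vsub (b i) (b k)
  rw [h, b.coord_apply_eq, b.coord_apply_ne hk.symm] at this
  simp at this

end Simplex

theorem isFacetOf_self_of_subsingleton {K : Set (Fin 0 → ℝ)} (hK : K.Nonempty) :
    IsFacetOf K K :=
  ⟨hK, IsExposed.refl K, Module.finrank_zero_of_subsingleton⟩

/-- **Facet criterion for nonseparable supports.** Let `Λ = {Δ₁,…,Δ_r}` be a nonempty
family of full-dimensional simplices with vertices in `A₊`, `D = ⋂ Δ_k`, with
`int D ≠ ∅`, `int D ⊆ int Δ_k` for all `k`, and `A₋ ⊆ D`. Then `A₋` is contained in a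
facet of `D` iff `A₋` is contained in a facet of some `Δ_k`. -/
theorem stmt18 {n r : ℕ} (hr : 0 < r) (Ap Am : Finset (Fin n → ℝ))
    (hdisj : Disjoint Ap Am)
    (hApfull : affineSpan ℝ (Ap : Set (Fin n → ℝ)) = ⊤)
    (V : Fin r → Finset (Fin n → ℝ))
    (hVsub : ∀ k, V k ⊆ Ap) (hVcard : ∀ k, (V k).card = n + 1)
    (hVaff : ∀ k, AffineIndependent ℝ (fun p : {x // x ∈ V k} => (p : Fin n → ℝ)))
    (D : Set (Fin n → ℝ))
    (hD : D = ⋂ k, convexHull ℝ ((V k : Set (Fin n → ℝ))))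
    (hDint : (interior D).Nonempty)
    (hDin : ∀ k, interior D ⊆ interior (convexHull ℝ ((V k : Set (Fin n → ℝ)))))
    (hAmD : (Am : Set (Fin n → ℝ)) ⊆ D) :
    (∃ Γ : Set (Fin n → ℝ), IsFacetOf D Γ ∧ (Am : Set (Fin n → ℝ)) ⊆ Γ) ↔
    (∃ k : Fin r, ∃ Γ : Set (Fin n → ℝ),
      IsFacetOf (convexHull ℝ ((V k : Set (Fin n → ℝ)))) Γ ∧
      (Am : Set (Fin n → ℝ)) ⊆ Γ) := by
  rcases eq_or_ne n 0 with rfl | hn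
  · have hDk : ∀ k, D ⊆ convexHull ℝ ((V k : Set (Fin 0 → ℝ))) := fun k =>
      hD ▸ Set.iInter_subset _ k
    have hDne := hDint.mono interior_subset
    exact ⟨fun _ => ⟨⟨0, hr⟩, _, isFacetOf_self_of_subsingleton (hDne.mono (hDk _)),
      hAmD.trans (hDk _)⟩, fun _ => ⟨D, isFacetOf_self_of_subsingleton hDne, hAmD⟩⟩
  choose b hb using fun k => exists_affineBasis_of_card (hVcard k) (hVaff k)
  have hΔ := fun k => convexHull_eq_polyhedron (b k) (hb k)
  have hnt : ∀ k, Nontrivial {x // x ∈ V k} := fun k => by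
    rw [← Fintype.one_lt_card_iff_nontrivial, Fintype.card_coe, hVcard k]
    omega
  let g : (Σ k, {x // x ∈ V k}) → ((Fin n → ℝ) →ᵃ[ℝ] ℝ) := fun j => (b j.1).coord j.2
  have hg : ∀ j, (g j).linear ≠ 0 := fun j => coord_linear_ne_zero (b j.1) j.2
  have hDg : D = polyhedron g univ := by
    rw [hD]
    ext x
    simp [hΔ, polyhedron, g, Sigma.forall]
  have hDΔ : ∀ k, D ⊆ polyhedron (b k).coord univ := fun k => by
    rw [← hΔ k, hD]
    exact Set.iInter_subset _ k
  have hDcvx : Convex ℝ D := hD ▸ convex_iInter fun k => convex_convexHull ℝ _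
  constructor
  · rintro ⟨Γ, hΓ, hAm⟩
    have hΓD : Γ ⊆ D := hΓ.2.1.subset
    have hne : (univ : Finset (Σ k, {x // x ∈ V k})).Nonempty :=
      ⟨⟨⟨0, hr⟩, (hnt _).to_nonempty.some⟩, mem_univ _⟩
    obtain ⟨⟨k, i⟩, -, h0⟩ := exists_eq_zero_of_disjoint_interior g hne
      (hΓ.2.1.convex hDcvx) (hDg ▸ hΓD) (hDg ▸ hΓ.disjoint_interior hn)
    have := hnt k
    obtain ⟨y, hy, hy'⟩ := exists_coord_neg (b k) i
    have hfacet := isFacetOf_polyhedron (b k).coord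
      (fun j _ => coord_linear_ne_zero (b k) j) (hDint.mono (interior_mono (hDΔ k)))
      (mem_univ i) ⟨y, hy, fun j _ => hy' j⟩
    rw [← hΔ k] at hfacet
    exact ⟨k, _, hfacet, fun x hx => ⟨hΔ k ▸ hDΔ k (hAmD hx), h0 x (hAm hx)⟩⟩
  · rintro ⟨k, Γ, hΓ, hAm⟩
    have hdis := hΓ.disjoint_interior hn
    obtain ⟨I, -, hI, hirr⟩ := exists_irredundant g univ
    rw [← hDg] at hI
    have hne : I.Nonempty := by
      rw [nonempty_iff_ne_empty]
      rintro rfl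
      have hDu : D = Set.univ := by
        rw [← hI]
        simp [polyhedron]
      obtain ⟨p, hp⟩ := hΓ.1
      exact Set.disjoint_left.1 hdis hp (hDin k (by simp [hDu]))
    obtain ⟨j, hj, h0⟩ := exists_eq_zero_of_disjoint_interior g hne
      (hDcvx.inter (hΓ.2.1.convex (convex_convexHull ℝ _))) (hI.symm ▸ Set.inter_subset_left)
      (hI.symm ▸ hdis.mono Set.inter_subset_right (hDin k))
    have hfacet := isFacetOf_polyhedron g (fun i _ => hg i) (hI.symm ▸ hDint) hj (hirr j hj)
    rw [hI] at hfacet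
    exact ⟨_, hfacet, fun x hx => ⟨hAmD hx, h0 x ⟨hAmD hx, hAm hx⟩⟩⟩
end

section
/- Let A₊ ⊆ ℝⁿ be a finite set and let D ⊆ ℝⁿ be a compact convex set with nonempty interior such that for every full-dimensional simplex Δ = conv(W) with W ⊆ A₊ affinely independent of cardinality n+1, either interior(D) ⊆ interior(Δ) or interior(D) ∩ interior(Δ) = ∅. Let V ⊆ A₊ be affinely independent with cardinality n+1 such that interior(D) ⊆ interior(conv(V)). Then for every a ∈ A₊ ∖ V there exists a unique w ∈ V such that the set (V ∖ {w}) ∪ {a} is affinely independent and interior(D) ⊆ interior(conv((V ∖ {w}) ∪ {a}))); in other words, there is a unique facet Γ_a of the simplex conv(V) such that conv(Γ_a ∪ {a}) is a full-dimensional simplex with vertices in A₊ whose interior contains interior(D). -/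
open Finset

attribute [local instance] Classical.propDecidable

/-- Replacing a vertex `b w` of an affine basis by a point off the hyperplane through the other
vertices preserves affine independence. -/
theorem AffineBasis.affineIndependent_update {ι E : Type*} [DecidableEq ι]
    [AddCommGroup E] [Module ℝ E] (b : AffineBasis ι ℝ E) {w : ι} {a : E} (ha : b.coord w a ≠ 0) :
    AffineIndependent ℝ (Function.update b w a) := by
  refine AffineIndependent.affineIndependent_of_notMem_span (i := w) ?_ fun h => ha ?_
  · convert! b.ind.comp_embedding (Function.Embedding.subtype (· ≠ w)) using 1
    funext x
    exact Function.update_of_ne x.2 _ _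
  · have hle : affineSpan ℝ (Function.update b w a '' {x | x ≠ w}) ≤
        (affineSpan ℝ {(0 : ℝ)}).comap (b.coord w) := by
      rw [affineSpan_le]
      rintro _ ⟨v, hv, rfl⟩
      have hv' : v ≠ w := hv
      simp [Function.update_of_ne hv', b.coord_apply_ne hv'.symm]
    simpa using hle h

/-- The coordinates of an interior point of the simplex obtained by replacing the vertex `b w` by
`a`. -/
theorem AffineBasis.exists_of_mem_interior_convexHull_update {ι E : Type*} [Fintype ι]
    [DecidableEq ι] [NormedAddCommGroup E] [NormedSpace ℝ E] [FiniteDimensional ℝ E]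
    (b : AffineBasis ι ℝ E) {w : ι} {a x : E}
    (hx : x ∈ interior (convexHull ℝ (Set.range (Function.update b w a)))) :
    ∃ t, 0 < t ∧ b.coord w x = t * b.coord w a ∧
      ∀ v ≠ w, t * b.coord v a < b.coord v x := by
  have htop : affineSpan ℝ (Set.range (Function.update b w a)) = ⊤ :=
    interior_convexHull_nonempty_iff_affineSpan_eq_top.1 ⟨x, hx⟩
  have hind : AffineIndependent ℝ (Function.update b w a) := by
    rw [affineIndependent_iff_finrank_vectorSpan_eq ℝ _
      (b.ind.affineSpan_eq_top_iff_card_eq_finrank_add_one.1 b.tot),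
      ← direction_affineSpan, htop, AffineSubspace.direction_top, finrank_top]
  let c : AffineBasis ι ℝ E := ⟨Function.update b w a, hind, htop⟩
  have hc : ⇑c = Function.update b w a := rfl
  rw [← hc, c.interior_convexHull] at hx
  have key (v : ι) : b.coord v x = ∑ i, c.coord i x * b.coord v (c i) := by
    conv_lhs => rw [← c.affineCombination_coord_eq_self x]
    rw [Finset.map_affineCombination _ _ _ (c.sum_coord_apply_eq_one x),
      Finset.affineCombination_eq_linear_combination _ _ _ (c.sum_coord_apply_eq_one x)]
    simp
  have hcw : c w = a := by simp [hc]
  have hcv (v : ι) (hv : v ≠ w) : c v = b v := by simp [hc, hv]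
  refine ⟨c.coord w x, hx w, ?_, fun v hv => ?_⟩
  · rw [key, Finset.sum_eq_single w, hcw]
    · intro i _ hi
      rw [hcv i hi, b.coord_apply_ne hi.symm, mul_zero]
    · simp
  · rw [key v, Fintype.sum_eq_add w v hv.symm, hcw, hcv v hv, b.coord_apply_eq]
    · linarith [hx v]
    · rintro i ⟨hiw, hiv⟩
      rw [hcv i hiw, b.coord_apply_ne hiv.symm, mul_zero]

/-- If all the coordinates of `x - t • a` are nonnegative and the one at `w` vanishes, then `x`
lies in the simplex obtained by replacing the vertex `b w` by `a`. -/
theorem AffineBasis.mem_convexHull_update {ι E : Type*} [Fintype ι] [DecidableEq ι]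
    [AddCommGroup E] [Module ℝ E] (b : AffineBasis ι ℝ E) {w : ι} {a x : E} {t : ℝ} (ht : 0 ≤ t)
    (hw : b.coord w x = t * b.coord w a) (h : ∀ v, t * b.coord v a ≤ b.coord v x) :
    x ∈ convexHull ℝ (Set.range (Function.update b w a)) := by
  let z : Option ι → E := fun o => o.elim a (Function.update b w a)
  let m : Option ι → ℝ := fun o => o.elim t fun v => b.coord v x - t * b.coord v a
  have hz : ∑ o, m o • z o = x := by
    have hterm (v : ι) : m (some v) • z (some v) = b.coord v x • b v - t • b.coord v a • b v := by
      by_cases hv : v = w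
      · subst hv
        simp [m, hw, smul_smul]
      · simp [m, z, hv, sub_smul, smul_smul]
    rw [Fintype.sum_option, Finset.sum_congr rfl fun v _ => hterm v, Finset.sum_sub_distrib,
      ← Finset.smul_sum, b.linear_combination_coord_eq_self, b.linear_combination_coord_eq_self]
    simp [m, z]
  rw [← hz]
  refine (convex_convexHull ℝ _).sum_mem ?_ ?_ ?_
  · rintro (_ | v) _
    · exact ht
    · exact sub_nonneg.2 (h v)
  · simp [m, Fintype.sum_option, Finset.sum_sub_distrib, ← Finset.mul_sum]
  · rintro (_ | v) _
    · exact subset_convexHull ℝ _ ⟨w, by simp [z]⟩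
    · exact subset_convexHull ℝ _ ⟨v, rfl⟩

/-- Some vertex can be exchanged for `a` such that the new simplex is nondegenerate and
contains `x`. -/
theorem AffineBasis.exists_mem_convexHull_update {ι E : Type*} [Fintype ι] [DecidableEq ι]
    [AddCommGroup E] [Module ℝ E] (b : AffineBasis ι ℝ E) (a : E) {x : E}
    (hx : ∀ v, 0 < b.coord v x) :
    ∃ w, b.coord w a ≠ 0 ∧ x ∈ convexHull ℝ (Set.range (Function.update b w a)) := by
  have hne : (Finset.univ.filter fun v => 0 < b.coord v a).Nonempty := by
    obtain ⟨v, -, hv⟩ := Finset.exists_lt_of_sum_lt (s := Finset.univ) (f := fun _ : ι => (0 : ℝ))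
      (g := fun v => b.coord v a) (by simp)
    exact ⟨v, by simpa using hv⟩
  obtain ⟨w, hw, hmin⟩ := Finset.exists_min_image _ (fun v => b.coord v x / b.coord v a) hne
  have hwpos : 0 < b.coord w a := by simpa using hw
  have ht : 0 < b.coord w x / b.coord w a := div_pos (hx w) hwpos
  refine ⟨w, hwpos.ne', b.mem_convexHull_update ht.le (div_mul_cancel₀ _ hwpos.ne').symm
    fun v => ?_⟩
  by_cases hv : 0 < b.coord v a
  · exact (le_div_iff₀ hv).1 (hmin v (by simpa using hv))
  · exact (mul_nonpos_of_nonneg_of_nonpos ht.le (not_lt.1 hv)).trans (hx v).le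

/-- Replacing one value of the inclusion of a finset replaces that element in its range. -/
theorem Finset.range_update_coe {α : Type*} [DecidableEq α] (V : Finset α)
    [DecidableEq {x // x ∈ V}] (a : α) (w : {x // x ∈ V}) :
    Set.range (Function.update (fun p : {x // x ∈ V} => (p : α)) w a) =
      ((insert a (V.erase w) : Finset α) : Set α) := by
  ext x
  simp only [Set.mem_range, Finset.coe_insert, Finset.coe_erase, Set.mem_insert_iff, Set.mem_sdiff,
    Set.mem_singleton_iff, Finset.mem_coe]
  constructor
  · rintro ⟨v, rfl⟩
    by_cases hv : v = w
    · simp [hv]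
    · simp [hv, Subtype.coe_ne_coe.2 hv]
  · rintro (rfl | ⟨hxV, hxw⟩)
    · exact ⟨w, by simp⟩
    · exact ⟨⟨x, hxV⟩, Function.update_of_ne (fun h => hxw (congrArg Subtype.val h)) _ _⟩

/-- **Unique vertex exchange for simplices containing a common cell.** Let `D` be a
compact convex set with nonempty interior such that the interior of `D` is either
contained in, or disjoint from, the interior of every full-dimensional simplex with
vertices in `A₊`. If `V ⊆ A₊` spans a full-dimensional simplex with
`int D ⊆ int(conv V)`, then for every `a ∈ A₊ ∖ V` there is a unique vertex `w ∈ V`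
such that replacing `w` by `a` yields again a full-dimensional simplex whose interior
contains `int D`. -/
theorem stmt19 {n : ℕ} (Ap : Finset (Fin n → ℝ)) (D : Set (Fin n → ℝ))
    (hDcompact : IsCompact D) (hDconv : Convex ℝ D) (hDint : (interior D).Nonempty)
    (hmeet : ∀ W : Finset (Fin n → ℝ), W ⊆ Ap → W.card = n + 1 →
      AffineIndependent ℝ (fun p : {x // x ∈ W} => (p : Fin n → ℝ)) →
      interior D ⊆ interior (convexHull ℝ (W : Set (Fin n → ℝ))) ∨
        interior D ∩ interior (convexHull ℝ (W : Set (Fin n → ℝ))) = ∅)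
    (V : Finset (Fin n → ℝ)) (hVsub : V ⊆ Ap) (hVcard : V.card = n + 1)
    (hVaff : AffineIndependent ℝ (fun p : {x // x ∈ V} => (p : Fin n → ℝ)))
    (hVD : interior D ⊆ interior (convexHull ℝ (V : Set (Fin n → ℝ)))) :
    ∀ a ∈ Ap, a ∉ V → ∃! w : Fin n → ℝ, w ∈ V ∧
      AffineIndependent ℝ
        (fun p : {x // x ∈ insert a (V.erase w)} => (p : Fin n → ℝ)) ∧
      interior D ⊆
        interior (convexHull ℝ ((insert a (V.erase w) : Finset (Fin n → ℝ)) :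
          Set (Fin n → ℝ))) := by
  intro a haA haV
  let b : AffineBasis {x // x ∈ V} ℝ (Fin n → ℝ) :=
    ⟨fun p => p, hVaff, hVaff.affineSpan_eq_top_iff_card_eq_finrank_add_one.2 (by simp [hVcard])⟩
  have hrange (w : {x // x ∈ V}) : Set.range (Function.update b w a) =
      ((insert a (V.erase w) : Finset (Fin n → ℝ)) : Set (Fin n → ℝ)) :=
    V.range_update_coe a w
  obtain ⟨x, hxD⟩ := hDint
  have hx : ∀ v, 0 < b.coord v x := by
    have hmem := hVD hxD
    have hbV : Set.range b = (V : Set (Fin n → ℝ)) := Subtype.range_coe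
    rwa [← hbV, b.interior_convexHull] at hmem
  obtain ⟨w, hwa, hxw⟩ := b.exists_mem_convexHull_update a hx
  have hind := b.affineIndependent_update hwa
  have hcard : (insert a (V.erase (w : Fin n → ℝ))).card = n + 1 := by
    rw [Finset.card_insert_of_notMem fun h => haV (Finset.mem_of_mem_erase h),
      Finset.card_erase_add_one w.2, hVcard]
  have hsub : insert a (V.erase (w : Fin n → ℝ)) ⊆ Ap :=
    Finset.insert_subset haA ((Finset.erase_subset _ _).trans hVsub)
  have hWaff : AffineIndependent ℝ
      (fun p : {x // x ∈ insert a (V.erase (w : Fin n → ℝ))} => (p : Fin n → ℝ)) := by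
    have h := hind.range
    rw [hrange] at h
    exact h
  have hWD : interior D ⊆ interior (convexHull ℝ
      ((insert a (V.erase (w : Fin n → ℝ)) : Finset (Fin n → ℝ)) : Set (Fin n → ℝ))) := by
    refine (hmeet _ hsub hcard hWaff).resolve_right fun hempty => ?_
    have hne : (interior (convexHull ℝ (Set.range (Function.update b w a)))).Nonempty :=
      interior_convexHull_nonempty_iff_affineSpan_eq_top.2
        (hind.affineSpan_eq_top_iff_card_eq_finrank_add_one.2 (by simp [hVcard]))
    have hcl : x ∈ closure (interior (convexHull ℝ (Set.range (Function.update b w a)))) := by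
      rw [(convex_convexHull ℝ _).closure_interior_eq_closure_of_nonempty_interior hne]
      exact subset_closure hxw
    obtain ⟨y, hyD, hy⟩ := mem_closure_iff.1 hcl _ isOpen_interior hxD
    rw [hrange] at hy
    exact (Set.eq_empty_iff_forall_notMem.1 hempty) y ⟨hyD, hy⟩
  refine ⟨w, ⟨w.2, hWaff, hWD⟩, ?_⟩
  rintro w' ⟨hw'V, -, hw'D⟩
  by_contra hne
  obtain ⟨t, ht, htw, htv⟩ := b.exists_of_mem_interior_convexHull_update (w := w) (a := a)
    (x := x) (by rw [hrange]; exact hWD hxD)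
  obtain ⟨s, hs, hsw, hsv⟩ := b.exists_of_mem_interior_convexHull_update (w := ⟨w', hw'V⟩)
    (a := a) (x := x) (by rw [hrange]; exact hw'D hxD)
  have hne' : (⟨w', hw'V⟩ : {x // x ∈ V}) ≠ w := fun h => hne (congrArg Subtype.val h)
  have h₁ := htv _ hne'
  have h₂ := hsv _ hne'.symm
  rw [hsw] at h₁
  rw [htw] at h₂
  have hpos₁ : 0 < b.coord w a :=
    (mul_pos_iff_of_pos_left ht).1 (by rw [← htw]; exact hx w)
  have hpos₂ : 0 < b.coord ⟨w', hw'V⟩ a :=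
    (mul_pos_iff_of_pos_left hs).1 (by rw [← hsw]; exact hx _)
  exact lt_asymm (lt_of_mul_lt_mul_right h₁ hpos₂.le) (lt_of_mul_lt_mul_right h₂ hpos₁.le)
end
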